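/- arXiv:1211.6766 — 4 statements merged into one kernel-verified Lean document; each statement's English description precedes it below -/
import Mathlib

section
/- Let ε ∈ (0,1), let P be a monotone increasing property of balanced bipartite graphs on 2n vertices, and let p′, p : ℕ → (0,1] satisfy p′(n) ≤ p(n) for all n and n²·p′(n) → ∞ as n → ∞. If asymptotically almost surely the global resilience of G(n,n,p′(n)) with respect to P is at least (1/2 − ε/4)·n²·p′(n), then asymptotically almost surely the global resilience of G(n,n,p(n)) with respect to P is at least (1/2 − ε/2)·n²·p(n). -/
open Finset

open Classical in
/-- Probability that the Bernoulli(`q`) random subset of `V` satisfies `P`. -/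
noncomputable def subsetProbOn {α : Type*} (V : Finset α) (q : ℝ) (P : Finset α → Prop) : ℝ :=
  ∑ A ∈ V.powerset, if P A then q ^ A.card * (1 - q) ^ (V.card - A.card) else 0

/-- Probability that the random bipartite graph `G(n,n,q)` satisfies `P`. -/
noncomputable def bipProb (n : ℕ) (q : ℝ) (P : Finset (Fin n × Fin n) → Prop) : ℝ :=
  subsetProbOn Finset.univ q P

/-- Bernoulli weight. -/
noncomputable def bw {α : Type*} (q : ℝ) (V A : Finset α) : ℝ :=
  q ^ A.card * (1 - q) ^ (V.card - A.card)

theorem bw_nonneg {α : Type*} {q : ℝ} (h0 : 0 ≤ q) (h1 : q ≤ 1) (V A : Finset α) :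
    0 ≤ bw q V A :=
  mul_nonneg (pow_nonneg h0 _) (pow_nonneg (by linarith) _)

theorem bw_sum {α : Type*} (q : ℝ) (V : Finset α) : ∑ A ∈ V.powerset, bw q V A = 1 := by
  unfold bw
  rw [Finset.sum_pow_mul_eq_add_pow]
  simp

theorem bw_sum_mem {α : Type*} [DecidableEq α] (q : ℝ) (V : Finset α) (x : α) (hx : x ∈ V) :
    ∑ A ∈ V.powerset, (if x ∈ A then bw q V A else 0) = q := by
  obtain ⟨W, hW, rfl⟩ : ∃ W, x ∉ W ∧ V = insert x W :=
    ⟨V.erase x, by simp, by rw [Finset.insert_erase hx]⟩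
  rw [Finset.sum_powerset_insert hW]
  have h1 : ∑ A ∈ W.powerset, (if x ∈ A then bw q (insert x W) A else 0) = 0 := by
    apply Finset.sum_eq_zero
    intro A hA
    rw [if_neg]
    intro h
    exact hW (Finset.mem_powerset.1 hA h)
  have h2 : ∑ A ∈ W.powerset, (if x ∈ insert x A then bw q (insert x W) (insert x A) else 0)
      = ∑ A ∈ W.powerset, q * bw q W A := by
    apply Finset.sum_congr rfl
    intro A hA
    have hxA : x ∉ A := fun h => hW (Finset.mem_powerset.1 hA h)
    rw [if_pos (Finset.mem_insert_self _ _)]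
    unfold bw
    rw [Finset.card_insert_of_notMem hW, Finset.card_insert_of_notMem hxA, Nat.add_sub_add_right]
    ring
  rw [h1, h2, ← Finset.mul_sum, bw_sum]
  ring

theorem bw_mean {α : Type*} [DecidableEq α] (q : ℝ) (V D : Finset α) (hD : D ⊆ V) :
    ∑ A ∈ V.powerset, bw q V A * ((A ∩ D).card : ℝ) = q * D.card := by
  have : ∀ A ∈ V.powerset, bw q V A * ((A ∩ D).card : ℝ)
      = ∑ x ∈ D, if x ∈ A then bw q V A else 0 := by
    intro A _
    rw [← Finset.sum_filter, Finset.sum_const, nsmul_eq_mul, Finset.filter_mem_eq_inter,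
      Finset.inter_comm]
    ring
  rw [Finset.sum_congr rfl this, Finset.sum_comm, Finset.sum_congr rfl
    (fun x hx => bw_sum_mem q V x (hD hx))]
  simp [mul_comm]

theorem bw_couple {α : Type*} [DecidableEq α] (p r : ℝ) (V B : Finset α) (hB : B ⊆ V) :
    ∑ A ∈ V.powerset, (if B ⊆ A then bw p V A * bw r A B else 0) = bw (p * r) V B := by
  rw [← Finset.sum_filter]
  have h : ∑ A ∈ V.powerset with B ⊆ A, bw p V A * bw r A B
      = ∑ C ∈ (V \ B).powerset, (p * r) ^ B.card *
        ((p * (1 - r)) ^ C.card * (1 - p) ^ ((V \ B).card - C.card)) := by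
    symm
    apply Finset.sum_bij' (fun C _ => B ∪ C) (fun A _ => A \ B)
    · intro C hC
      simp only [Finset.mem_powerset, Finset.mem_filter] at hC ⊢
      exact ⟨Finset.union_subset hB (hC.trans Finset.sdiff_subset), Finset.subset_union_left⟩
    · intro A hA
      simp only [Finset.mem_powerset, Finset.mem_filter] at hA ⊢
      exact Finset.sdiff_subset_sdiff hA.1 (le_refl _)
    · intro C hC
      simp only [Finset.mem_powerset] at hC
      ext x
      have := @hC x
      simp at this ⊢
      tauto
    · intro A hA
      simp only [Finset.mem_powerset, Finset.mem_filter] at hA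
      exact Finset.union_sdiff_of_subset hA.2
    · intro C hC
      simp only [Finset.mem_powerset] at hC
      have hd : Disjoint B C := Finset.disjoint_of_subset_right hC Finset.disjoint_sdiff
      unfold bw
      rw [Finset.card_union_of_disjoint hd, Finset.card_sdiff_of_subset hB, Nat.add_sub_cancel_left,
        Nat.sub_sub, pow_add, mul_pow, mul_pow]
      ring
  rw [h, ← Finset.mul_sum, Finset.sum_pow_mul_eq_add_pow, Finset.card_sdiff_of_subset hB]
  unfold bw
  congr 2
  ring

open Classical in
theorem subsetProbOn_compl {α : Type*} (V : Finset α) (q : ℝ) (P : Finset α → Prop) :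
    1 - subsetProbOn V q P = ∑ A ∈ V.powerset, if P A then 0 else bw q V A := by
  rw [← bw_sum q V, subsetProbOn, ← Finset.sum_sub_distrib]
  apply Finset.sum_congr rfl
  intro A _
  split_ifs <;> simp [bw]

open Classical in
theorem transfer_ineq {α : Type*} (V : Finset α) (p r c : ℝ) (hp0 : 0 ≤ p) (hp1 : p ≤ 1)
    (hr0 : 0 ≤ r) (hr1 : r ≤ 1) (Q Q' : Finset α → Prop)
    (h : ∀ A ⊆ V, ¬ Q A → c ≤ ∑ B ∈ A.powerset, if Q' B then 0 else bw r A B) :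
    c * (1 - subsetProbOn V p Q) ≤ 1 - subsetProbOn V (p * r) Q' := by
  rw [subsetProbOn_compl, subsetProbOn_compl]
  have e : ∑ B ∈ V.powerset, (if Q' B then 0 else bw (p * r) V B)
      = ∑ A ∈ V.powerset, bw p V A * ∑ B ∈ A.powerset, if Q' B then 0 else bw r A B := by
    have e1 : ∀ B ∈ V.powerset, (if Q' B then 0 else bw (p * r) V B)
        = ∑ A ∈ V.powerset, if B ⊆ A then bw p V A * (if Q' B then 0 else bw r A B) else 0 := by
      intro B hB
      split_ifs with hQ
      · simp
      · exact (bw_couple p r V B (Finset.mem_powerset.1 hB)).symm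
    rw [Finset.sum_congr rfl e1, Finset.sum_comm]
    apply Finset.sum_congr rfl
    intro A hA
    rw [← Finset.sum_filter, Finset.mul_sum]
    apply Finset.sum_congr _ (fun _ _ => rfl)
    ext B
    simp only [Finset.mem_powerset, Finset.mem_filter] at hA ⊢
    exact ⟨fun h => h.2, fun h => ⟨h.trans hA, h⟩⟩
  rw [e, Finset.mul_sum]
  apply Finset.sum_le_sum
  intro A hA
  have hw := bw_nonneg hp0 hp1 V A
  split_ifs with hQ
  · rw [mul_zero]
    apply mul_nonneg hw
    apply Finset.sum_nonneg
    intro B _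
    split_ifs
    · exact le_refl _
    · exact bw_nonneg hr0 hr1 A B
  · rw [mul_comm]
    exact mul_le_mul_of_nonneg_left (h A (Finset.mem_powerset.1 hA) hQ) hw

/-- **Claim 2.** Transference of global resilience from `G(n,n,p')` to `G(n,n,p)` for a
monotone increasing property `P`, when `p' ≤ p` and `n² p' → ∞`. -/
theorem resilience_transfer (ε : ℝ) (hε : 0 < ε ∧ ε < 1)
    (P : ∀ n : ℕ, Finset (Fin n × Fin n) → Prop)
    (hmono : ∀ n : ℕ, ∀ A B : Finset (Fin n × Fin n), A ⊆ B → P n A → P n B)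
    (p' p : ℕ → ℝ) (hp' : ∀ n, 0 < p' n ∧ p' n ≤ 1) (hp : ∀ n, 0 < p n ∧ p n ≤ 1)
    (hle : ∀ n, p' n ≤ p n)
    (hinf : Filter.Tendsto (fun n : ℕ => (n : ℝ) ^ 2 * p' n) Filter.atTop Filter.atTop)
    (hres : Filter.Tendsto
      (fun n : ℕ => bipProb n (p' n) (fun E =>
        ∀ D ⊆ E, (D.card : ℝ) < (1 / 2 - ε / 4) * (n : ℝ) ^ 2 * p' n → P n (E \ D)))
      Filter.atTop (nhds 1)) :
    Filter.Tendsto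
      (fun n : ℕ => bipProb n (p n) (fun E =>
        ∀ D ⊆ E, (D.card : ℝ) < (1 / 2 - ε / 2) * (n : ℝ) ^ 2 * p n → P n (E \ D)))
      Filter.atTop (nhds 1) := by
  classical
  obtain ⟨hε0, hε1⟩ := hε
  set c : ℝ := 1 - (1 / 2 - ε / 2) / (1 / 2 - ε / 4) with hc
  have hden : (0 : ℝ) < 1 / 2 - ε / 4 := by linarith
  have hcpos : 0 < c := by
    rw [hc, sub_pos, div_lt_one hden]
    linarith
  have key : ∀ n : ℕ, 0 < n → c * (1 - bipProb n (p n) (fun E =>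
        ∀ D ⊆ E, (D.card : ℝ) < (1 / 2 - ε / 2) * (n : ℝ) ^ 2 * p n → P n (E \ D)))
      ≤ 1 - bipProb n (p' n) (fun E =>
        ∀ D ⊆ E, (D.card : ℝ) < (1 / 2 - ε / 4) * (n : ℝ) ^ 2 * p' n → P n (E \ D)) := by
    intro n hn
    have hn' : (0 : ℝ) < n := by exact_mod_cast hn
    obtain ⟨hp0, hp1⟩ := hp n
    obtain ⟨hq0, hq1⟩ := hp' n
    have hr0 : 0 ≤ p' n / p n := by positivity
    have hr1 : p' n / p n ≤ 1 := (div_le_one hp0).2 (hle n)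
    have hpr : p n * (p' n / p n) = p' n := by field_simp
    unfold bipProb
    have T := transfer_ineq (Finset.univ : Finset (Fin n × Fin n)) (p n) (p' n / p n) c hp0.le hp1
      hr0 hr1 (fun E =>
        ∀ D ⊆ E, (D.card : ℝ) < (1 / 2 - ε / 2) * (n : ℝ) ^ 2 * p n → P n (E \ D))
      (fun E =>
        ∀ D ⊆ E, (D.card : ℝ) < (1 / 2 - ε / 4) * (n : ℝ) ^ 2 * p' n → P n (E \ D)) ?_
    · rw [hpr] at T
      exact T
    intro A _ hA
    push Not at hA
    obtain ⟨D, hDA, hDc, hDP⟩ := hA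
    set t : ℝ := (1 / 2 - ε / 4) * (n : ℝ) ^ 2 * p' n with ht
    have htpos : 0 < t := by positivity
    calc c ≤ 1 - (p' n / p n * D.card) / t := by
          rw [hc]
          apply sub_le_sub_left
          rw [div_le_iff₀ htpos, ht]
          calc p' n / p n * D.card ≤ p' n / p n * ((1 / 2 - ε / 2) * (n : ℝ) ^ 2 * p n) :=
                mul_le_mul_of_nonneg_left hDc.le hr0
            _ = (1 / 2 - ε / 2) * (n : ℝ) ^ 2 * (p n * (p' n / p n)) := by ring
            _ = (1 / 2 - ε / 2) / (1 / 2 - ε / 4) * (1 / 2 - ε / 4) * (n : ℝ) ^ 2 * p' n := by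
                rw [hpr, div_mul_cancel₀ _ hden.ne']
            _ = _ := by ring
      _ = ∑ B ∈ A.powerset, (bw (p' n / p n) A B
            - bw (p' n / p n) A B * ((B ∩ D).card : ℝ) / t) := by
          rw [Finset.sum_sub_distrib, bw_sum, ← Finset.sum_div, bw_mean _ _ _ hDA]
      _ ≤ _ := by
          apply Finset.sum_le_sum
          intro B hB
          have hBA := Finset.mem_powerset.1 hB
          have hw := bw_nonneg hr0 hr1 A B
          split_ifs with hQ
          · have hge : t ≤ ((B ∩ D).card : ℝ) := by
              by_contra hlt
              refine hDP (hmono n _ _ ?_ (hQ (B ∩ D) Finset.inter_subset_left (not_le.1 hlt)))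
              intro x hx
              simp only [Finset.mem_sdiff, Finset.mem_inter] at hx ⊢
              exact ⟨hBA hx.1, fun h => hx.2 ⟨hx.1, h⟩⟩
            rw [sub_nonpos, le_div_iff₀ htpos]
            exact mul_le_mul_of_nonneg_left hge hw
          · have : 0 ≤ bw (p' n / p n) A B * ((B ∩ D).card : ℝ) / t := by positivity
            linarith
  have lower : Filter.Tendsto (fun n : ℕ => 1 - (1 - bipProb n (p' n) (fun E =>
        ∀ D ⊆ E, (D.card : ℝ) < (1 / 2 - ε / 4) * (n : ℝ) ^ 2 * p' n → P n (E \ D))) / c)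
      Filter.atTop (nhds 1) := by
    have := ((hres.const_sub 1).div_const c).const_sub 1
    simpa using this
  refine tendsto_of_tendsto_of_tendsto_of_le_of_le' lower tendsto_const_nhds ?_ ?_
  · filter_upwards [Filter.eventually_gt_atTop 0] with n hn
    have := key n hn
    rw [sub_le_comm, le_div_iff₀ hcpos, mul_comm]
    exact this
  · refine Filter.Eventually.of_forall fun n => ?_
    rw [← sub_nonneg, bipProb, subsetProbOn_compl]
    apply Finset.sum_nonneg
    intro B _
    split_ifs
    · exact le_refl _
    · exact bw_nonneg (hp n).1.le (hp n).2 _ _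
end

section
/- Let k be a positive integer and let G be a simple graph on n vertices with more than 100·k·n^{1+1/k} edges. Then G contains a cycle of length 2k. -/
open Finset

/-- `G` contains a cycle of length `t`. -/
def HasCycleOfLength {V : Type*} (G : SimpleGraph V) (t : ℕ) : Prop :=
  ∃ (v : V) (c : G.Walk v v), c.IsCycle ∧ c.length = t


lemma bs_split {V : Type*} [DecidableEq V] (t : V → V → ℕ) (hs : ∀ u w, t u w = t w u)
    (h0 : ∀ u, t u u = 0) (S : Finset V) (v : V) (hv : v ∈ S) :
    ∑ u ∈ S, ∑ w ∈ S, t u w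
      = 2 * ∑ w ∈ S, t v w + ∑ u ∈ S.erase v, ∑ w ∈ S.erase v, t u w := by
  rw [← Finset.add_sum_erase S _ hv]
  have h1 : ∀ u ∈ S.erase v, ∑ w ∈ S, t u w = t v u + ∑ w ∈ S.erase v, t u w := by
    intro u _
    rw [← Finset.add_sum_erase S _ hv, hs]
  rw [Finset.sum_congr rfl h1, Finset.sum_add_distrib]
  have h2 : ∑ w ∈ S, t v w = ∑ w ∈ S.erase v, t v w := by
    rw [← Finset.add_sum_erase S _ hv, h0, zero_add]
  rw [h2]; ring

open Classical in
lemma bs_mindeg {V : Type*} (H : SimpleGraph V) (T : Finset V) (c : ℝ)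
    (h : 2 * c * (T.card : ℝ) < ((∑ v ∈ T, (T.filter (fun u => H.Adj v u)).card : ℕ) : ℝ)) :
    ∃ S ⊆ T, S.Nonempty ∧ ∀ v ∈ S, c < ((S.filter (fun u => H.Adj v u)).card : ℝ) := by
  induction T using Finset.strongInduction with
  | H T ih =>
    by_cases hg : ∀ v ∈ T, c < ((T.filter (fun u => H.Adj v u)).card : ℝ)
    · refine ⟨T, subset_rfl, ?_, hg⟩
      by_contra hne
      rw [Finset.not_nonempty_iff_eq_empty] at hne
      subst hne
      simp at h
    · push Not at hg
      obtain ⟨v, hv, hc⟩ := hg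
      have key := bs_split (fun u w => if H.Adj u w then 1 else 0)
        (by intro u w; simp [H.adj_comm]) (by simp) T v hv
      simp only [← Finset.card_filter] at key
      have hcard : ((T.erase v).card : ℝ) = T.card - 1 := by
        rw [Finset.card_erase_of_mem hv, Nat.cast_sub (Finset.card_pos.2 ⟨v, hv⟩)]; simp
      obtain ⟨S, hS, h1⟩ := ih (T.erase v) (Finset.erase_ssubset hv) (by
        rw [key] at h
        rw [hcard]
        push_cast at h ⊢
        linarith)
      exact ⟨S, hS.trans (Finset.erase_subset _ _), h1⟩

open Classical in
lemma bs_cut {V : Type*} [Fintype V] (H : SimpleGraph V) :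
    ∃ f : V → Bool, ∀ v, (univ.filter (fun u => H.Adj v u)).card
      ≤ 2 * (univ.filter (fun u => H.Adj v u ∧ f v ≠ f u)).card := by
  obtain ⟨f, hf⟩ := Finite.exists_max
    (fun f : V → Bool => ∑ u, ∑ w, if H.Adj u w ∧ f u ≠ f w then 1 else 0)
  refine ⟨f, fun v => ?_⟩
  have h1 := hf (Function.update f v (!f v))
  have hsp : ∀ g : V → Bool, _ := fun g => bs_split
    (fun u w => if H.Adj u w ∧ g u ≠ g w then 1 else 0)
        (by intro u w; simp [H.adj_comm, ne_comm]) (by simp) univ v (mem_univ v)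
  beta_reduce at hsp h1
  rw [hsp, hsp] at h1
  have h2 : ∑ u ∈ univ.erase v, ∑ w ∈ univ.erase v, (if H.Adj u w ∧
      Function.update f v (!f v) u ≠ Function.update f v (!f v) w then 1 else 0)
      = ∑ u ∈ univ.erase v, ∑ w ∈ univ.erase v, (if H.Adj u w ∧ f u ≠ f w then 1 else 0) := by
    refine Finset.sum_congr rfl fun u hu => Finset.sum_congr rfl fun w hw => ?_
    rw [Function.update_of_ne (Finset.ne_of_mem_erase hu),
      Function.update_of_ne (Finset.ne_of_mem_erase hw)]
  rw [h2] at h1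
  simp only [← Finset.card_filter] at h1
  have h3 : (univ.filter (fun w => H.Adj v w ∧
      Function.update f v (!f v) v ≠ Function.update f v (!f v) w))
      = univ.filter (fun w => H.Adj v w ∧ ¬ f v ≠ f w) := by
    ext w
    simp only [mem_filter, mem_univ, true_and]
    refine and_congr_right fun hw => ?_
    rw [Function.update_self, Function.update_of_ne hw.ne']
    cases f v <;> cases f w <;> simp
  rw [h3] at h1
  have h4 := Finset.card_filter_add_card_filter_not (s := univ.filter (fun u => H.Adj v u))
    (fun u => f v ≠ f u)
  rw [Finset.filter_filter, Finset.filter_filter] at h4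
  omega

section cyc
variable {V : Type*} {H : SimpleGraph V} {k : ℕ} {lev : V → ℕ} {p : V → V} {x : V}

lemma bs_lev_iter (hp : ∀ v, 0 < lev v → lev v ≤ k → H.Adj v (p v) ∧ lev (p v) + 1 = lev v)
    (v : V) (m : ℕ) (hm : m ≤ lev v) (hk : lev v ≤ k) : lev (p^[m] v) + m = lev v := by
  induction m with
  | zero => simp
  | succ m ih =>
    have := ih (by omega)
    rw [Function.iterate_succ_apply']
    have := (hp (p^[m] v) (by omega) (by omega)).2
    omega

lemma bs_ext (hp : ∀ v, 0 < lev v → lev v ≤ k → H.Adj v (p v) ∧ lev (p v) + 1 = lev v)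
    {a w : V} {i : ℕ} (ha : lev a = i) (hw : lev w = i) (hik : i ≤ k)
    (Q : H.Walk a w) (hQ : Q.IsPath) (hl : ∀ v ∈ Q.support, i ≤ lev v)
    (m : ℕ) (hm : m ≤ i) (hne : p^[m] a ≠ p^[m] w) :
    ∃ R : H.Walk (p^[m] a) (p^[m] w), R.IsPath ∧ R.length = Q.length + 2 * m ∧
      ∀ v ∈ R.support, i ≤ lev v + m := by
  induction m with
  | zero => exact ⟨Q, hQ, by simp, by simpa using hl⟩
  | succ m ih =>
    have hne' : p^[m] a ≠ p^[m] w := by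
      intro h; apply hne; rw [Function.iterate_succ_apply', Function.iterate_succ_apply', h]
    obtain ⟨R, hR, hlen, hs⟩ := ih (by omega) hne'
    have la := bs_lev_iter hp a m (by omega) (by omega)
    have lw := bs_lev_iter hp w m (by omega) (by omega)
    have aa := hp (p^[m] a) (by omega) (by omega)
    have aw := hp (p^[m] w) (by omega) (by omega)
    rw [Function.iterate_succ_apply', Function.iterate_succ_apply'] at *
    have n1 : p (p^[m] a) ∉ R.support := fun h => by have := hs _ h; omega
    have n2 : p (p^[m] w) ∉ R.support := fun h => by have := hs _ h; omega
    refine ⟨SimpleGraph.Walk.cons aa.1.symm (R.concat aw.1), ?_, ?_, ?_⟩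
    · rw [SimpleGraph.Walk.cons_isPath_iff]
      refine ⟨hR.concat n2 aw.1, ?_⟩
      rw [SimpleGraph.Walk.support_concat]
      simp [n1, hne]
    · simp [hlen]; ring
    · intro v hv
      rw [SimpleGraph.Walk.support_cons, SimpleGraph.Walk.support_concat] at hv
      simp at hv
      rcases hv with rfl | hv | rfl
      · omega
      · have := hs _ hv; omega
      · omega

lemma bs_close (hp : ∀ v, 0 < lev v → lev v ≤ k → H.Adj v (p v) ∧ lev (p v) + 1 = lev v)
    {a w : V} {i : ℕ} (ha : lev a = i) (hw : lev w = i) (hik : i ≤ k)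
    (Q : H.Walk a w) (hQ : Q.IsPath) (hl : ∀ v ∈ Q.support, i ≤ lev v)
    (m : ℕ) (hm : m + 1 ≤ i) (hne : p^[m] a ≠ p^[m] w) (heq : p^[m+1] a = p^[m+1] w) :
    ∃ (v : V) (c : H.Walk v v), c.IsCycle ∧ c.length = Q.length + 2 * (m + 1) := by
  obtain ⟨R, hR, hlen, hs⟩ := bs_ext hp ha hw hik Q hQ hl m (by omega) hne
  have la := bs_lev_iter hp a m (by omega) (by omega)
  have lw := bs_lev_iter hp w m (by omega) (by omega)
  have aa := hp (p^[m] a) (by omega) (by omega)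
  have aw := hp (p^[m] w) (by omega) (by omega)
  rw [Function.iterate_succ_apply', Function.iterate_succ_apply'] at heq
  rw [heq] at aa
  have n2 : p (p^[m] w) ∉ R.support := fun h => by have := hs _ h; omega
  refine ⟨_, SimpleGraph.Walk.cons aa.1.symm (R.concat aw.1), ?_, ?_⟩
  · rw [SimpleGraph.Walk.cons_isCycle_iff]
    refine ⟨hR.concat n2 aw.1, ?_⟩
    rw [SimpleGraph.Walk.edges_concat]
    simp only [List.concat_eq_append, List.mem_append, List.mem_singleton, not_or]
    refine ⟨fun h => n2 (R.fst_mem_support_of_mem_edges h), ?_⟩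
    intro h
    rw [Sym2.eq_swap, Sym2.congr_left] at h
    exact hne h
  · simp [hlen]; ring

open Classical in
lemma bs_greedy (S : Finset V) (hadj : ∀ u v, H.Adj u v → lev u ≤ k → lev v = lev u + 1 ∨ lev u = lev v + 1)
    {i : ℕ} (hik : i < k) (hS : ∀ v ∈ S, lev v = i ∨ lev v = i + 1) (c : ℕ)
    (hdeg : ∀ v ∈ S, c < (S.filter (fun u => H.Adj v u)).card) (g : V → V)
    (hg : ∀ z ∈ S, lev z = i + 1 → ∀ y ∈ S, ∀ y' ∈ S, H.Adj z y → H.Adj z y' → g y = g y')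
    (t : ℕ) (u : V) (hu : u ∈ S) (hui : lev u = i) (F : Finset V) (huF : u ∉ F)
    (hF : F.card + 2 * t ≤ c) :
    ∃ w, w ∈ S ∧ lev w = i ∧ g w = g u ∧ ∃ P : H.Walk u w, P.IsPath ∧ P.length = 2 * t ∧
      ∀ v ∈ P.support, v ∉ F ∧ i ≤ lev v := by
  induction t generalizing u F with
  | zero => exact ⟨u, hu, hui, rfl, SimpleGraph.Walk.nil, by simp, by simp, by simp [huF, hui]⟩
  | succ t ih =>
    have pick : ∀ v ∈ S, ∀ F : Finset V, F.card ≤ c → ∃ z ∈ S, H.Adj v z ∧ z ∉ F := by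
      intro v hv F hF
      obtain ⟨z, hz, hzF⟩ := Finset.exists_mem_notMem_of_card_lt_card
        (lt_of_le_of_lt hF (hdeg v hv))
      rw [mem_filter] at hz
      exact ⟨z, hz.1, hz.2, hzF⟩
    have c1 := Finset.card_insert_le u F
    obtain ⟨z, hzS, hz, hzF⟩ := pick u hu (insert u F) (by omega)
    have c2 := Finset.card_insert_le z (insert u F)
    obtain ⟨y, hyS, hy, hyF⟩ := pick z hzS (insert z (insert u F)) (by omega)
    have hzl : lev z = i + 1 := by
      have := hadj u z hz (by omega)
      have := hS z hzS
      omega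
    have hyl : lev y = i := by
      have := hadj z y hy (by omega)
      have := hS y hyS
      omega
    obtain ⟨w, hwS, hwl, hgw, P, hP, hlen, hPF⟩ := ih y hyS hyl (insert z (insert u F)) hyF (by omega)
    refine ⟨w, hwS, hwl, ?_, SimpleGraph.Walk.cons hz (SimpleGraph.Walk.cons hy P), ?_, ?_, ?_⟩
    · rw [hgw]; exact hg z hzS hzl y hyS u hu hy hz.symm
    · rw [SimpleGraph.Walk.cons_isPath_iff, SimpleGraph.Walk.cons_isPath_iff]
      refine ⟨⟨hP, fun h => by have := (hPF _ h).1; simp at this⟩, ?_⟩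
      rw [SimpleGraph.Walk.support_cons]
      simp only [List.mem_cons, not_or]
      exact ⟨hz.ne, fun h => by have := (hPF _ h).1; simp at this⟩
    · simp [hlen]; ring
    · intro v hv
      simp only [SimpleGraph.Walk.support_cons, List.mem_cons] at hv
      rcases hv with rfl | rfl | hv
      · exact ⟨huF, hui.ge⟩
      · exact ⟨fun h => hzF (by simp [h]), by omega⟩
      · have := hPF _ hv
        exact ⟨fun h => this.1 (by simp [h]), this.2⟩

open Classical in
lemma bs_layer (hp : ∀ v, 0 < lev v → lev v ≤ k → H.Adj v (p v) ∧ lev (p v) + 1 = lev v)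
    (hx : ∀ v, lev v = 0 → v = x)
    (hadj : ∀ u v, H.Adj u v → lev u ≤ k → lev v = lev u + 1 ∨ lev u = lev v + 1)
    (S : Finset V)
    {i : ℕ} (hik : i < k) (hS : ∀ v ∈ S, lev v = i ∨ lev v = i + 1) (hne : S.Nonempty)
    (hdeg : ∀ v ∈ S, 2 * k < (S.filter (fun u => H.Adj v u)).card) :
    HasCycleOfLength H (2 * k) := by
  have pick : ∀ v ∈ S, ∀ F : Finset V, F.card ≤ 2 * k → ∃ z ∈ S, H.Adj v z ∧ z ∉ F := by
    intro v hv F hF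
    obtain ⟨z, hz, hzF⟩ := Finset.exists_mem_notMem_of_card_lt_card
      (lt_of_le_of_lt hF (hdeg v hv))
    rw [mem_filter] at hz
    exact ⟨z, hz.1, hz.2, hzF⟩
  have hdown : ∀ z ∈ S, lev z = i + 1 → ∀ y ∈ S, H.Adj z y → lev y = i := by
    intro z hz hzl y hy h
    have := hadj z y h (by omega)
    have := hS y hy
    omega
  obtain ⟨z0, hz0, hz0l⟩ : ∃ z ∈ S, lev z = i + 1 := by
    obtain ⟨v, hv⟩ := hne
    rcases hS v hv with h | h
    · obtain ⟨z, hz, ha, -⟩ := pick v hv ∅ (by simp)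
      have := hadj v z ha (by omega)
      have := hS z hz
      exact ⟨z, hz, by omega⟩
    · exact ⟨v, hv, h⟩
  let Q : ℕ → Prop := fun h => ∀ z ∈ S, lev z = i + 1 → ∀ y ∈ S, ∀ y' ∈ S,
    H.Adj z y → H.Adj z y' → p^[h] y = p^[h] y'
  have hQi : Q i := by
    intro z hz hzl y hy y' hy' h h'
    have e1 := hdown z hz hzl y hy h
    have e2 := hdown z hz hzl y' hy' h'
    have f1 := bs_lev_iter hp y i (by omega) (by omega)
    have f2 := bs_lev_iter hp y' i (by omega) (by omega)
    rw [hx _ (show lev (p^[i] y) = 0 by omega), hx _ (show lev (p^[i] y') = 0 by omega)]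
  have hQ0 : ¬ Q 0 := by
    intro h
    obtain ⟨y, hy, ha, -⟩ := pick z0 hz0 ∅ (by simp)
    obtain ⟨y', hy', ha', hn⟩ := pick z0 hz0 {y} (by simp; omega)
    exact hn (by simpa using (h z0 hz0 hz0l y hy y' hy' ha ha').symm)
  have hex : ∃ h, Q h := ⟨i, hQi⟩
  obtain ⟨m, hm⟩ : ∃ m, Nat.find hex = m + 1 := by
    refine Nat.exists_eq_succ_of_ne_zero fun h => hQ0 ?_
    have := Nat.find_spec hex
    rwa [h] at this
  have hQm : Q (m + 1) := hm ▸ Nat.find_spec hex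
  have hmi : m + 1 ≤ i := hm ▸ Nat.find_min' hex hQi
  have hnQ : ¬ Q m := Nat.find_min hex (by omega)
  simp only [Q] at hnQ
  push Not at hnQ
  obtain ⟨z, hz, hzl, y1, hy1, y2, hy2, a1, a2, hd⟩ := hnQ
  obtain ⟨y3, hy3, a3, hn3⟩ := pick z hz {y1, y2} (Finset.card_le_two.trans (by omega))
  simp only [mem_insert, mem_singleton, not_or] at hn3
  have l1 := hdown z hz hzl y1 hy1 a1
  have l2 := hdown z hz hzl y2 hy2 a2
  have l3 := hdown z hz hzl y3 hy3 a3
  obtain ⟨w, hwS, hwl, hgw, P, hP, hlen, hPF⟩ := bs_greedy S hadj hik hS (2 * k) hdeg p^[m+1] hQm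
    (k - m - 2) y3 hy3 l3 {y1, y2, z} (by simp [hn3, a3.ne']) (by
      have : ({y1, y2, z} : Finset V).card ≤ 3 := Finset.card_le_three
      omega)
  have fin : ∀ a ∈ S, H.Adj z a → lev a = i → a ∈ ({y1, y2, z} : Finset V) → a ≠ y3 →
      p^[m] a ≠ p^[m] w → HasCycleOfLength H (2 * k) := by
    intro a ha haz hal hai ha3 hne
    have hPa : a ∉ P.support := fun h => (hPF _ h).1 hai
    have hPz : z ∉ P.support := fun h => (hPF _ h).1 (by simp)
    obtain ⟨v, c, hc, hcl⟩ := bs_close hp hal hwl hik.le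
      (SimpleGraph.Walk.cons haz.symm (SimpleGraph.Walk.cons a3 P))
      (by
        rw [SimpleGraph.Walk.cons_isPath_iff, SimpleGraph.Walk.cons_isPath_iff]
        refine ⟨⟨hP, hPz⟩, ?_⟩
        rw [SimpleGraph.Walk.support_cons]
        simp only [List.mem_cons, not_or]
        exact ⟨haz.ne', hPa⟩)
      (by
        intro v hv
        simp only [SimpleGraph.Walk.support_cons, List.mem_cons] at hv
        rcases hv with rfl | rfl | hv
        · omega
        · omega
        · exact (hPF _ hv).2)
      m hmi hne (by rw [hgw]; exact hQm z hz hzl a ha y3 hy3 haz a3)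
    refine ⟨v, c, hc, ?_⟩
    rw [hcl]
    simp [hlen]
    omega
  by_cases hw : p^[m] y1 = p^[m] w
  · exact fin y2 hy2 a2 l2 (by simp) (Ne.symm hn3.2) (fun h => hd (hw.trans h.symm))
  · exact fin y1 hy1 a1 l1 (by simp) (Ne.symm hn3.1) hw

end cyc

lemma bs_parity {V : Type*} {H : SimpleGraph V} {f : V → Bool} (hf : ∀ u v, H.Adj u v → f u ≠ f v)
    {u v : V} (w : H.Walk u v) : f u = f v ↔ Even w.length := by
  induction w with
  | nil => simp
  | cons h q ih =>
    rw [SimpleGraph.Walk.length_cons, Nat.even_add_one, ← ih]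
    have := hf _ _ h
    revert this
    generalize f _ = a
    generalize f _ = b
    generalize f _ = c
    revert a b c
    decide

open Classical in
lemma bs_levels {V : Type*} (H : SimpleGraph V) (f : V → Bool) (hf : ∀ u v, H.Adj u v → f u ≠ f v)
    (x : V) (k : ℕ) : ∃ (lev : V → ℕ) (p : V → V), lev x = 0 ∧
    (∀ v, 0 < lev v → lev v ≤ k → H.Adj v (p v) ∧ lev (p v) + 1 = lev v) ∧
    (∀ v, lev v = 0 → v = x) ∧
    (∀ u v, H.Adj u v → lev u ≤ k → lev v = lev u + 1 ∨ lev u = lev v + 1) := by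
  let lev : V → ℕ := fun v => if H.Reachable x v then H.dist x v else k + 1
  have hr : ∀ v, H.Reachable x v → lev v = H.dist x v := fun v h => if_pos h
  have hr' : ∀ v, lev v ≤ k → H.Reachable x v := by
    intro v h
    by_contra hn
    have : lev v = k + 1 := if_neg hn
    omega
  have hpar : ∀ v, H.Reachable x v → (f x = f v ↔ Even (H.dist x v)) := by
    intro v h
    obtain ⟨w, hw⟩ := h.exists_walk_length_eq_dist
    rw [← hw]; exact bs_parity hf w
  have hadj : ∀ u v, H.Adj u v → lev u ≤ k → lev v = lev u + 1 ∨ lev u = lev v + 1 := by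
    intro u v h hu
    have ru := hr' u hu
    have rv : H.Reachable x v := ru.trans h.reachable
    rw [hr u ru, hr v rv]
    have h1 := h.diff_dist_adj (u := x)
    have h2 : H.dist x u ≠ H.dist x v := by
      intro he
      have p1 := hpar u ru
      have p2 := hpar v rv
      rw [he, ← p2] at p1
      have := hf u v h
      revert p1 this
      generalize f _ = a
      generalize f _ = b
      generalize f _ = c
      revert a b c
      decide
    omega
  have hpar : ∀ v, ∃ q, 0 < lev v → lev v ≤ k → H.Adj v q ∧ lev q + 1 = lev v := by
    intro v
    by_cases hv : 0 < lev v ∧ lev v ≤ k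
    · have rv := hr' v hv.2
      obtain ⟨w, hw⟩ := rv.exists_walk_length_eq_dist
      rw [hr v rv] at hv
      have hn : ¬ w.Nil := by
        rw [SimpleGraph.Walk.not_nil_iff_lt_length]; omega
      have ha := w.adj_penultimate hn
      refine ⟨w.penultimate, fun _ _ => ⟨ha.symm, ?_⟩⟩
      have h1 : H.dist x w.penultimate ≤ w.dropLast.length := SimpleGraph.dist_le _
      have h2 : w.dropLast.length + 1 = w.length := SimpleGraph.Walk.length_dropLast_add_one hn
      have h3 := hadj v w.penultimate ha.symm (by rw [hr v rv]; exact hv.2)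
      rw [hr v rv, hr _ ⟨w.dropLast⟩] at *
      omega
    · exact ⟨v, fun h1 h2 => absurd ⟨h1, h2⟩ hv⟩
  choose p hp using hpar
  refine ⟨lev, p, ?_, hp, ?_, hadj⟩
  · rw [hr x (SimpleGraph.Reachable.refl x)]; simp
  · intro v hv
    have rv := hr' v (by omega)
    rw [hr v rv, rv.dist_eq_zero_iff] at hv
    exact hv.symm

open Classical in
lemma bs_count {V : Type*} [Fintype V] {H : SimpleGraph V} {k : ℕ} {lev : V → ℕ} {p : V → V} {x : V}
    (hp : ∀ v, 0 < lev v → lev v ≤ k → H.Adj v (p v) ∧ lev (p v) + 1 = lev v)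
    (hx : ∀ v, lev v = 0 → v = x)
    (hadj : ∀ u v, H.Adj u v → lev u ≤ k → lev v = lev u + 1 ∨ lev u = lev v + 1)
    (hno : ¬ HasCycleOfLength H (2 * k)) (L : ℕ → Finset V) (hL : ∀ i v, v ∈ L i ↔ lev v = i)
    (i : ℕ) (hik : i < k) :
    ∑ v ∈ L i, ((L (i + 1)).filter (fun u => H.Adj v u)).card
      = ∑ v ∈ L (i + 1), ((L i).filter (fun u => H.Adj v u)).card ∧
    ((∑ v ∈ L i, ((L (i + 1)).filter (fun u => H.Adj v u)).card : ℕ) : ℝ)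
      ≤ 2 * k * ((L i).card + (L (i + 1)).card) := by
  have hE : ∑ v ∈ L i, ((L (i + 1)).filter (fun u => H.Adj v u)).card
      = ∑ v ∈ L (i + 1), ((L i).filter (fun u => H.Adj v u)).card := by
    have := Finset.sum_card_bipartiteAbove_eq_sum_card_bipartiteBelow (s := L i) (t := L (i+1)) H.Adj
    simp only [Finset.bipartiteAbove, Finset.bipartiteBelow] at this
    rw [this]
    simp only [H.adj_comm]
  refine ⟨hE, ?_⟩
  by_contra hcon
  push Not at hcon
  have hdisj : Disjoint (L i) (L (i + 1)) := by
    rw [Finset.disjoint_left]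
    intro v h1 h2
    rw [hL] at h1 h2
    omega
  obtain ⟨S, hST, hne, hdeg⟩ := bs_mindeg H (L i ∪ L (i + 1)) (2 * k) (by
    rw [Finset.card_union_of_disjoint hdisj, Finset.sum_union hdisj]
    have h1 : ∑ v ∈ L i, ((L (i + 1)).filter (fun u => H.Adj v u)).card
        ≤ ∑ v ∈ L i, ((L i ∪ L (i + 1)).filter (fun u => H.Adj v u)).card :=
      Finset.sum_le_sum fun v _ => Finset.card_le_card
        (Finset.filter_subset_filter _ Finset.subset_union_right)
    have h2 : ∑ v ∈ L (i + 1), ((L i).filter (fun u => H.Adj v u)).card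
        ≤ ∑ v ∈ L (i + 1), ((L i ∪ L (i + 1)).filter (fun u => H.Adj v u)).card :=
      Finset.sum_le_sum fun v _ => Finset.card_le_card
        (Finset.filter_subset_filter _ Finset.subset_union_left)
    rw [← hE] at h2
    have h3 := add_le_add h1 h2
    have h4 := (Nat.cast_le (α := ℝ)).2 h3
    rw [Nat.cast_add] at h4
    refine lt_of_lt_of_le ?_ h4
    rw [Nat.cast_add (L i).card]
    linarith)
  refine hno (bs_layer hp hx hadj S hik ?_ hne ?_)
  · intro v hv
    have := hST hv
    rw [mem_union, hL, hL] at this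
    exact this
  · intro v hv
    have := hdeg v hv
    exact_mod_cast this

open Classical in
lemma bs_main {V : Type*} [Fintype V] (H : SimpleGraph V) (f : V → Bool)
    (hf : ∀ u v, H.Adj u v → f u ≠ f v) (k : ℕ) (hk : 1 ≤ k) (N : ℝ) (hN : 1 ≤ N)
    (hNk : N ^ k = Fintype.card V) (x : V) (T : Finset V) (hxT : x ∈ T)
    (hT : ∀ u v, H.Adj u v → v ∈ T)
    (hdeg : ∀ v ∈ T, 50 * k * N ≤ ((univ.filter (fun u => H.Adj v u)).card : ℝ)) :
    HasCycleOfLength H (2 * k) := by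
  by_contra hno
  obtain ⟨lev, p, hlx, hp, hx, hadj⟩ := bs_levels H f hf x k
  obtain ⟨L, hL⟩ : ∃ L : ℕ → Finset V, ∀ i v, v ∈ L i ↔ lev v = i :=
    ⟨fun i => univ.filter (fun v => lev v = i), by intro i v; simp⟩
  have hc := bs_count hp hx hadj hno L hL
  have hLT : ∀ i ≤ k, ∀ v ∈ L i, v ∈ T := by
    intro i hi v hv
    rw [hL] at hv
    rcases Nat.eq_zero_or_pos i with h | h
    · rw [hx v (by omega)]; exact hxT
    · exact hT _ _ (hp v (by omega) (by omega)).1.symm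
  have hkR : (1 : ℝ) ≤ k := by exact_mod_cast hk
  have hsum : ∀ i ≤ k, 50 * k * N * ((L i).card : ℝ)
      ≤ ((∑ v ∈ L i, (univ.filter (fun u => H.Adj v u)).card : ℕ) : ℝ) := by
    intro i hi
    push_cast
    have := Finset.card_nsmul_le_sum (L i)
      (fun v => ((univ.filter (fun u => H.Adj v u)).card : ℝ)) (50 * k * N)
      (fun v hv => hdeg v (hLT i hi v hv))
    rw [nsmul_eq_mul] at this
    linarith
  have step : ∀ i < k, 2 * N * ((L i).card : ℝ) ≤ (L (i + 1)).card := by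
    intro i
    induction i with
    | zero =>
      intro h0
      have h1 := hsum 0 (by omega)
      have h2 := (hc 0 h0).2
      have h3 : ∑ v ∈ L 0, (univ.filter (fun u => H.Adj v u)).card
          ≤ ∑ v ∈ L 0, ((L (0 + 1)).filter (fun u => H.Adj v u)).card := by
        refine Finset.sum_le_sum fun v hv => Finset.card_le_card fun u hu => ?_
        rw [mem_filter] at hu
        rw [hL] at hv
        rw [mem_filter, hL]
        have := hadj v u hu.2 (by omega)
        exact ⟨by omega, hu.2⟩
      have h4 := (Nat.cast_le (α := ℝ)).2 h3
      have h5 := h1.trans (h4.trans h2)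
      have h6 : (k : ℝ) * (50 * N * (L 0).card) ≤ k * (2 * ((L 0).card + (L (0 + 1)).card)) := by
        linarith
      have h7 := le_of_mul_le_mul_left h6 (by linarith)
      nlinarith [Nat.cast_nonneg (α := ℝ) (L 0).card]
    | succ i ih =>
      intro hi
      have ih := ih (by omega)
      have h1 := hsum (i + 1) (by omega)
      have h2 := (hc (i + 1) hi).2
      have h2' := hc i (by omega)
      have h3 : ∑ v ∈ L (i + 1), (univ.filter (fun u => H.Adj v u)).card
          ≤ ∑ v ∈ L (i + 1), ((L (i + 1 + 1)).filter (fun u => H.Adj v u)).card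
            + ∑ v ∈ L (i + 1), ((L i).filter (fun u => H.Adj v u)).card := by
        rw [← Finset.sum_add_distrib]
        refine Finset.sum_le_sum fun v hv => ?_
        refine (Finset.card_le_card (fun u hu => ?_)).trans (Finset.card_union_le _ _)
        rw [mem_filter] at hu
        rw [hL] at hv
        rw [mem_union, mem_filter, mem_filter, hL (i + 1 + 1), hL i]
        have := hadj v u hu.2 (by omega)
        rcases this with h | h
        · exact Or.inl ⟨by omega, hu.2⟩
        · exact Or.inr ⟨by omega, hu.2⟩
      rw [← h2'.1] at h3
      have h4 := (Nat.cast_le (α := ℝ)).2 h3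
      rw [Nat.cast_add] at h4
      have h5 := h1.trans (h4.trans (add_le_add h2 h2'.2))
      have h6 : (k : ℝ) * (50 * N * (L (i + 1)).card)
          ≤ k * (2 * ((L (i + 1)).card + (L (i + 1 + 1)).card) +
            2 * ((L i).card + (L (i + 1)).card)) := by
        linarith
      have h7 := le_of_mul_le_mul_left h6 (by linarith)
      have h8 : ((L i).card : ℝ) ≤ N * (L i).card :=
        le_mul_of_one_le_left (Nat.cast_nonneg _) hN
      have h9 : ((L (i + 1)).card : ℝ) ≤ N * (L (i + 1)).card :=
        le_mul_of_one_le_left (Nat.cast_nonneg _) hN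
      have h10 : (0 : ℝ) ≤ (L i).card := Nat.cast_nonneg _
      linarith
  have hpow : ∀ i ≤ k, (2 * N) ^ i ≤ ((L i).card : ℝ) := by
    intro i
    induction i with
    | zero =>
      intro _
      have : 1 ≤ (L 0).card := Finset.card_pos.2 ⟨x, by rw [hL]; exact hlx⟩
      simpa using this
    | succ i ih =>
      intro hi
      have h1 := ih (by omega)
      have h2 := step i (by omega)
      rw [pow_succ]
      nlinarith
  have h1 := hpow k le_rfl
  have h2 : ((L k).card : ℝ) ≤ Fintype.card V := by exact_mod_cast Finset.card_le_univ _
  rw [mul_pow, ← hNk] at *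
  have h3 : (2 : ℝ) ≤ 2 ^ k := by
    simpa using pow_le_pow_right₀ (show (1 : ℝ) ≤ 2 by norm_num) hk
  have h4 : (1 : ℝ) ≤ N ^ k := one_le_pow₀ hN
  nlinarith

open Classical in
lemma bs_all {V : Type*} [Fintype V] (G : SimpleGraph V) (k : ℕ) (hk : 1 ≤ k) (N : ℝ) (hN : 1 ≤ N)
    (hNk : N ^ k = Fintype.card V)
    (h : 2 * (100 * k * N) * ((univ : Finset V).card : ℝ)
      < ((∑ v, (univ.filter (fun u => G.Adj v u)).card : ℕ) : ℝ)) :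
    HasCycleOfLength G (2 * k) := by
  obtain ⟨T, -, ⟨x, hxT⟩, hTdeg⟩ := bs_mindeg G univ (100 * k * N) h
  obtain ⟨G1, hG1⟩ : ∃ G1 : SimpleGraph V, ∀ u v, G1.Adj u v ↔ G.Adj u v ∧ u ∈ T ∧ v ∈ T :=
    ⟨{ Adj := fun u v => G.Adj u v ∧ u ∈ T ∧ v ∈ T
       symm := ⟨fun u v h => ⟨h.1.symm, h.2.2, h.2.1⟩⟩
       loopless := ⟨fun u h => G.loopless.irrefl u h.1⟩ }, fun _ _ => Iff.rfl⟩
  obtain ⟨f, hf⟩ := bs_cut G1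
  obtain ⟨H, hH⟩ : ∃ H : SimpleGraph V, ∀ u v, H.Adj u v ↔ G1.Adj u v ∧ f u ≠ f v :=
    ⟨{ Adj := fun u v => G1.Adj u v ∧ f u ≠ f v
       symm := ⟨fun u v h => ⟨h.1.symm, h.2.symm⟩⟩
       loopless := ⟨fun u h => h.2 rfl⟩ }, fun _ _ => Iff.rfl⟩
  have hHG : H ≤ G := fun u v h => ((hG1 _ _).1 ((hH _ _).1 h).1).1
  obtain ⟨v, c, hc, hcl⟩ := bs_main H f (fun u v h => ((hH _ _).1 h).2) k hk N hN hNk x T hxT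
    (fun u v h => ((hG1 _ _).1 ((hH _ _).1 h).1).2.2) (by
      intro v hv
      have h1 := hTdeg v hv
      have h2 := hf v
      have h3 : (T.filter (fun u => G.Adj v u)).card ≤ (univ.filter (fun u => G1.Adj v u)).card := by
        refine Finset.card_le_card fun u hu => ?_
        rw [mem_filter] at hu
        rw [mem_filter]
        exact ⟨mem_univ _, (hG1 _ _).2 ⟨hu.2, hv, hu.1⟩⟩
      have h5 : (univ.filter (fun u => G1.Adj v u ∧ f v ≠ f u)).card
          ≤ (univ.filter (fun u => H.Adj v u)).card := by
        refine Finset.card_le_card fun u hu => ?_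
        rw [mem_filter] at hu ⊢
        exact ⟨hu.1, (hH _ _).2 hu.2⟩
      have h4 : ((T.filter (fun u => G.Adj v u)).card : ℝ)
          ≤ 2 * ((univ.filter (fun u => H.Adj v u)).card : ℝ) := by
        exact_mod_cast h3.trans (h2.trans (Nat.mul_le_mul_left 2 h5))
      linarith)
  exact ⟨v, c.mapLe hHG, hc.mapLe hHG, by simpa using hcl⟩

/-- **Bondy–Simonovits.** A graph on `n` vertices with more than `100 k n^(1+1/k)` edges
contains a cycle of length `2k`. -/
theorem bondy_simonovits (k n : ℕ) (hk : 1 ≤ k) (G : SimpleGraph (Fin n))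
    [DecidableRel G.Adj]
    (h : 100 * (k : ℝ) * (n : ℝ) ^ ((1 : ℝ) + 1 / (k : ℝ)) < (G.edgeFinset.card : ℝ)) :
    HasCycleOfLength G (2 * k) := by
  have hkR : (1 : ℝ) ≤ k := by exact_mod_cast hk
  have hn : 1 ≤ n := by
    rcases Nat.eq_zero_or_pos n with h0 | h0
    · exfalso
      subst h0
      have : G.edgeFinset.card = 0 := by
        rw [Finset.card_eq_zero, Finset.eq_empty_iff_forall_notMem]
        intro e
        induction e with
        | _ a b => exact a.elim0
      rw [this, Nat.cast_zero] at h
      have : (0 : ℝ) ≤ 100 * (k : ℝ) * ((0 : ℕ) : ℝ) ^ ((1 : ℝ) + 1 / (k : ℝ)) := by positivity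
      linarith
    · exact h0
  have hnR : (1 : ℝ) ≤ n := by exact_mod_cast hn
  obtain ⟨N, hNdef⟩ : ∃ N : ℝ, N = (n : ℝ) ^ (1 / (k : ℝ)) := ⟨_, rfl⟩
  have hN : 1 ≤ N := by rw [hNdef]; exact Real.one_le_rpow hnR (by positivity)
  have hNk : N ^ k = n := by
    rw [hNdef, one_div]
    exact Real.rpow_inv_natCast_pow (by linarith) (by omega)
  rw [Real.rpow_add (by linarith), Real.rpow_one, ← hNdef] at h
  exact bs_all G k hk N hN (by simpa using hNk) (by
    have hs := G.sum_degrees_eq_twice_card_edges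
    have : ∑ v ∈ (univ : Finset (Fin n)), (univ.filter (fun u => G.Adj v u)).card
        = 2 * G.edgeFinset.card := by
      rw [← hs]
      refine Finset.sum_congr rfl fun v _ => ?_
      rw [← SimpleGraph.card_neighborFinset_eq_degree, SimpleGraph.neighborFinset_eq_filter]
    rw [Finset.card_univ, Fintype.card_fin]
    have h2 : (100 * (k : ℝ) * N) * n < (G.edgeFinset.card : ℝ) := by linarith
    have h3 : 2 * (100 * (k : ℝ) * N) * n < ((2 * G.edgeFinset.card : ℕ) : ℝ) := by
      push_cast; linarith
    rw [← this] at h3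
    convert h3)
end

section
/- For every fixed integer l ≥ 2 and every ε ∈ (0,1), there exists a constant C > 0 such that if p : ℕ → (0,1] satisfies p(n) ≥ C·n^{-1+1/(2l−1)} for all sufficiently large n, then asymptotically almost surely the binomial random graph G(n,p(n)) satisfies the following: every subgraph G′ of G(n,p(n)) with at least (1+ε)·n²·p(n)/8 edges contains a cycle of length 2l. -/
open Finset

/-- Probability that the binomial random graph `G(n,q)` satisfies `P` (samples are the
sets of present unordered pairs of distinct vertices). -/
noncomputable def gnpProb (n : ℕ) (q : ℝ)
    (P : Finset {e : Sym2 (Fin n) // ¬ e.IsDiag} → Prop) : ℝ :=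
  subsetProbOn Finset.univ q P

/-- The simple graph on `Fin n` determined by a set of unordered pairs. -/
def gnpGraph {n : ℕ} (E : Finset {e : Sym2 (Fin n) // ¬ e.IsDiag}) : SimpleGraph (Fin n) :=
  SimpleGraph.fromEdgeSet {e | ∃ x ∈ E, (x : Sym2 (Fin n)) = e}

set_option linter.unusedSectionVars false

namespace CC
variable {V : Type*} [Fintype V] [DecidableEq V]

def Cont (F0 : Set (Finset V)) (k m : ℝ) : Prop :=
  ∃ F C : Finset V → Finset V, ∀ I ∈ F0, F I ⊆ I ∧ ((F I).card : ℝ) ≤ k ∧ I ⊆ C I ∧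
    ((C I).card : ℝ) ≤ m ∧ ∀ S, F I ⊆ S → S ⊆ I → C S = C I

lemma Cont.mono {F0 : Set (Finset V)} {k k' m : ℝ} (h : Cont F0 k m) (hk : k ≤ k') :
    Cont F0 k' m := by
  obtain ⟨F, C, h⟩ := h
  refine ⟨F, C, fun I hI => ?_⟩
  obtain ⟨h1, h2, h3⟩ := h I hI
  exact ⟨h1, h2.trans hk, h3⟩

lemma Cont.leaf {F0 : Set (Finset V)} {k m : ℝ} (C0 : Finset V) (hk : 0 ≤ k)
    (hC : (C0.card : ℝ) ≤ m) (h : ∀ I ∈ F0, I ⊆ C0) : Cont F0 k m :=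
  ⟨fun _ => ∅, fun _ => C0, fun I hI => ⟨by simp, by simpa using hk, h I hI, hC, by simp⟩⟩

lemma Cont.branch {F0 : Set (Finset V)} {k m : ℝ} (v : V)
    (hy : Cont {I | I ∈ F0 ∧ v ∈ I} (k - 1) m) (hn : Cont {I | I ∈ F0 ∧ v ∉ I} k m) :
    Cont F0 k m := by
  obtain ⟨F, C, h⟩ := hy
  obtain ⟨F', C', h'⟩ := hn
  refine ⟨fun I => if v ∈ I then insert v (F I) else F' I,
    fun I => if v ∈ I then C I else C' I, fun I hI => ?_⟩
  by_cases hv : v ∈ I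
  · obtain ⟨h1, h2, h3, h4, h5⟩ := h I ⟨hI, hv⟩
    simp only [hv, if_true]
    refine ⟨insert_subset hv h1, ?_, h3, h4, ?_⟩
    · have : ((insert v (F I)).card : ℝ) ≤ (F I).card + 1 := by exact_mod_cast card_insert_le _ _
      linarith
    · intro S hS hSI
      have : v ∈ S := hS (mem_insert_self _ _)
      simp only [this, if_true]
      exact h5 S ((subset_insert _ _).trans hS) hSI
  · obtain ⟨h1, h2, h3, h4, h5⟩ := h' I ⟨hI, hv⟩
    simp only [hv, if_false]
    refine ⟨h1, h2, h3, h4, ?_⟩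
    intro S hS hSI
    have : v ∉ S := fun h => hv (hSI h)
    simp only [this, if_false]
    exact h5 S hS hSI

def deg (H : Multiset (Finset V)) (T : Finset V) : ℝ := (H.countP (fun e => T ⊆ e) : ℕ)

lemma deg_nonneg (H : Multiset (Finset V)) (T : Finset V) : 0 ≤ deg H T := Nat.cast_nonneg _

lemma deg_add (H H' : Multiset (Finset V)) (T : Finset V) :
    deg (H + H') T = deg H T + deg H' T := by
  simp [deg, Multiset.countP_add]

lemma deg_le {H H' : Multiset (Finset V)} (h : H ≤ H') (T : Finset V) :
    deg H T ≤ deg H' T := by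
  unfold deg
  exact_mod_cast Multiset.countP_le_of_le _ h

lemma sum_deg (s : ℕ) (H : Multiset (Finset V)) (h : ∀ e ∈ H, e.card = s) :
    ∑ T : Finset V, deg H T = 2 ^ s * (Multiset.card H : ℝ) := by
  induction H using Multiset.induction with
  | empty => simp [deg]
  | cons a H ih =>
    have ha := h a (by simp)
    have := ih (fun e he => h e (by simp [he]))
    have h2 : ∀ T, deg (a ::ₘ H) T = deg H T + if T ⊆ a then 1 else 0 := by
      intro T
      simp only [deg, Multiset.countP_cons]
      push_cast
      rfl
    simp only [h2, sum_add_distrib, this, Multiset.card_cons]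
    have h3 : ∑ T : Finset V, (if T ⊆ a then (1 : ℝ) else 0) = 2 ^ s := by
      rw [← ha, sum_boole]
      have : (univ.filter (fun T => T ⊆ a)) = a.powerset := by ext T; simp
      rw [this, card_powerset]; push_cast; rfl
    rw [h3]; push_cast; ring

lemma sum_deg_one (s : ℕ) (H : Multiset (Finset V)) (h : ∀ e ∈ H, e.card = s) :
    ∑ v : V, deg H {v} = s * (Multiset.card H : ℝ) := by
  induction H using Multiset.induction with
  | empty => simp [deg]
  | cons a H ih =>
    have ha := h a (by simp)
    have := ih (fun e he => h e (by simp [he]))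
    have h2 : ∀ T, deg (a ::ₘ H) T = deg H T + if T ⊆ a then 1 else 0 := by
      intro T
      simp only [deg, Multiset.countP_cons]
      push_cast
      rfl
    simp only [h2, sum_add_distrib, this, Multiset.card_cons]
    have h3 : ∑ v : V, (if {v} ⊆ a then (1 : ℝ) else 0) = s := by
      simp [← ha]
    rw [h3]; push_cast; ring

/-- link of v -/
def link (H : Multiset (Finset V)) (v : V) : Multiset (Finset V) :=
  (H.filter (fun e => v ∈ e)).map (fun e => e.erase v)

lemma card_link (H : Multiset (Finset V)) (v : V) :
    (Multiset.card (link H v) : ℝ) = deg H {v} := by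
  simp [link, deg, Multiset.countP_eq_card_filter]

lemma deg_link_le (H : Multiset (Finset V)) (v : V) (T : Finset V) :
    deg (link H v) T ≤ deg H (insert v T) := by
  unfold link deg
  rw [Multiset.countP_map, ← Multiset.countP_eq_card_filter, Multiset.countP_filter]
  norm_cast
  rw [Multiset.countP_eq_card_filter, Multiset.countP_eq_card_filter]
  apply Multiset.card_le_card
  apply Multiset.monotone_filter_right
  rintro e ⟨h1, h2⟩
  exact insert_subset h2 (h1.trans (erase_subset _ _))

lemma deg_link_zero (H : Multiset (Finset V)) (v : V) (T : Finset V) (hv : v ∈ T) :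
    deg (link H v) T = 0 := by
  unfold link deg
  norm_cast
  rw [Multiset.countP_eq_zero]
  intro e he hT
  rw [Multiset.mem_map] at he
  obtain ⟨a, _, rfl⟩ := he
  simpa using hT hv

/-- removal of edges containing members of a family -/
lemma card_le_filter (H : Multiset (Finset V)) (X : Finset (Finset V)) :
    (Multiset.card H : ℝ) ≤ Multiset.card (H.filter (fun e => ∀ T ∈ X, ¬ T ⊆ e)) +
      ∑ T ∈ X, deg H T := by
  induction H using Multiset.induction with
  | empty => simp [deg]
  | cons a H ih =>
    have h2 : ∀ T, deg (a ::ₘ H) T = deg H T + if T ⊆ a then 1 else 0 := by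
      intro T
      simp only [deg, Multiset.countP_cons]
      push_cast
      rfl
    simp only [h2, sum_add_distrib, Multiset.card_cons, Multiset.filter_cons, Multiset.card_add]
    by_cases h : ∀ T ∈ X, ¬ T ⊆ a
    · rw [if_pos h]
      have : 0 ≤ ∑ T ∈ X, (if T ⊆ a then (1 : ℝ) else 0) := 
        sum_nonneg (fun _ _ => by split_ifs <;> norm_num)
      push_cast
      simp only [Multiset.card_singleton, Nat.cast_one]
      linarith
    · rw [if_neg h]
      push Not at h
      obtain ⟨T, hT, hTa⟩ := h
      have : (if T ⊆ a then (1 : ℝ) else 0) ≤ ∑ T ∈ X, (if T ⊆ a then (1 : ℝ) else 0) := 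
        single_le_sum (f := fun T => (if T ⊆ a then (1 : ℝ) else 0))
          (fun _ _ => by split_ifs <;> norm_num) hT
      rw [if_pos hTa] at this
      push_cast
      simp only [Multiset.card_zero, Nat.cast_zero]
      linarith


lemma deg_eq_zero (H : Multiset (Finset V)) (T : Finset V) (h : ∀ e ∈ H, ¬ T ⊆ e) :
    deg H T = 0 := by
  unfold deg
  norm_cast
  rw [Multiset.countP_eq_zero]
  exact h

lemma deg_anti (H : Multiset (Finset V)) {T T' : Finset V} (h : T ⊆ T') :
    deg H T' ≤ deg H T := by
  unfold deg
  norm_cast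
  rw [Multiset.countP_eq_card_filter, Multiset.countP_eq_card_filter]
  apply Multiset.card_le_card
  apply Multiset.monotone_filter_right
  exact fun e he => h.trans he

lemma card_split (H : Multiset (Finset V)) (v : V) :
    (Multiset.card H : ℝ) = deg H {v} + Multiset.card (H.filter (fun e => v ∉ e)) := by
  unfold deg
  rw [Multiset.countP_eq_card_filter]
  simp only [singleton_subset_iff]
  norm_cast
  rw [← Multiset.card_add, Multiset.filter_add_not]

lemma leaf_size (s : ℕ) (τ B c : ℝ) (hτ : 0 < τ) (hB : 0 < B) (hc : 0 < c)
    (H : Multiset (Finset V)) (h : ∀ e ∈ H, e.card = s + 1)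
    (hd : ∀ v, deg H {v} ≤ B * τ) (hH : c * B * τ * Fintype.card V / 2 ≤ Multiset.card H) :
    c / 4 * Fintype.card V ≤ ((univ.filter (fun v => c / 4 * B * τ ≤ deg H {v})).card : ℝ) := by
  have h1 := sum_deg_one (s + 1) H h
  have h2 : ∑ v : V, deg H {v} ≤ ∑ v : V, (c / 4 * B * τ + if c / 4 * B * τ ≤ deg H {v} then B * τ else 0) := by
    apply sum_le_sum
    intro v _
    have := hd v
    have : 0 ≤ c / 4 * B * τ := by positivity
    split_ifs with h <;> linarith
  rw [sum_add_distrib, ← sum_filter, sum_const, sum_const, h1] at h2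
  simp only [nsmul_eq_mul, card_univ] at h2
  have h3 : (Multiset.card H : ℝ) ≤ ((s + 1 : ℕ) : ℝ) * Multiset.card H := by
    have : (0 : ℝ) ≤ Multiset.card H := by positivity
    push_cast
    nlinarith
  have h4 : 0 < B * τ := by positivity
  have h5 : (c / 4 * Fintype.card V) * (B * τ) ≤ 
    ((univ.filter (fun v => c / 4 * B * τ ≤ deg H {v})).card : ℝ) * (B * τ) := by
    linarith
  exact le_of_mul_le_mul_right h5 h4

lemma inner (s : ℕ) (τ B θ X c β k k1 m : ℝ) (hτ : 0 < τ) (hτ1 : τ ≤ 1) (hB : 0 < B) (hc : 0 < c)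
    (hθ : θ = c / 4) (hβ : β = 1 / 2 ^ (s + 2))
    (H0 : Multiset (Finset V)) (hX : X = β * τ * Multiset.card H0)
    (h0 : ∀ e ∈ H0, e.card = s + 1) (A : Finset V) (hA : ∀ e ∈ H0, e ⊆ A)
    (hd0 : ∀ T : Finset V, T.Nonempty → deg H0 T ≤ B * τ ^ T.card)
    (hcard : c * B * τ * Fintype.card V ≤ Multiset.card H0)
    (I0 : Set (Finset V)) (hind : ∀ I ∈ I0, ∀ e ∈ H0, ¬ e ⊆ I)
    (hk1 : k ≤ k1)
    (hnext : ∀ J ⊆ I0, ∀ H' : Multiset (Finset V), (∀ e ∈ H', e.card = s) → (∀ e ∈ H', e ⊆ A) →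
      (∀ T : Finset V, T.Nonempty → deg H' T ≤ 2 * τ * B * τ ^ T.card) →
      X ≤ Multiset.card H' → (∀ I ∈ J, ∀ e ∈ H', ¬ e ⊆ I) → Cont J k1 m)
    (hleaf : ∀ J ⊆ I0, ∀ Z : Finset V, c / 4 * Fintype.card V ≤ Z.card →
      Z ⊆ A → (∀ I ∈ J, Disjoint I Z) → Cont J k m) :
    ∀ (t : ℕ) (H H' : Multiset (Finset V)) (Z : Finset V) (J : Set (Finset V)) (kk : ℝ),
      Multiset.card H + Zᶜ.card < t → H ≤ H0 → (∀ e ∈ H', e.card = s) → (∀ e ∈ H', e ⊆ A) →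
      (∀ T : Finset V, T.Nonempty → deg H' T ≤ 2 * τ * B * τ ^ T.card) →
      (∀ T : Finset V, T.Nonempty → τ * B * τ ^ T.card ≤ deg H' T → ∀ e ∈ H, ¬ T ⊆ e) →
      ((Multiset.card H0 : ℝ) ≤ Multiset.card H + Multiset.card H' +
        ∑ T : Finset V with (T.Nonempty ∧ τ * B * τ ^ T.card ≤ deg H' T), B * τ ^ T.card) →
      J ⊆ I0 → (∀ I ∈ J, ∀ e ∈ H', ¬ e ⊆ I) → (∀ v ∈ Z, ∀ I ∈ J, v ∉ I) →
      k1 ≤ kk → k1 + 1 + (X - Multiset.card H') / (θ * B * τ) ≤ kk → Cont J kk m := by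
  have hθ0 : 0 < θ := by rw [hθ]; positivity
  have hβ0 : 0 < β := by rw [hβ]; positivity
  intro t
  induction t with
  | zero => 
    intro H H' Z J kk h
    omega
  | succ t ih =>
    intro H H' Z J kk ht hH hs' hA' hd' hsat hbal hJ hind' hZ hkk1 hkk
    by_cases hXc : X ≤ Multiset.card H'
    · exact (hnext J hJ H' hs' hA' hd' hXc hind').mono hkk1
    push Not at hXc
    have hθB : 0 < θ * B * τ := by positivity
    by_cases hv : ∃ v, v ∉ Z ∧ θ * B * τ ≤ deg H {v}
    · obtain ⟨v, hvZ, hv⟩ := hv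
      have hsplit := card_split H v
      apply Cont.branch v
      · set H1' := H' + link H v with hH1'
        set Sat1 : Finset (Finset V) :=
          univ.filter (fun T => T.Nonempty ∧ τ * B * τ ^ T.card ≤ deg H1' T) with hSat1
        set Sat : Finset (Finset V) :=
          univ.filter (fun T => T.Nonempty ∧ τ * B * τ ^ T.card ≤ deg H' T) with hSat
        set Hv := H.filter (fun e => v ∉ e) with hHv
        set H1 := Hv.filter (fun e => ∀ T ∈ Sat1, ¬ T ⊆ e) with hH1
        have hHvH : Hv ≤ H := Multiset.filter_le _ _
        have hH1Hv : H1 ≤ Hv := Multiset.filter_le _ _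
        have hcl := card_link H v
        have hcH1' : (Multiset.card H1' : ℝ) = Multiset.card H' + deg H {v} := by
          rw [hH1', Multiset.card_add]; push_cast; rw [hcl]
        have hSS : Sat ⊆ Sat1 := by
          intro T hT
          simp only [hSat, hSat1, mem_filter, mem_univ, true_and] at hT ⊢
          refine ⟨hT.1, hT.2.trans ?_⟩
          rw [hH1', deg_add]
          linarith [deg_nonneg (link H v) T]
        refine ih H1 H1' Z {I | I ∈ J ∧ v ∈ I} (kk - 1) ?_ ((hH1Hv.trans hHvH).trans hH) ?_ ?_ ?_ ?_ ?_
          (fun I hI => hJ hI.1) ?_ (fun u hu I hI => hZ u hu I hI.1) ?_ ?_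
        · have h1 : (Multiset.card Hv : ℝ) < Multiset.card H := by linarith
          have h2 : Multiset.card Hv < Multiset.card H := by exact_mod_cast h1
          have h3 := Multiset.card_le_card hH1Hv
          omega
        · intro e he
          rw [hH1', Multiset.mem_add] at he
          rcases he with he | he
          · exact hs' e he
          · simp only [link, Multiset.mem_map, Multiset.mem_filter] at he
            obtain ⟨a, ⟨ha, hva⟩, rfl⟩ := he
            rw [card_erase_of_mem hva, h0 a (Multiset.mem_of_le hH ha)]
            rfl
        · intro e he
          rw [hH1', Multiset.mem_add] at he
          rcases he with he | he
          · exact hA' e he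
          · simp only [link, Multiset.mem_map, Multiset.mem_filter] at he
            obtain ⟨a, ⟨ha, hva⟩, rfl⟩ := he
            exact (erase_subset _ _).trans (hA a (Multiset.mem_of_le hH ha))
        · intro T hT
          rw [hH1', deg_add]
          have h1 := hd' T hT
          by_cases hvT : v ∈ T
          · rw [deg_link_zero H v T hvT]; linarith
          have h2 := deg_link_le H v T
          by_cases hs : τ * B * τ ^ T.card ≤ deg H' T
          · have h3 := deg_eq_zero H T (hsat T hT hs)
            have h4 := deg_anti H (subset_insert v T)
            linarith
          · push Not at hs
            have h3 := (deg_le hH (insert v T)).trans (hd0 (insert v T) (insert_nonempty _ _))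
            rw [card_insert_of_notMem hvT, pow_succ] at h3
            linarith
        · intro T hT hTs e he
          rw [hH1, Multiset.mem_filter] at he
          exact he.2 T (by simp [hSat1, hT, hTs])
        · have h1 := card_le_filter Hv Sat1
          have h2 : ∑ T ∈ Sat1, deg Hv T ≤ ∑ T ∈ Sat1 \ Sat, B * τ ^ T.card := by
            rw [← sum_sdiff hSS]
            have h3 : ∑ T ∈ Sat, deg Hv T = 0 := by
              apply sum_eq_zero
              intro T hT
              simp only [hSat, mem_filter, mem_univ, true_and] at hT
              exact deg_eq_zero _ _ (fun e he => hsat T hT.1 hT.2 e (Multiset.mem_of_le hHvH he))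
            rw [h3, add_zero]
            apply sum_le_sum
            intro T hT
            simp only [hSat1, mem_sdiff, mem_filter, mem_univ, true_and] at hT
            exact (deg_le (hHvH.trans hH) T).trans (hd0 T hT.1.1)
          have h4 := sum_sdiff hSS (f := fun T => B * τ ^ T.card)
          linarith
        · rintro I ⟨hI, hvI⟩ e he
          rw [hH1', Multiset.mem_add] at he
          rcases he with he | he
          · exact hind' I hI e he
          · simp only [link, Multiset.mem_map, Multiset.mem_filter] at he
            obtain ⟨a, ⟨ha, hva⟩, rfl⟩ := he
            intro hsub
            apply hind I (hJ hI) a (Multiset.mem_of_le hH ha)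
            rw [← insert_erase hva]
            exact insert_subset hvI hsub
        · have : 0 < (X - Multiset.card H') / (θ * B * τ) := div_pos (by linarith) hθB
          linarith
        · rw [hcH1']
          have h1 : 1 ≤ deg H {v} / (θ * B * τ) := by rw [le_div_iff₀ hθB]; linarith
          have : (X - (Multiset.card H' + deg H {v})) / (θ * B * τ) =
            (X - Multiset.card H') / (θ * B * τ) - deg H {v} / (θ * B * τ) := by ring
          linarith
      · refine ih H H' (insert v Z) {I | I ∈ J ∧ v ∉ I} kk ?_ hH hs' hA' hd' hsat hbal
          (fun I hI => hJ hI.1) (fun I hI => hind' I hI.1) ?_ hkk1 hkk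
        · have : (insert v Z)ᶜ.card < Zᶜ.card := by
            apply card_lt_card
            rw [compl_ssubset_compl]
            exact ssubset_insert hvZ
          omega
        · intro u hu I hI
          rw [mem_insert] at hu
          rcases hu with rfl | hu
          · exact hI.2
          · exact hZ u hu I hI.1
    · push Not at hv
      refine (hleaf J hJ (univ.filter (fun v => c / 4 * B * τ ≤ deg H {v})) ?_ ?_ ?_).mono
        (hk1.trans hkk1)
      · apply leaf_size s τ B c hτ hB hc H (fun e he => h0 e (Multiset.mem_of_le hH he))
        · intro v
          have := (deg_le hH {v}).trans (hd0 {v} (singleton_nonempty v))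
          simpa using this
        · have h1 : ∑ T : Finset V with (T.Nonempty ∧ τ * B * τ ^ T.card ≤ deg H' T), B * τ ^ T.card
            ≤ 2 ^ s * (Multiset.card H' : ℝ) / τ := by
            rw [← sum_deg s H' hs', sum_div]
            calc _ ≤ ∑ T : Finset V with (T.Nonempty ∧ τ * B * τ ^ T.card ≤ deg H' T), deg H' T / τ := by
                  apply sum_le_sum
                  intro T hT
                  simp only [mem_filter, mem_univ, true_and] at hT
                  rw [le_div_iff₀ hτ]
                  linarith [hT.2]
              _ ≤ _ := by
                  apply sum_le_sum_of_subset_of_nonneg (filter_subset _ _)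
                  intro T _ _
                  exact div_nonneg (deg_nonneg _ _) hτ.le
          have h2 : (Multiset.card H' : ℝ) / τ ≤ β * Multiset.card H0 := by
            rw [div_le_iff₀ hτ]; linarith
          have h3 : (Multiset.card H' : ℝ) ≤ Multiset.card H' / τ := by
            rw [le_div_iff₀ hτ]
            have : (0 : ℝ) ≤ Multiset.card H' := by positivity
            nlinarith
          have h4 : β * 2 ^ s = 1 / 4 := by
            rw [hβ, pow_add]; field_simp; norm_num
          have h5 : β ≤ 1 / 4 := by
            rw [← h4]
            have : (1 : ℝ) ≤ 2 ^ s := one_le_pow₀ (by norm_num)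
            nlinarith
          have h6 : 2 ^ s * (Multiset.card H' : ℝ) / τ ≤ 1 / 4 * Multiset.card H0 := by
            rw [← h4, mul_div_assoc]
            have : (0 : ℝ) ≤ 2 ^ s := by positivity
            nlinarith
          have h7 : (0 : ℝ) ≤ Multiset.card H0 := by positivity
          nlinarith
      · intro z hz
        simp only [mem_filter, mem_univ, true_and] at hz
        rw [← hθ] at hz
        by_contra hcon
        have := deg_eq_zero H {z} (fun e he => by
          rw [singleton_subset_iff]
          exact fun hze => hcon (hA e (Multiset.mem_of_le hH he) hze))
        linarith
      · intro I hI
        rw [Finset.disjoint_left]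
        intro u hu huZ
        simp only [mem_filter, mem_univ, true_and] at huZ
        rw [← hθ] at huZ
        by_cases h : u ∈ Z
        · exact hZ u h I hI hu
        · linarith [hv u h]

lemma level (s : ℕ) : ∀ c : ℝ, 0 < c → ∃ K δ : ℝ, 0 < K ∧ 0 < δ ∧
    ∀ (V : Type) [Fintype V] [DecidableEq V] [Nonempty V] (τ B k m : ℝ), 0 < τ → τ ≤ 1 → 0 < B →
    ∀ (H0 : Multiset (Finset V)) (A : Finset V) (I0 : Set (Finset V)),
    (∀ e ∈ H0, e.card = s) → (∀ e ∈ H0, e ⊆ A) →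
    (∀ T : Finset V, T.Nonempty → deg H0 T ≤ B * τ ^ T.card) →
    (c * B * τ * Fintype.card V ≤ Multiset.card H0) →
    (∀ I ∈ I0, ∀ e ∈ H0, ¬ e ⊆ I) →
    (∀ J ⊆ I0, ∀ Z : Finset V, δ * Fintype.card V ≤ Z.card →
      Z ⊆ A → (∀ I ∈ J, Disjoint I Z) → Cont J k m) →
    Cont I0 (k + K * (τ * Fintype.card V + 1)) m := by
  induction s with
  | zero =>
    intro c hc
    refine ⟨1, 1, one_pos, one_pos, ?_⟩
    intro V _ _ _ τ B k m hτ hτ1 hB H0 A I0 hs hA hd hcard hind hleaf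
    have h1 : (0 : ℝ) < Multiset.card H0 := by
      refine lt_of_lt_of_le ?_ hcard
      have : (0 : ℝ) < Fintype.card V := by exact_mod_cast Fintype.card_pos
      positivity
    have h2 : 0 < Multiset.card H0 := by exact_mod_cast h1
    obtain ⟨e, he⟩ := Multiset.card_pos_iff_exists_mem.1 h2
    have he0 := card_eq_zero.1 (hs e he)
    refine ⟨id, id, fun I hI => ?_⟩
    exact absurd (by simp [he0]) (hind I hI e he)
  | succ s ih =>
    intro c hc
    obtain ⟨K, δ, hK, hδ, h⟩ := ih ((1 / 2 ^ (s + 2)) * c / 2) (by positivity)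
    refine ⟨K + 1 + (1 / 2 ^ (s + 2)) / (c / 4), min δ (c / 4), by positivity, by positivity, ?_⟩
    intro V _ _ _ τ B k m hτ hτ1 hB H0 A I0 hs hA hd hcard hind hleaf
    set β : ℝ := 1 / 2 ^ (s + 2) with hβ
    have hβ0 : 0 < β := by positivity
    have hN : (0 : ℝ) < Fintype.card V := by exact_mod_cast Fintype.card_pos
    have hcN : (Multiset.card H0 : ℝ) ≤ B * τ * Fintype.card V := by
      have h1 := sum_deg_one (s + 1) H0 hs
      have h2 : ∑ v : V, deg H0 {v} ≤ ∑ v : V, B * τ := by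
        apply sum_le_sum
        intro v _
        simpa using hd {v} (singleton_nonempty v)
      rw [h1, sum_const, card_univ, nsmul_eq_mul] at h2
      have : (0 : ℝ) ≤ s * Multiset.card H0 := by positivity
      push_cast at h2
      linarith
    have hmin1 : min δ (c / 4) ≤ δ := min_le_left _ _
    have hmin2 : min δ (c / 4) ≤ c / 4 := min_le_right _ _
    refine inner s τ B (c / 4) (β * τ * Multiset.card H0) c β k
      (k + K * (τ * Fintype.card V + 1)) m hτ hτ1 hB hc rfl hβ H0 rfl hs A hA hd hcard I0 hind
      ?_ ?_ ?_ (Multiset.card H0 + (∅ : Finset V)ᶜ.card + 1) H0 0 ∅ I0 _ (Nat.lt_succ_self _)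
      le_rfl ?_ ?_ ?_ ?_ ?_ (subset_refl _) ?_ ?_ ?_ ?_
    · have : 0 ≤ K * (τ * Fintype.card V + 1) := by positivity
      linarith
    · intro J hJ H' hs' hA' hd' hX hind'
      refine h V τ (2 * τ * B) k m hτ hτ1 (by positivity) H' A J hs' hA' hd' ?_ hind' ?_
      · refine le_trans ?_ hX
        have := mul_le_mul_of_nonneg_left hcard (mul_pos hβ0 hτ).le
        linarith
      · intro J' hJ' Z hZ hZA hdis
        exact hleaf J' (hJ'.trans hJ) Z (by nlinarith) hZA hdis
    · intro J hJ Z hZ hZA hdis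
      exact hleaf J hJ Z (by nlinarith) hZA hdis
    · simp
    · simp
    · intro T hT
      have : deg (0 : Multiset (Finset V)) T = 0 := by simp [deg]
      rw [this]; positivity
    · intro T hT h1
      have : deg (0 : Multiset (Finset V)) T = 0 := by simp [deg]
      rw [this] at h1
      have : 0 < τ * B * τ ^ T.card := by positivity
      linarith
    · have : 0 ≤ ∑ T : Finset V with (T.Nonempty ∧ τ * B * τ ^ T.card ≤ deg 0 T), B * τ ^ T.card :=
        sum_nonneg (fun _ _ => by positivity)
      simp only [Multiset.card_zero, Nat.cast_zero]
      linarith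
    · simp
    · simp
    · have : 0 ≤ (1 + β / (c / 4)) * (τ * Fintype.card V + 1) := by positivity
      linarith
    · have h1 : (β * τ * Multiset.card H0 - (Multiset.card (0 : Multiset (Finset V)) : ℝ)) / (c / 4 * B * τ)
          ≤ β / (c / 4) * (τ * Fintype.card V) := by
        rw [div_le_iff₀ (by positivity)]
        simp only [Multiset.card_zero, Nat.cast_zero, sub_zero]
        have h2 : β / (c / 4) * (τ * Fintype.card V) * (c / 4 * B * τ) = β * τ * (B * τ * Fintype.card V) := by
          field_simp
        rw [h2]
        exact mul_le_mul_of_nonneg_left hcN (by positivity)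
      have h3 : 0 ≤ τ * Fintype.card V := by positivity
      have h4 : 0 ≤ β / (c / 4) := by positivity
      linarith

/-- Iterated container theorem. -/
lemma containers (s : ℕ) (c : ℝ) (hc : 0 < c) : ∃ K : ℝ, 0 < K ∧
    ∀ (V : Type) [Fintype V] [DecidableEq V] [Nonempty V] (τ B m : ℝ), 0 < τ → τ ≤ 1 → 0 < B → 0 ≤ m →
    ∀ (I0 : Set (Finset V)),
    (∀ A : Finset V, m < A.card → ∃ H0 : Multiset (Finset V),
      (∀ e ∈ H0, e.card = s) ∧ (∀ e ∈ H0, e ⊆ A) ∧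
      (∀ T : Finset V, T.Nonempty → deg H0 T ≤ B * τ ^ T.card) ∧
      (c * B * τ * Fintype.card V ≤ Multiset.card H0) ∧
      (∀ I ∈ I0, ∀ e ∈ H0, ¬ e ⊆ I)) →
    Cont I0 (K * (τ * Fintype.card V + 1)) m := by
  obtain ⟨K, δ, hK, hδ, h⟩ := level s c hc
  obtain ⟨j0, hj0⟩ := exists_nat_gt (1 / δ)
  refine ⟨(j0 + 1) * K, by positivity, ?_⟩
  intro V _ _ _ τ B m hτ hτ1 hB hm I0 hsup
  have key : ∀ (j : ℕ) (A : Finset V) (J : Set (Finset V)), J ⊆ I0 → (∀ I ∈ J, I ⊆ A) →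
      (A.card : ℝ) ≤ m + j * (δ * Fintype.card V) →
      Cont J (j * (K * (τ * Fintype.card V + 1))) m := by
    intro j
    induction j with
    | zero =>
      intro A J hJ hA hcard
      exact Cont.leaf A (by simp) (by simpa using hcard) hA
    | succ j ih =>
      intro A J hJ hA hcard
      by_cases hAm : (A.card : ℝ) ≤ m
      · exact Cont.leaf A (by positivity) hAm hA
      push Not at hAm
      obtain ⟨H0, h1, h2, h3, h4, h5⟩ := hsup A hAm
      have := h V τ B (j * (K * (τ * Fintype.card V + 1))) m hτ hτ1 hB H0 A J h1 h2 h3 h4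
        (fun I hI => h5 I (hJ hI)) ?_
      · refine this.mono (le_of_eq ?_)
        push_cast; ring
      · intro J' hJ' Z hZ hZA hdis
        refine ih (A \ Z) J' (hJ'.trans hJ) ?_ ?_
        · intro I hI
          rw [subset_sdiff]
          exact ⟨hA I (hJ' hI), hdis I hI⟩
        · rw [cast_card_sdiff hZA]
          push_cast at hcard
          linarith
  refine (key j0 univ I0 (subset_refl _) (fun I _ => subset_univ _) ?_).mono ?_
  · have : 1 < j0 * δ := by rwa [div_lt_iff₀ hδ] at hj0
    have hN : (0 : ℝ) < Fintype.card V := by exact_mod_cast Fintype.card_pos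
    rw [card_univ]
    nlinarith
  · have : 0 ≤ K * (τ * Fintype.card V + 1) := by positivity
    linarith

end CC
set_option linter.unusedSectionVars false
namespace CC

lemma wt_sum {α : Type} [Fintype α] [DecidableEq α] (q : ℝ) (hq0 : 0 ≤ q) (hq1 : q ≤ 1)
    (S C : Finset α) :
    ∑ E : Finset α, (q ^ E.card * (1 - q) ^ (Fintype.card α - E.card)) *
      (if S ⊆ E then (2 : ℝ) ^ (E ∩ C).card else 0) ≤ (2 * q) ^ S.card * (1 + q) ^ C.card := by
  have h1 : ∀ E : Finset α, (q ^ E.card * (1 - q) ^ (Fintype.card α - E.card)) *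
      (if S ⊆ E then (2 : ℝ) ^ (E ∩ C).card else 0) =
      (∏ i ∈ E, q * (if i ∈ C then 2 else 1)) * ∏ i ∈ univ \ E, (if i ∈ S then 0 else (1 - q)) := by
    intro E
    rw [prod_mul_distrib, prod_const, prod_ite_mem]
    by_cases hS : S ⊆ E
    · rw [if_pos hS, prod_const]
      have : ∏ i ∈ univ \ E, (if i ∈ S then 0 else (1 - q)) = ∏ i ∈ univ \ E, (1 - q) := by
        apply prod_congr rfl
        intro i hi
        rw [mem_sdiff] at hi
        rw [if_neg (fun h => hi.2 (hS h))]
      rw [this, prod_const, card_univ_sdiff]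
      ring
    · rw [if_neg hS]
      obtain ⟨x, hx, hxE⟩ := not_subset.1 hS
      rw [prod_eq_zero (s := univ \ E) (i := x)]
      · ring
      · simp [hxE]
      · simp [hx]
  rw [sum_congr rfl (fun E _ => h1 E)]
  have h2 := prod_add (fun i => q * (if i ∈ C then (2 : ℝ) else 1))
    (fun i => if i ∈ S then (0 : ℝ) else (1 - q)) (univ : Finset α)
  rw [powerset_univ] at h2
  rw [← h2]
  calc _ ≤ ∏ i : α, (if i ∈ S then 2 * q else 1) * (if i ∈ C then (1 + q) else 1) := by
        apply prod_le_prod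
        · intro i _
          split_ifs <;> linarith
        · intro i _
          split_ifs <;> nlinarith
    _ = _ := by
        rw [prod_mul_distrib, prod_ite_mem, prod_ite_mem]
        simp

lemma wt_total {α : Type} [Fintype α] [DecidableEq α] (q : ℝ) :
    ∑ E : Finset α, (q ^ E.card * (1 - q) ^ (Fintype.card α - E.card)) = 1 := by
  have := Finset.sum_pow_mul_eq_add_pow q (1 - q) (univ : Finset α)
  rw [powerset_univ, card_univ] at this
  rw [this]; simp

lemma prob_le_one {α : Type} [Fintype α] [DecidableEq α] (q : ℝ) (hq0 : 0 ≤ q) (hq1 : q ≤ 1)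
    (P : Finset α → Prop) : subsetProbOn univ q P ≤ 1 := by
  unfold subsetProbOn
  refine le_trans ?_ (wt_total (α := α) q).le
  rw [powerset_univ, card_univ]
  apply sum_le_sum
  intro E _
  have : 0 ≤ 1 - q := by linarith
  split_ifs
  · exact le_rfl
  · positivity

lemma prob_bound {α : Type} [Fintype α] [DecidableEq α] (q : ℝ) (hq0 : 0 ≤ q) (hq1 : q ≤ 1)
    (P : Finset α → Prop) (F0 : Set (Finset α)) (k m M a : ℝ) (ha : 0 ≤ a) (hC : Cont F0 k m)
    (hbad : ∀ E, ¬ P E → ∃ E' ⊆ E, E' ∈ F0 ∧ M ≤ E'.card) :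
    1 - Real.exp (a * k + 2 * q * Real.exp (-a) * Fintype.card α + q * m - M * Real.log 2) ≤
      subsetProbOn univ q P := by
  classical
  obtain ⟨F, C, hFC⟩ := hC
  have hq2 : 0 ≤ 1 - q := by linarith
  set wt : Finset α → ℝ := fun E => q ^ E.card * (1 - q) ^ (Fintype.card α - E.card) with hwt
  have hwt0 : ∀ E, 0 ≤ wt E := fun E => by simp only [hwt]; positivity
  set g : Finset α → ℝ := fun S => if ((C S).card : ℝ) ≤ m then
    Real.exp (a * (k - S.card) - M * Real.log 2) else 0 with hg
  have hg0 : ∀ S, 0 ≤ g S := fun S => by simp only [hg]; split_ifs <;> positivity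
  have h1 : 1 ≤ subsetProbOn univ q P + ∑ E : Finset α, ∑ S : Finset α,
      g S * (wt E * (if S ⊆ E then (2 : ℝ) ^ (E ∩ C S).card else 0)) := by
    unfold subsetProbOn
    refine (wt_total (α := α) q).symm.le.trans ?_
    rw [powerset_univ, card_univ, ← sum_add_distrib]
    apply sum_le_sum
    intro E _
    have hnn : ∀ S : Finset α, 
      0 ≤ g S * (wt E * (if S ⊆ E then (2 : ℝ) ^ (E ∩ C S).card else 0)) := by
      intro S
      refine mul_nonneg (hg0 S) (mul_nonneg (hwt0 E) ?_)
      split_ifs <;> positivity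
    by_cases hP : P E
    · rw [if_pos hP]
      have := sum_nonneg (fun S (_ : S ∈ univ) => hnn S)
      linarith
    · rw [if_neg hP, zero_add]
      obtain ⟨E', hE', hEF, hM⟩ := hbad E hP
      obtain ⟨f1, f2, f3, f4, f5⟩ := hFC E' hEF
      have hCS := f5 (F E') (subset_refl _) f1
      refine le_trans ?_ (single_le_sum (fun S _ => hnn S) (mem_univ (F E')))
      simp only [hg]
      rw [hCS, if_pos f4, if_pos (f1.trans hE')]
      have h2 : (E'.card : ℝ) ≤ (E ∩ C E').card := by
        exact_mod_cast card_le_card (subset_inter hE' f3)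
      have h3 : (2 : ℝ) ^ (E ∩ C E').card = Real.exp ((E ∩ C E').card * Real.log 2) := by
        rw [mul_comm, Real.exp_mul, Real.exp_log (by norm_num), Real.rpow_natCast]
      have h4 : 1 ≤ Real.exp (a * (k - (F E').card) - M * Real.log 2) * (2 : ℝ) ^ (E ∩ C E').card := by
        rw [h3, ← Real.exp_add, Real.one_le_exp_iff]
        have : 0 ≤ Real.log 2 := Real.log_nonneg (by norm_num)
        nlinarith
      have := hwt0 E
      simp only [hwt] at this ⊢
      nlinarith
  have h2 : ∑ E : Finset α, ∑ S : Finset α,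
      g S * (wt E * (if S ⊆ E then (2 : ℝ) ^ (E ∩ C S).card else 0)) ≤
      Real.exp (a * k + 2 * q * Real.exp (-a) * Fintype.card α + q * m - M * Real.log 2) := by
    rw [sum_comm]
    calc _ ≤ ∑ S : Finset α, Real.exp (a * k - M * Real.log 2 + q * m) * (2 * q * Real.exp (-a)) ^ S.card := by
          apply sum_le_sum
          intro S _
          rw [← mul_sum]
          have h3 := wt_sum q hq0 hq1 S (C S)
          simp only [hg]
          split_ifs with hm
          · have h4 : (1 + q) ^ (C S).card ≤ Real.exp (q * m) := by
              calc (1 + q) ^ (C S).card ≤ (Real.exp q) ^ (C S).card := by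
                    gcongr
                    linarith [Real.add_one_le_exp q]
                _ = Real.exp ((C S).card * q) := by rw [← Real.exp_nat_mul]
                _ ≤ _ := by
                    apply Real.exp_le_exp.2
                    nlinarith
            have h5 : Real.exp (a * (k - S.card) - M * Real.log 2) =
              Real.exp (a * k - M * Real.log 2) * (Real.exp (-a)) ^ S.card := by
              rw [← Real.exp_nat_mul, ← Real.exp_add]; ring_nf
            rw [h5, Real.exp_add, mul_pow (2 * q)]
            calc _ ≤ Real.exp (a * k - M * Real.log 2) * (Real.exp (-a)) ^ S.card * 
                  ((2 * q) ^ S.card * Real.exp (q * m)) := by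
                  gcongr
                  exact h3.trans (by gcongr)
              _ = _ := by ring
          · rw [zero_mul]; positivity
      _ = Real.exp (a * k - M * Real.log 2 + q * m) * (2 * q * Real.exp (-a) + 1) ^ Fintype.card α := by
          rw [← mul_sum]
          have := Finset.sum_pow_mul_eq_add_pow (2 * q * Real.exp (-a)) 1 (univ : Finset α)
          rw [powerset_univ, card_univ] at this
          rw [← this]; simp
      _ ≤ Real.exp (a * k - M * Real.log 2 + q * m) * (Real.exp (2 * q * Real.exp (-a))) ^ Fintype.card α := by
          gcongr
          exact Real.add_one_le_exp _
      _ = _ := by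
          rw [← Real.exp_nat_mul, ← Real.exp_add]; ring_nf
  linarith

end CC
set_option linter.unusedSectionVars false
namespace CC

open Classical in
lemma pw {X Y : Type} [Fintype X] [Fintype Y] (R : X → Y → Prop) (k : ℕ) :
    ((univ.filter (fun p : X × Y => R p.1 p.2)).card : ℝ) ^ (k + 1) / (Fintype.card X : ℝ) ^ k ≤
    (univ.filter (fun p : X × (Fin (k + 1) → Y) => ∀ j, R p.1 (p.2 j))).card := by
  have h1 : ((univ.filter (fun p : X × Y => R p.1 p.2)).card : ℝ) =
      ∑ x : X, ((univ.filter (fun y => R x y)).card : ℝ) := by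
    rw [← sum_boole, Fintype.sum_prod_type]
    simp only [sum_boole]
  have h2 : ((univ.filter (fun p : X × (Fin (k + 1) → Y) => ∀ j, R p.1 (p.2 j))).card : ℝ) =
      ∑ x : X, ((univ.filter (fun y => R x y)).card : ℝ) ^ (k + 1) := by
    rw [← sum_boole, Fintype.sum_prod_type]
    apply sum_congr rfl
    intro x _
    rw [sum_boole]
    have : univ.filter (fun y : Fin (k + 1) → Y => ∀ j, R x (y j)) =
        Fintype.piFinset (fun _ : Fin (k + 1) => univ.filter (fun y => R x y)) := by
      ext y; simp [Fintype.mem_piFinset]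
    rw [this, Fintype.card_piFinset]
    simp
  rw [h1, h2]
  have := pow_sum_div_card_le_sum_pow (s := (univ : Finset X))
    (f := fun x => ((univ.filter (fun y => R x y)).card : ℝ)) (fun _ _ => by positivity) k
  rwa [card_univ] at this

open Classical in
lemma kll (n k : ℕ) (hn : 0 < n) (R : Fin n → Fin n → Prop) (a : ℝ) (ha : 0 ≤ a)
    (h : a * n ^ 2 ≤ (univ.filter (fun p : Fin n × Fin n => R p.1 p.2)).card) :
    a ^ ((k + 1) * (k + 1)) * (n : ℝ) ^ (2 * (k + 1)) ≤
    (univ.filter (fun p : (Fin (k + 1) → Fin n) × (Fin (k + 1) → Fin n) =>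
      ∀ i j, R (p.2 i) (p.1 j))).card := by
  have hn' : (0 : ℝ) < n := by exact_mod_cast hn
  have h1 := pw R k
  have h2 := pw (fun (y : Fin (k + 1) → Fin n) (x : Fin n) => ∀ j, R x (y j)) k
  have h3 : ((univ.filter (fun p : Fin n × (Fin (k + 1) → Fin n) => ∀ j, R p.1 (p.2 j))).card) =
    ((univ.filter (fun p : (Fin (k + 1) → Fin n) × Fin n => ∀ j, R p.2 (p.1 j))).card) := by
    apply card_bij (fun p _ => p.swap)
    · intro p hp; simpa using hp
    · intro p _ q _ h; exact Prod.swap_injective h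
    · intro p hp; exact ⟨p.swap, by simpa using hp, by simp⟩
  refine le_trans ?_ (h2.trans (le_of_eq (by congr)))
  suffices key : a ^ ((k + 1) * (k + 1)) * (n : ℝ) ^ (2 * (k + 1)) ≤
      ((univ.filter (fun p : Fin n × (Fin (k + 1) → Fin n) => ∀ j, R p.1 (p.2 j))).card : ℝ)
      ^ (k + 1) / (Fintype.card (Fin (k + 1) → Fin n) : ℝ) ^ k by
    rw [h3] at key
    refine key.trans (le_of_eq ?_)
    congr
  have h1 : ((univ.filter (fun p : Fin n × Fin n => R p.1 p.2)).card : ℝ) ^ (k + 1) /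
      (Fintype.card (Fin n) : ℝ) ^ k ≤
    (univ.filter (fun p : Fin n × (Fin (k + 1) → Fin n) => ∀ j, R p.1 (p.2 j))).card := by
    convert h1
  simp only [Fintype.card_fin, Fintype.card_pi, prod_const, card_univ] at h1 ⊢
  have h4 : a ^ (k + 1) * (n : ℝ) ^ (k + 2) ≤
    ((univ.filter (fun p : Fin n × (Fin (k + 1) → Fin n) => ∀ j, R p.1 (p.2 j))).card : ℝ) := by
    refine le_trans ?_ h1
    rw [le_div_iff₀ (by positivity)]
    calc _ = (a * n ^ 2) ^ (k + 1) := by ring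
      _ ≤ _ := by gcongr
  rw [le_div_iff₀ (by positivity)]
  push_cast
  calc _ = (a ^ (k + 1) * (n : ℝ) ^ (k + 2)) ^ (k + 1) := by ring
    _ ≤ _ := by gcongr

abbrev EV (n : ℕ) := {e : Sym2 (Fin n) // ¬ e.IsDiag}

open Classical in
noncomputable def cycE {n L : ℕ} [NeZero L] (z : Fin L → Fin n) : Finset (EV n) :=
  univ.filter (fun e => ∃ i, e.1 = s(z i, z (i + 1)))

lemma fin_one_ne {L : ℕ} [NeZero L] (hL : 3 ≤ L) : (1 : Fin L) ≠ 0 ∧ (1 : Fin L) + 1 ≠ 0 := by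
  obtain ⟨r, rfl⟩ : ∃ r, L = r + 3 := ⟨L - 3, by omega⟩
  constructor
  · intro h
    have := congrArg Fin.val h
    simp at this
  · intro h
    have := congrArg Fin.val h
    rw [Fin.val_add] at this
    simp at this
    rw [Nat.mod_eq_of_lt (by omega)] at this
    omega

lemma edge_inj {n L : ℕ} [NeZero L] (hL : 3 ≤ L) (z : Fin L → Fin n) (hz : Function.Injective z)
    {i j : Fin L} (h : s(z i, z (i + 1)) = s(z j, z (j + 1))) : i = j := by
  obtain ⟨h1, h2⟩ := fin_one_ne hL
  rw [Sym2.eq_iff] at h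
  rcases h with h | h
  · exact hz h.1
  · have e1 := hz h.1
    have e2 := hz h.2
    exfalso
    apply h2
    rw [e1] at e2
    rw [add_assoc] at e2
    simpa using e2

lemma edge_nd {n L : ℕ} [NeZero L] (hL : 3 ≤ L) (z : Fin L → Fin n) (hz : Function.Injective z)
    (i : Fin L) : ¬ (s(z i, z (i + 1))).IsDiag := by
  obtain ⟨h1, h2⟩ := fin_one_ne hL
  rw [Sym2.mk_isDiag_iff]
  intro h
  have := hz h
  exact h1 (by simpa using this.symm)

lemma card_cycE {n L : ℕ} [NeZero L] (hL : 3 ≤ L) (z : Fin L → Fin n) (hz : Function.Injective z) :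
    (cycE z).card = L := by
  classical
  have : cycE z = univ.image (fun i : Fin L => (⟨s(z i, z (i + 1)), edge_nd hL z hz i⟩ : EV n)) := by
    ext e
    simp only [cycE, mem_filter, mem_univ, true_and, mem_image]
    constructor
    · rintro ⟨i, hi⟩; exact ⟨i, Subtype.ext hi.symm⟩
    · rintro ⟨i, rfl⟩; exact ⟨i, rfl⟩
  rw [this, card_image_of_injective]
  · simp
  · intro i j h
    exact edge_inj hL z hz (congrArg Subtype.val h)

lemma cycle_of_cycE {n L : ℕ} [NeZero L] (hL : 3 ≤ L) (z : Fin L → Fin n) (hz : Function.Injective z)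
    (I : Finset (EV n)) (hI : cycE z ⊆ I) : HasCycleOfLength (gnpGraph I) L := by
  unfold HasCycleOfLength
  rw [← SimpleGraph.cycleGraph_isContained_iff (by omega)]
  have hadj : ∀ i : Fin L, (gnpGraph I).Adj (z i) (z (i + 1)) := by
    intro i
    unfold gnpGraph
    rw [SimpleGraph.fromEdgeSet_adj]
    have hnd := edge_nd hL z hz i
    refine ⟨⟨⟨_, hnd⟩, hI ?_, rfl⟩, ?_⟩
    · simp only [cycE, mem_filter, mem_univ, true_and]
      exact ⟨i, rfl⟩
    · rwa [Sym2.mk_isDiag_iff] at hnd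
  have hv1 : ∀ u v : Fin L, (u - v).val = 1 → u = v + 1 := by
    intro u v h
    have : u - v = 1 := by
      apply Fin.ext
      rw [h]
      obtain ⟨r, rfl⟩ : ∃ r, L = r + 3 := ⟨L - 3, by omega⟩
      simp
    rw [← this]; abel
  refine ⟨⟨⟨z, ?_⟩, hz⟩⟩
  intro u v h
  rw [SimpleGraph.cycleGraph_adj'] at h
  rcases h with h | h
  · rw [hv1 u v h]; exact (hadj v).symm
  · rw [hv1 v u h]; exact hadj u

open Classical in
noncomputable def verts {n : ℕ} (T : Finset (EV n)) : Finset (Fin n) :=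
  univ.filter (fun x => ∃ e ∈ T, x ∈ e.1)

lemma card_verts {n : ℕ} (T : Finset (EV n)) : (verts T).card ≤ 2 * T.card := by
  classical
  have h1 : verts T ⊆ T.biUnion (fun e => univ.filter (fun x => x ∈ e.1)) := by
    intro x hx
    simp only [verts, mem_filter, mem_univ, true_and] at hx
    obtain ⟨e, he, hx⟩ := hx
    simp only [mem_biUnion, mem_filter, mem_univ, true_and]
    exact ⟨e, he, hx⟩
  refine (card_le_card h1).trans ?_
  rw [mul_comm]
  apply card_biUnion_le_card_mul
  rintro ⟨e, he⟩ _
  induction e with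
  | h a b =>
    have : (univ.filter (fun x => x ∈ s(a, b))) ⊆ {a, b} := by
      intro x hx
      simpa using hx
    exact (card_le_card this).trans card_le_two

lemma grow {L : ℕ} [NeZero L] (P : Finset (Fin L)) (hP : P.Nonempty) :
    min (P.card + 1) L ≤ (P ∪ P.image (· + 1)).card := by
  classical
  by_cases h : P.image (· + 1) ⊆ P
  · have hall : ∀ i, i ∈ P := by
      obtain ⟨x, hx⟩ := hP
      have h1 : ∀ t : ℕ, x + (Fin.ofNat L t) ∈ P := by
        intro t
        induction t with
        | zero => 
          have : Fin.ofNat L 0 = 0 := by ext; simp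
          rw [this, add_zero]; exact hx
        | succ t ih =>
          have := h (mem_image_of_mem (· + 1) ih)
          have e : x + Fin.ofNat L (t + 1) = x + Fin.ofNat L t + 1 := by
            rw [add_assoc]
            congr 1
            ext
            simp [Fin.val_add]
          rw [e]; exact this
      intro i
      have := h1 (i - x).val
      have e : Fin.ofNat L (i - x).val = i - x := by
        ext; simp
      rw [e] at this
      simpa using this
    have : P = univ := by ext i; simp [hall i]
    refine (min_le_right _ _).trans ?_
    calc L = P.card := by rw [this]; simp
      _ ≤ _ := card_le_card subset_union_left
  · refine (min_le_left _ _).trans ?_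
    apply card_lt_card
    rw [ssubset_iff_subset_ne]
    refine ⟨subset_union_left, fun he => h ?_⟩
    intro i hi
    rw [he]
    exact mem_union_right _ hi

open Classical in
lemma count_deg {n L : ℕ} [NeZero L] (hn : 0 < n) (hL : 3 ≤ L) (T : Finset (EV n)) (hT : T.Nonempty) :
    ((univ.filter (fun z : Fin L → Fin n => Function.Injective z ∧ T ⊆ cycE z)).card : ℕ) ≤
      2 ^ L * (2 * L) ^ L * n ^ (L - (T.card + 1)) := by
  by_cases hTL : L < T.card
  · have : (univ.filter (fun z : Fin L → Fin n => Function.Injective z ∧ T ⊆ cycE z)) = ∅ := by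
      rw [filter_eq_empty_iff]
      rintro z - ⟨hz, hT'⟩
      have := card_le_card hT'
      rw [card_cycE hL z hz] at this
      omega
    rw [this]; simp
  push Not at hTL
  set QQ : Finset (Finset (Fin L)) := univ.filter (fun Q => min (T.card + 1) L ≤ Q.card) with hQQ
  have hsub : (univ.filter (fun z : Fin L → Fin n => Function.Injective z ∧ T ⊆ cycE z)) ⊆
      QQ.biUnion (fun Q => Fintype.piFinset (fun i => if i ∈ Q then verts T else univ)) := by
    intro z hz
    simp only [mem_filter, mem_univ, true_and] at hz
    obtain ⟨hz, hTz⟩ := hz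
    rw [mem_biUnion]
    set P : Finset (Fin L) := univ.filter (fun i => ∃ e ∈ T, e.1 = s(z i, z (i + 1))) with hP
    have hTP : T.card ≤ P.card := by
      have : T ⊆ P.image (fun i : Fin L => (⟨s(z i, z (i + 1)), edge_nd hL z hz i⟩ : EV n)) := by
        intro e he
        have := hTz he
        simp only [cycE, mem_filter, mem_univ, true_and] at this
        obtain ⟨i, hi⟩ := this
        rw [mem_image]
        refine ⟨i, ?_, Subtype.ext hi.symm⟩
        simp only [hP, mem_filter, mem_univ, true_and]
        exact ⟨e, he, hi⟩
      exact (card_le_card this).trans card_image_le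
    have hPn : P.Nonempty := by
      rw [← card_pos]
      exact lt_of_lt_of_le (card_pos.2 hT) hTP
    refine ⟨P ∪ P.image (· + 1), ?_, ?_⟩
    · simp only [hQQ, mem_filter, mem_univ, true_and]
      refine le_trans ?_ (grow P hPn)
      exact min_le_min (by omega) le_rfl
    · rw [Fintype.mem_piFinset]
      intro i
      split_ifs with hi
      · rw [mem_union, mem_image] at hi
        simp only [verts, mem_filter, mem_univ, true_and]
        rcases hi with hi | ⟨j, hj, rfl⟩
        · simp only [hP, mem_filter, mem_univ, true_and] at hi
          obtain ⟨e, he, hee⟩ := hi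
          exact ⟨e, he, by rw [hee]; simp⟩
        · simp only [hP, mem_filter, mem_univ, true_and] at hj
          obtain ⟨e, he, hee⟩ := hj
          exact ⟨e, he, by rw [hee]; simp⟩
      · exact mem_univ _
  refine (card_le_card hsub).trans ?_
  have hQc : QQ.card ≤ 2 ^ L := by
    refine (card_le_univ QQ).trans ?_
    simp
  calc _ ≤ QQ.card * ((2 * L) ^ L * n ^ (L - (T.card + 1))) := by
        apply card_biUnion_le_card_mul
        intro Q hQ
        simp only [hQQ, mem_filter, mem_univ, true_and] at hQ
        rw [Fintype.card_piFinset]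
        have h1 : ∀ i : Fin L, (if i ∈ Q then verts T else univ).card = 
          (if i ∈ Q then (verts T).card else 1) * (if i ∈ Qᶜ then n else 1) := by
          intro i
          by_cases h : i ∈ Q <;> simp [h]
        rw [prod_congr rfl (fun i _ => h1 i), prod_mul_distrib, prod_ite_mem, prod_ite_mem]
        simp only [univ_inter, prod_const, card_compl, Fintype.card_fin]
        have hv := card_verts T
        have hQL : Q.card ≤ L := by simpa using card_le_univ Q
        apply Nat.mul_le_mul
        · calc (verts T).card ^ Q.card ≤ (2 * L) ^ Q.card := by gcongr; omega
            _ ≤ (2 * L) ^ L := by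
              apply Nat.pow_le_pow_right (by omega) hQL
        · apply Nat.pow_le_pow_right hn
          omega
    _ ≤ 2 ^ L * ((2 * L) ^ L * n ^ (L - (T.card + 1))) := by gcongr
    _ = _ := by ring

open Classical in
lemma count_noninj (n L : ℕ) (hL : 0 < L) :
    (univ.filter (fun z : Fin L → Fin n => ¬ Function.Injective z)).card ≤ L ^ 2 * n ^ (L - 1) := by
  have hsub : (univ.filter (fun z : Fin L → Fin n => ¬ Function.Injective z)) ⊆
    ((univ : Finset (Fin L × Fin L)).filter (fun p => p.1 ≠ p.2)).biUnion
      (fun p => univ.filter (fun z => z p.1 = z p.2)) := by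
    intro z hz
    rw [mem_filter] at hz
    have hz := hz.2
    unfold Function.Injective at hz
    push Not at hz
    obtain ⟨i, j, h, hne⟩ := hz
    simp only [mem_biUnion, mem_filter, mem_univ, true_and]
    exact ⟨(i, j), hne, h⟩
  refine (card_le_card hsub).trans ?_
  calc _ ≤ ((univ : Finset (Fin L × Fin L)).filter (fun p => p.1 ≠ p.2)).card * n ^ (L - 1) := by
        apply card_biUnion_le_card_mul
        rintro ⟨i, j⟩ hij
        simp only [mem_filter, mem_univ, true_and] at hij ⊢
        have : n ^ (L - 1) = (univ : Finset ({k : Fin L // k ≠ i} → Fin n)).card := by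
          simp
        rw [this]
        apply card_le_card_of_injOn (fun z k => z k.1) (fun _ _ => mem_coe.2 (mem_univ _))
        intro z hz w hw h
        simp only [coe_filter, mem_univ, true_and, Set.mem_ofPred_eq] at hz hw
        funext k
        by_cases hk : k = i
        · subst hk
          rw [hz, hw]
          exact congrFun h ⟨j, hij.symm⟩
        · exact congrFun h ⟨k, hk⟩
    _ ≤ _ := by
        gcongr
        refine (card_le_univ _).trans ?_
        simp [sq]

open Classical in
lemma supersat (l n : ℕ) [NeZero (2 * l)] (hl : 2 ≤ l) (hn : 0 < n) (A : Finset (EV n))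
    (hA : (n : ℝ) ^ 2 / 32 < A.card) :
    (1 / 32 : ℝ) ^ (l * l) * (n : ℝ) ^ (2 * l) - (2 * l : ℕ) ^ 2 * (n : ℝ) ^ (2 * l - 1) ≤
    (univ.filter (fun z : Fin (2 * l) → Fin n => Function.Injective z ∧ cycE z ⊆ A)).card := by
  set R : Fin n → Fin n → Prop := fun x y => ∃ e ∈ A, e.1 = s(x, y) with hR
  have hsymm : ∀ x y, R x y → R y x := by
    rintro x y ⟨e, he, h⟩
    exact ⟨e, he, by rw [h, Sym2.eq_swap]⟩
  obtain ⟨k, rfl⟩ : ∃ k, l = k + 1 := ⟨l - 1, by omega⟩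
  have h1 := kll n k hn R (1 / 32) (by norm_num) (by
    have : A.card ≤ (univ.filter (fun p : Fin n × Fin n => R p.1 p.2)).card := by
      have hsub : A.image (fun e => e.1) ⊆ 
        (univ.filter (fun p : Fin n × Fin n => R p.1 p.2)).image (fun p => s(p.1, p.2)) := by
        intro e he
        rw [mem_image] at he
        obtain ⟨e', he', rfl⟩ := he
        obtain ⟨⟨a, b⟩, hab⟩ : ∃ p : Fin n × Fin n, s(p.1, p.2) = e'.1 := by
          obtain ⟨p, hp⟩ := Quot.exists_rep e'.1
          exact ⟨p, hp⟩
        rw [mem_image]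
        refine ⟨(a, b), ?_, hab⟩
        simp only [mem_filter, mem_univ, true_and, hR]
        exact ⟨e', he', hab.symm⟩
      have h2 := (card_le_card hsub).trans card_image_le
      rwa [card_image_of_injective _ Subtype.val_injective] at h2
    have h3 : (A.card : ℝ) ≤ (univ.filter (fun p : Fin n × Fin n => R p.1 p.2)).card := by
      exact_mod_cast this
    have h4 : (1 / 32 : ℝ) * n ^ 2 ≤ (univ.filter (fun p : Fin n × Fin n => R p.1 p.2)).card := by
      linarith
    convert h4)
  set S1 := univ.filter (fun p : (Fin (k + 1) → Fin n) × (Fin (k + 1) → Fin n) =>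
      ∀ i j, R (p.2 i) (p.1 j)) with hS1
  set S2 := univ.filter (fun z : Fin (2 * (k + 1)) → Fin n => ∀ i, R (z i) (z (i + 1))) with hS2
  have h12 : S1.card ≤ S2.card := by
    apply card_le_card_of_injOn (fun p i => if i.val % 2 = 0 then p.1 ⟨i.val / 2, by omega⟩
      else p.2 ⟨i.val / 2, by omega⟩)
    · intro p hp
      simp only [hS1, coe_filter, mem_univ, true_and, Set.mem_ofPred_eq] at hp
      simp only [hS2, coe_filter, mem_univ, true_and, Set.mem_ofPred_eq]
      intro i
      have hi : (i + 1).val % 2 ≠ i.val % 2 := by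
        rw [Fin.val_add]
        have h1 : ((1 : Fin (2 * (k + 1))).val) = 1 := by
          have : 2 * (k + 1) = 2 * k + 1 + 1 := by ring
          have e : (1 : Fin (2 * (k + 1))).val = 1 % (2 * (k + 1)) := rfl
          rw [e, Nat.mod_eq_of_lt (by omega)]
        rw [h1, Nat.mod_mul_right_mod]
        omega
      by_cases h0 : i.val % 2 = 0
      · rw [if_pos h0, if_neg (by omega)]
        exact hsymm _ _ (hp _ _)
      · rw [if_neg h0, if_pos (by omega)]
        exact hp _ _
    · intro p _ q _ h
      have h' := fun i => congrFun h i
      ext j : 2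
      · have := h' ⟨2 * j.val, by omega⟩
        simpa using this
      · have := h' ⟨2 * j.val + 1, by omega⟩
        have e : (2 * j.val + 1) / 2 = j.val := by omega
        have e2 : (2 * j.val + 1) % 2 = 1 := by omega
        simpa [e, e2] using this
  have h3 : S2 ⊆ (univ.filter (fun z : Fin (2 * (k + 1)) → Fin n => Function.Injective z ∧ cycE z ⊆ A)) ∪
      (univ.filter (fun z : Fin (2 * (k + 1)) → Fin n => ¬ Function.Injective z)) := by
    intro z hz
    simp only [hS2, mem_filter, mem_univ, true_and] at hz
    simp only [mem_union, mem_filter, mem_univ, true_and]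
    by_cases hinj : Function.Injective z
    · left
      refine ⟨hinj, ?_⟩
      intro e he
      simp only [cycE, mem_filter, mem_univ, true_and] at he
      obtain ⟨i, hi⟩ := he
      obtain ⟨e', he', h⟩ := hz i
      have : e = e' := Subtype.ext (hi.trans h.symm)
      rwa [this]
    · right; exact hinj
  have h4 := (card_le_card h3).trans (card_union_le _ _)
  have h5 := count_noninj n (2 * (k + 1)) (by omega)
  have h6 : (S1.card : ℝ) ≤ 
    (univ.filter (fun z : Fin (2 * (k + 1)) → Fin n => Function.Injective z ∧ cycE z ⊆ A)).card
     + (2 * (k + 1) : ℕ) ^ 2 * (n : ℝ) ^ (2 * (k + 1) - 1) := by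
    exact_mod_cast h12.trans (h4.trans (by omega))
  have h7 : ((1 : ℝ) / 32) ^ ((k + 1) * (k + 1)) * (n : ℝ) ^ (2 * (k + 1)) ≤ S1.card := by
    convert h1
  linarith

end CC

namespace CC

lemma hyper (l n : ℕ) [NeZero (2 * l)] (hl : 2 ≤ l) (hn : 0 < n) (τ c0 K0 : ℝ) (hτ : 0 < τ)
    (hτn : 1 / (n : ℝ) ≤ τ) (hτp : (n : ℝ) ^ (2 * l - 2) * τ ^ (2 * l - 1) = 1)
    (hc0 : c0 = (1 / 32 : ℝ) ^ (l * l)) (hK0 : K0 = 2 ^ (2 * l) * (2 * (2 * l)) ^ (2 * l))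
    (hnl : 2 * (2 * l) ^ 2 / c0 ≤ n)
    (A : Finset (EV n)) (hA : (n : ℝ) ^ 2 / 32 < A.card) :
    ∃ H0 : Multiset (Finset (EV n)),
      (∀ e ∈ H0, e.card = 2 * l) ∧ (∀ e ∈ H0, e ⊆ A) ∧
      (∀ T : Finset (EV n), T.Nonempty →
        deg H0 T ≤ (K0 * (n : ℝ) ^ (2 * l - 2) / τ) * τ ^ T.card) ∧
      ((c0 / (2 * K0)) * (K0 * (n : ℝ) ^ (2 * l - 2) / τ) * τ * Fintype.card (EV n)
        ≤ Multiset.card H0) ∧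
      (∀ I ∈ {I : Finset (EV n) | ¬ HasCycleOfLength (gnpGraph I) (2 * l)}, ∀ e ∈ H0, ¬ e ⊆ I) := by
  classical
  have hn' : (0 : ℝ) < n := by exact_mod_cast hn
  have hc0' : 0 < c0 := by rw [hc0]; positivity
  have hK0' : 0 < K0 := by
    rw [hK0]
    have : (0 : ℝ) < l := by exact_mod_cast (by omega : 0 < l)
    positivity
  set Zs := univ.filter (fun z : Fin (2 * l) → Fin n => Function.Injective z ∧ cycE z ⊆ A) with hZs
  have hmem : ∀ e, e ∈ Zs.val.map cycE → 
      ∃ z : Fin (2 * l) → Fin n, Function.Injective z ∧ cycE z ⊆ A ∧ cycE z = e := by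
    intro e he
    rw [Multiset.mem_map] at he
    obtain ⟨z, hz, rfl⟩ := he
    rw [mem_val, hZs, mem_filter] at hz
    exact ⟨z, hz.2.1, hz.2.2, rfl⟩
  refine ⟨Zs.val.map cycE, ?_, ?_, ?_, ?_, ?_⟩
  · intro e he
    obtain ⟨z, h1, h2, rfl⟩ := hmem e he
    exact card_cycE (by omega) z h1
  · intro e he
    obtain ⟨z, h1, h2, rfl⟩ := hmem e he
    exact h2
  · intro T hT
    have hT1 : 1 ≤ T.card := card_pos.2 hT
    by_cases hTL : 2 * l < T.card
    · rw [deg_eq_zero]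
      · positivity
      · intro e he hTe
        obtain ⟨z, h1, h2, rfl⟩ := hmem e he
        have := card_le_card hTe
        rw [card_cycE (by omega) z h1] at this
        omega
    push Not at hTL
    have h1 : deg (Zs.val.map cycE) T ≤ K0 * (n : ℝ) ^ (2 * l - (T.card + 1)) := by
      have h2 := count_deg (L := 2 * l) hn (by omega) T hT
      unfold deg
      rw [Multiset.countP_map]
      have h3 : Multiset.card (Multiset.filter (fun z => T ⊆ cycE z) Zs.val) ≤
        (univ.filter (fun z : Fin (2 * l) → Fin n => Function.Injective z ∧ T ⊆ cycE z)).card := by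
        change (Zs.filter (fun z => T ⊆ cycE z)).card ≤ _
        apply card_le_card
        intro z hz
        simp only [hZs, mem_filter, mem_univ, true_and] at hz ⊢
        exact ⟨hz.1.1, hz.2⟩
      have h4 := h3.trans h2
      rw [hK0]
      exact_mod_cast h4
    refine h1.trans ?_
    obtain ⟨j, hj⟩ : ∃ j, T.card = j + 1 := ⟨T.card - 1, by omega⟩
    rw [hj] at hTL ⊢
    have e1 : K0 * (n : ℝ) ^ (2 * l - 2) / τ * τ ^ (j + 1) = K0 * ((n : ℝ) ^ (2 * l - 2) * τ ^ j) := by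
      rw [pow_succ]; field_simp
    rw [e1]
    apply mul_le_mul_of_nonneg_left _ hK0'.le
    by_cases hj2 : j + 1 = 2 * l
    · have : j = 2 * l - 1 := by omega
      rw [this, hτp]
      have : 2 * l - (2 * l - 1 + 1 + 1) = 0 := by omega
      rw [this, pow_zero]
    · have e2 : 2 * l - 2 = (2 * l - (j + 1 + 1)) + j := by omega
      have h5 : 1 ≤ n * τ := by
        rw [div_le_iff₀ hn'] at hτn; linarith
      calc (n : ℝ) ^ (2 * l - (j + 1 + 1)) = (n : ℝ) ^ (2 * l - (j + 1 + 1)) * 1 := by ring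
        _ ≤ (n : ℝ) ^ (2 * l - (j + 1 + 1)) * (n * τ) ^ j := by
            gcongr
            exact one_le_pow₀ h5
        _ = _ := by
            rw [e2, pow_add, mul_pow]
            have e3 : 2 * l - (j + 1 + 1) + j - j = 2 * l - (j + 1 + 1) := by omega
            ring
  · have h1 := supersat l n hl hn A hA
    rw [Multiset.card_map]
    change _ ≤ ((Zs.card : ℕ) : ℝ)
    refine le_trans ?_ (h1.trans (le_of_eq (by congr)))
    have hN : (Fintype.card (EV n) : ℝ) ≤ (n : ℝ) ^ 2 := by
      have : Fintype.card (EV n) ≤ n ^ 2 := by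
        have h := Sym2.card_subtype_not_diag (α := Fin n)
        rw [Fintype.card_fin] at h
        have h' : Fintype.card (EV n) = n.choose 2 := by
          rw [← h]
        rw [h']
        exact Nat.choose_le_pow n 2
      exact_mod_cast this
    have e1 : (c0 / (2 * K0)) * (K0 * (n : ℝ) ^ (2 * l - 2) / τ) * τ * Fintype.card (EV n) = 
      c0 / 2 * (n : ℝ) ^ (2 * l - 2) * Fintype.card (EV n) := by
      field_simp
    rw [e1, ← hc0]
    have e2 : (n : ℝ) ^ (2 * l) = (n : ℝ) ^ (2 * l - 2) * n ^ 2 := by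
      rw [← pow_add]; congr 1; omega
    have e3 : (n : ℝ) ^ (2 * l - 1) = (n : ℝ) ^ (2 * l - 2) * n := by
      rw [← pow_succ]; congr 1; omega
    rw [e2, e3]
    rw [div_le_iff₀ hc0'] at hnl
    have h3 : (0 : ℝ) < (n : ℝ) ^ (2 * l - 2) := by positivity
    have h4 : c0 / 2 * Fintype.card (EV n) ≤ c0 * n ^ 2 - (2 * l : ℕ) ^ 2 * n := by
      push_cast
      have : c0 / 2 * Fintype.card (EV n) ≤ c0 / 2 * n ^ 2 := by gcongr
      nlinarith
    calc _ = (n : ℝ) ^ (2 * l - 2) * (c0 / 2 * Fintype.card (EV n)) := by ring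
      _ ≤ (n : ℝ) ^ (2 * l - 2) * (c0 * n ^ 2 - (2 * l : ℕ) ^ 2 * n) := by gcongr
      _ = _ := by ring
  · intro I hI e he hsub
    obtain ⟨z, h1, h2, rfl⟩ := hmem e he
    exact hI (cycle_of_cycE (by omega) z h1 I hsub)

end CC

theorem cycles_in_sparse_subgraphs (l : ℕ) (hl : 2 ≤ l) (ε : ℝ) (hε : 0 < ε ∧ ε < 1) :
    ∃ C : ℝ, 0 < C ∧ ∀ p : ℕ → ℝ, (∀ n, 0 < p n ∧ p n ≤ 1) →
      (∀ᶠ n : ℕ in Filter.atTop,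
        C * (n : ℝ) ^ ((-1 : ℝ) + 1 / (2 * (l : ℝ) - 1)) ≤ p n) →
      Filter.Tendsto
        (fun n : ℕ => gnpProb n (p n) (fun E =>
          ∀ E' ⊆ E, (1 + ε) * (n : ℝ) ^ 2 * p n / 8 ≤ (E'.card : ℝ) →
            HasCycleOfLength (gnpGraph E') (2 * l)))
        Filter.atTop (nhds 1) := by
  haveI : NeZero (2 * l) := ⟨by omega⟩
  have hl' : (2 : ℝ) ≤ l := by exact_mod_cast hl
  set c0 : ℝ := (1 / 32 : ℝ) ^ (l * l) with hc0
  set K0 : ℝ := 2 ^ (2 * l) * (2 * (2 * l)) ^ (2 * l) with hK0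
  have hc0' : 0 < c0 := by positivity
  have hK0' : 0 < K0 := by positivity
  obtain ⟨K, hK, hcont⟩ := CC.containers (2 * l) (c0 / (2 * K0)) (by positivity)
  refine ⟨500 * K, by positivity, ?_⟩
  intro p hp hpC
  have hlow : ∀ᶠ n : ℕ in Filter.atTop, 1 - Real.exp (-(5 * K * (n : ℝ))) ≤ gnpProb n (p n) (fun E =>
          ∀ E' ⊆ E, (1 + ε) * (n : ℝ) ^ 2 * p n / 8 ≤ (E'.card : ℝ) →
            HasCycleOfLength (gnpGraph E') (2 * l)) := by
    obtain ⟨n0, hn0⟩ := exists_nat_gt (2 * (2 * (l : ℝ)) ^ 2 / c0)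
    filter_upwards [hpC, Filter.eventually_ge_atTop n0, Filter.eventually_ge_atTop 2] with n hpn hnn0 hn2
    have hn : 0 < n := by omega
    have hn' : (0 : ℝ) < n := by exact_mod_cast hn
    have hn1 : (1 : ℝ) ≤ n := by exact_mod_cast hn
    set τ : ℝ := (n : ℝ) ^ ((-1 : ℝ) + 1 / (2 * (l : ℝ) - 1)) with hτd
    have hτ : 0 < τ := by positivity
    have hl1 : (0 : ℝ) < 2 * (l : ℝ) - 1 := by linarith
    have hτ1 : τ ≤ 1 := by
      apply Real.rpow_le_one_of_one_le_of_nonpos hn1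
      have : 1 / (2 * (l : ℝ) - 1) ≤ 1 := by
        rw [div_le_one hl1]; linarith
      linarith
    have hτn : 1 / (n : ℝ) ≤ τ := by
      have : 1 / (n : ℝ) = (n : ℝ) ^ (-1 : ℝ) := by rw [Real.rpow_neg_one, one_div]
      rw [this]
      apply Real.rpow_le_rpow_of_exponent_le hn1
      have : 0 < 1 / (2 * (l : ℝ) - 1) := by positivity
      linarith
    have hτp : (n : ℝ) ^ (2 * l - 2) * τ ^ (2 * l - 1) = 1 := by
      rw [hτd, ← Real.rpow_natCast, ← Real.rpow_natCast, ← Real.rpow_mul hn'.le, ← Real.rpow_add hn']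
      rw [Nat.cast_sub (by omega), Nat.cast_sub (by omega)]
      push_cast
      have : (2 * (l : ℝ) - 2 + (-1 + 1 / (2 * (l : ℝ) - 1)) * (2 * (l : ℝ) - 1)) = 0 := by
        field_simp
        ring
      rw [this, Real.rpow_zero]
    haveI : Nonempty (CC.EV n) := by
      refine ⟨⟨s(⟨0, by omega⟩, ⟨1, by omega⟩), ?_⟩⟩
      rw [Sym2.mk_isDiag_iff]
      simp
    have hN : (Fintype.card (CC.EV n) : ℝ) ≤ (n : ℝ) ^ 2 := by
      have : Fintype.card (CC.EV n) ≤ n ^ 2 := by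
        have h := Sym2.card_subtype_not_diag (α := Fin n)
        rw [Fintype.card_fin] at h
        have h' : Fintype.card (CC.EV n) = n.choose 2 := by
          rw [← h]
        rw [h']
        exact Nat.choose_le_pow n 2
      exact_mod_cast this
    have hC := hcont (CC.EV n) τ (K0 * (n : ℝ) ^ (2 * l - 2) / τ) ((n : ℝ) ^ 2 / 32) hτ hτ1
      (by positivity) (by positivity) {I : Finset (CC.EV n) | ¬ HasCycleOfLength (gnpGraph I) (2 * l)}
      (fun A hA => CC.hyper l n hl hn τ c0 K0 hτ hτn hτp hc0 hK0
        (hn0.le.trans (by exact_mod_cast hnn0)) A hA)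
    have hb := CC.prob_bound (p n) (hp n).1.le (hp n).2 (fun E : Finset (CC.EV n) =>
          ∀ E' ⊆ E, (1 + ε) * (n : ℝ) ^ 2 * p n / 8 ≤ (E'.card : ℝ) →
            HasCycleOfLength (gnpGraph E') (2 * l)) _ _ _ ((1 + ε) * (n : ℝ) ^ 2 * p n / 8) 5
            (by norm_num) hC (by
        intro E hE
        push Not at hE
        obtain ⟨E', h1, h2, h3⟩ := hE
        exact ⟨E', h1, h3, h2⟩)
    unfold gnpProb
    refine le_trans ?_ hb
    apply sub_le_sub_left
    apply Real.exp_le_exp.2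
    have hp0 := (hp n).1
    set N : ℝ := (Fintype.card (CC.EV n) : ℝ)
    have hNn : 0 ≤ N := by positivity
    have hnτ : (n : ℝ) ≤ τ * n ^ 2 := by
      rw [div_le_iff₀ hn'] at hτn
      nlinarith
    have hY : 500 * K * (τ * (n : ℝ) ^ 2) ≤ p n * n ^ 2 := by
      have : 0 ≤ (n : ℝ) ^ 2 := by positivity
      nlinarith
    set Y : ℝ := p n * (n : ℝ) ^ 2 with hYd
    have hY0 : 0 < Y := by positivity
    have t1 : 5 * (K * (τ * N + 1)) ≤ 0.02 * Y := by
      have h1 : τ * N ≤ τ * n ^ 2 := by gcongr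
      have h2 : K * (τ * N + 1) ≤ K * (2 * (τ * n ^ 2)) := by
        gcongr; linarith
      linarith
    have t2 : 2 * p n * Real.exp (-5) * N ≤ 0.02 * Y := by
      have h1 : Real.exp (-5) ≤ 0.01 := by
        rw [Real.exp_neg]
        have h2 : (100 : ℝ) ≤ Real.exp 5 := by
          have h3 := Real.exp_one_gt_d9
          have h4 : Real.exp 5 = Real.exp 1 ^ 5 := by rw [← Real.exp_nat_mul]; norm_num
          rw [h4]
          calc (100 : ℝ) ≤ 2.7 ^ 5 := by norm_num
            _ ≤ _ := by gcongr; linarith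
        calc (Real.exp 5)⁻¹ ≤ (100 : ℝ)⁻¹ := by gcongr
          _ = 0.01 := by norm_num
      calc 2 * p n * Real.exp (-5) * N ≤ 2 * p n * 0.01 * n ^ 2 := by gcongr
        _ = 0.02 * Y := by rw [hYd]; ring
    have t3 : 0.08625 * Y ≤ (1 + ε) * (n : ℝ) ^ 2 * p n / 8 * Real.log 2 := by
      have h1 := Real.log_two_gt_d9
      have h2 : Y / 8 ≤ (1 + ε) * (n : ℝ) ^ 2 * p n / 8 := by
        have : (1 + ε) * (n : ℝ) ^ 2 * p n / 8 = Y / 8 + ε * Y / 8 := by rw [hYd]; ring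
        rw [this]
        have : 0 < ε * Y := mul_pos hε.1 hY0
        linarith
      calc 0.08625 * Y = Y / 8 * 0.69 := by ring
        _ ≤ _ := by
          apply mul_le_mul h2 (by linarith) (by norm_num)
          linarith
    have t4 : p n * ((n : ℝ) ^ 2 / 32) = 0.03125 * Y := by rw [hYd]; ring
    have t5 : 500 * K * n ≤ Y := by
      refine le_trans ?_ hY
      gcongr
    linarith
  have hlim : Filter.Tendsto (fun n : ℕ => 1 - Real.exp (-(5 * K * (n : ℝ)))) Filter.atTop (nhds 1) := by
    have h1 : Filter.Tendsto (fun n : ℕ => 5 * K * (n : ℝ)) Filter.atTop Filter.atTop :=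
      Filter.Tendsto.const_mul_atTop (by positivity) tendsto_natCast_atTop_atTop
    have h2 := (Real.tendsto_exp_neg_atTop_nhds_zero.comp h1).const_sub 1
    simpa [Function.comp_def] using h2
  refine tendsto_of_tendsto_of_tendsto_of_le_of_le' hlim tendsto_const_nhds hlow ?_
  exact Filter.Eventually.of_forall (fun n => CC.prob_le_one _ (hp n).1.le (hp n).2 _)
end

section
/- Let (H_n) be a sequence of k-uniform hypergraphs, let (p_n) be a sequence of probabilities in (0,1], and let (v_n) and (e_n) be sequences of positive integers satisfying p_n·v_n → ∞ and p_n^k·e_n → ∞ as n → ∞. Let α ≥ 0, K ≥ 1, and let f : (0,1) → (0,1) be non-decreasing. Then for every ε ∈ (0,1) there exist ε₀ ∈ (0,1), b > 0, C ≥ 1 and n₀ ≥ 1 such that for every n ≥ n₀ and every q with C·p_n ≤ q ≤ n^{-1/3} the following holds: if H_n is (α, f, ε₀)-dense and (K, p_n)-bounded, with |V(H_n)| ≥ v_n and |E(H_n)| ≥ e_n, then with probability at least 1 − e^{−b·q·v_n}, every subset W of the binomial random subset V(H_n)_q with |W| ≥ (α+ε)·|V(H_n)_q| contains a hyperedge of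 H_n. -/
open Finset

open Classical in
/-- The hypergraph with vertex set `V` and hyperedge set `edges` is `(a, f, e0)`-dense:
for every `ε ≥ e0` (in the domain `(0,1)` of `f`) and every `U ⊆ V` with
`|U| ≥ (a + ε)|V|`, at least `f ε · |edges|` hyperedges lie entirely inside `U`. -/
def HyperDense {α : Type*} (V : Finset α) (edges : Finset (Finset α)) (a : ℝ)
    (f : ℝ → ℝ) (e0 : ℝ) : Prop :=
  ∀ ε : ℝ, e0 ≤ ε → ε < 1 → ∀ U ⊆ V, (a + ε) * (V.card : ℝ) ≤ (U.card : ℝ) →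
    f ε * (edges.card : ℝ) ≤ (((edges.filter (fun X => X ⊆ U)).card : ℕ) : ℝ)

open Classical in
/-- `deg_i(v, U)`: the number of hyperedges `X` with `v ∈ X` and `|X ∩ (U \ {v})| ≥ i`. -/
noncomputable def hyperDeg {α : Type*} (edges : Finset (Finset α)) (i : ℕ) (v : α)
    (U : Finset α) : ℕ :=
  (edges.filter (fun X => v ∈ X ∧ i ≤ (X ∩ (U.erase v)).card)).card

open Classical in
/-- Expectation of `X` over the Bernoulli(`q`) random subset of `V`. -/
noncomputable def subsetExpOn {α : Type*} (V : Finset α) (q : ℝ) (X : Finset α → ℝ) : ℝ :=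
  ∑ A ∈ V.powerset, q ^ A.card * (1 - q) ^ (V.card - A.card) * X A

/-- The `k`-uniform hypergraph with vertex set `V` and hyperedge set `edges` is
`(K, p)`-bounded. -/
noncomputable def HyperBounded {α : Type*} (V : Finset α) (edges : Finset (Finset α))
    (k : ℕ) (K p : ℝ) : Prop :=
  ∀ i : ℕ, 1 ≤ i → i ≤ k - 1 → ∀ q : ℝ, p ≤ q → q ≤ 1 →
    subsetExpOn V q (fun A => ∑ v ∈ V, (hyperDeg edges i v A : ℝ) ^ 2) ≤
      K * q ^ (2 * i) * (edges.card : ℝ) ^ 2 / (V.card : ℝ)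

section aux

open Classical

lemma ex_insert {τ : Type*} (V : Finset τ) (v : τ) (hv : v ∉ V) (q : ℝ) (X : Finset τ → ℝ) :
    subsetExpOn (insert v V) q X = (1 - q) * subsetExpOn V q X
      + q * subsetExpOn V q (fun A => X (insert v A)) := by
  unfold subsetExpOn
  rw [Finset.sum_powerset_insert hv, Finset.mul_sum, Finset.mul_sum]
  congr 1
  · refine Finset.sum_congr rfl fun A hA => ?_
    have h := Finset.card_le_card (Finset.mem_powerset.1 hA)
    rw [Finset.card_insert_of_notMem hv, Nat.succ_sub h, pow_succ]
    ring
  · refine Finset.sum_congr rfl fun A hA => ?_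
    have hA' : v ∉ A := fun h => hv (Finset.mem_powerset.1 hA h)
    rw [Finset.card_insert_of_notMem hv, Finset.card_insert_of_notMem hA', Nat.add_sub_add_right,
      pow_succ]
    ring

lemma ex_mono {τ : Type*} (V : Finset τ) {q : ℝ} (h0 : 0 ≤ q) (h1 : q ≤ 1) {X Y : Finset τ → ℝ}
    (h : ∀ A ⊆ V, X A ≤ Y A) : subsetExpOn V q X ≤ subsetExpOn V q Y := by
  unfold subsetExpOn
  refine Finset.sum_le_sum fun A hA => ?_
  have : 0 ≤ 1 - q := by linarith
  exact mul_le_mul_of_nonneg_left (h A (Finset.mem_powerset.1 hA)) (by positivity)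

lemma ex_congr {τ : Type*} (V : Finset τ) {q : ℝ} {X Y : Finset τ → ℝ}
    (h : ∀ A ⊆ V, X A = Y A) : subsetExpOn V q X = subsetExpOn V q Y := by
  unfold subsetExpOn
  exact Finset.sum_congr rfl fun A hA => by rw [h A (Finset.mem_powerset.1 hA)]

lemma ex_const {τ : Type*} (V : Finset τ) (q c : ℝ) : subsetExpOn V q (fun _ => c) = c := by
  unfold subsetExpOn
  rw [← Finset.sum_mul, Finset.sum_pow_mul_eq_add_pow]
  simp

lemma ex_sub {τ : Type*} (V : Finset τ) (q : ℝ) (X Y : Finset τ → ℝ) :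
    subsetExpOn V q (fun A => X A - Y A) = subsetExpOn V q X - subsetExpOn V q Y := by
  unfold subsetExpOn
  rw [← Finset.sum_sub_distrib]
  exact Finset.sum_congr rfl fun A hA => by ring

lemma ex_mul {τ : Type*} (V : Finset τ) (q c : ℝ) (X : Finset τ → ℝ) :
    subsetExpOn V q (fun A => c * X A) = c * subsetExpOn V q X := by
  unfold subsetExpOn
  rw [Finset.mul_sum]
  exact Finset.sum_congr rfl fun A hA => by ring

lemma ex_sum {τ ι : Type*} (V : Finset τ) (q : ℝ) (s : Finset ι) (X : ι → Finset τ → ℝ) :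
    subsetExpOn V q (fun A => ∑ i ∈ s, X i A) = ∑ i ∈ s, subsetExpOn V q (X i) := by
  unfold subsetExpOn
  rw [Finset.sum_comm]
  exact Finset.sum_congr rfl fun A hA => by rw [Finset.mul_sum]

lemma ex_nonneg {τ : Type*} (V : Finset τ) {q : ℝ} (h0 : 0 ≤ q) (h1 : q ≤ 1) {X : Finset τ → ℝ}
    (h : ∀ A ⊆ V, 0 ≤ X A) : 0 ≤ subsetExpOn V q X := by
  rw [← ex_const V q 0]
  exact ex_mono V h0 h1 h

lemma ex_mem {τ : Type*} (V : Finset τ) (v : τ) (hv : v ∈ V) (q : ℝ) (g : Finset τ → ℝ) :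
    subsetExpOn V q (fun A => if v ∈ A then g A else 0)
      = q * subsetExpOn V q (fun A => g (insert v A)) := by
  obtain ⟨U, hU, rfl⟩ : ∃ U, v ∉ U ∧ V = insert v U :=
    ⟨V.erase v, by simp, by rw [Finset.insert_erase hv]⟩
  rw [ex_insert U v hU, ex_insert U v hU]
  have : subsetExpOn U q (fun A => if v ∈ A then g A else 0) = 0 := by
    refine (ex_congr U fun A hA => ?_).trans (ex_const U q 0)
    rw [if_neg fun h => hU (hA h)]
  rw [this]
  simp only [Finset.mem_insert_self, if_true, Finset.insert_idem]
  ring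

lemma ex_subset {τ : Type*} (V : Finset τ) (q : ℝ) (T : Finset τ) (hT : T ⊆ V)
    (g : Finset τ → ℝ) :
    subsetExpOn V q (fun A => if T ⊆ A then g A else 0)
      = q ^ T.card * subsetExpOn V q (fun A => g (A ∪ T)) := by
  induction T using Finset.induction_on generalizing g with
  | empty => simp
  | insert v T hv ih =>
    have hv' : v ∈ V := hT (Finset.mem_insert_self _ _)
    have hT' : T ⊆ V := fun x hx => hT (Finset.mem_insert_of_mem hx)
    have e1 : subsetExpOn V q (fun A => if insert v T ⊆ A then g A else 0)
        = subsetExpOn V q (fun A => if v ∈ A then (if T ⊆ A then g A else 0) else 0) := by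
      refine ex_congr V fun A _ => ?_
      simp only [Finset.insert_subset_iff]
      split_ifs <;> simp_all
    have e2 : subsetExpOn V q (fun A => (if T ⊆ insert v A then g (insert v A) else 0))
        = subsetExpOn V q (fun A => if T ⊆ A then g (insert v A) else 0) := by
      refine ex_congr V fun A _ => ?_
      simp only [Finset.subset_insert_iff_of_notMem hv]
    rw [e1, ex_mem V v hv' q (fun A => if T ⊆ A then g A else 0), e2,
      ih hT' (fun A => g (insert v A)), Finset.card_insert_of_notMem hv, pow_succ]
    have e3 : subsetExpOn V q (fun A => g (insert v (A ∪ T)))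
        = subsetExpOn V q (fun A => g (A ∪ insert v T)) := by
      refine ex_congr V fun A _ => ?_
      rw [Finset.union_insert]
    rw [e3]; ring

lemma ex_prod {τ : Type*} (V : Finset τ) (q : ℝ) (w : τ → ℝ) :
    subsetExpOn V q (fun A => ∏ v ∈ A, w v) = ∏ v ∈ V, (1 + q * (w v - 1)) := by
  have : ∀ v, 1 + q * (w v - 1) = q * w v + (1 - q) := fun v => by ring
  simp only [this]
  rw [Finset.prod_add]
  unfold subsetExpOn
  refine Finset.sum_congr rfl fun A hA => ?_
  rw [Finset.prod_mul_distrib, Finset.prod_const, Finset.prod_const,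
    Finset.card_sdiff_of_subset (Finset.mem_powerset.1 hA)]
  ring

lemma one_sub_sum_le_prod {ι : Type*} (s : Finset ι) (g : ι → ℝ) (h0 : ∀ i ∈ s, 0 ≤ g i)
    (h1 : ∀ i ∈ s, g i ≤ 1) : 1 - ∑ i ∈ s, g i ≤ ∏ i ∈ s, (1 - g i) := by
  induction s using Finset.induction_on with
  | empty => simp
  | insert a s ha ih =>
    rw [Finset.sum_insert ha, Finset.prod_insert ha]
    have h2 := ih (fun i hi => h0 i (Finset.mem_insert_of_mem hi))
      (fun i hi => h1 i (Finset.mem_insert_of_mem hi))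
    have h3 := h0 a (Finset.mem_insert_self _ _)
    have h4 := h1 a (Finset.mem_insert_self _ _)
    have h5 : ∏ i ∈ s, (1 - g i) ≤ 1 := Finset.prod_le_one
      (fun i hi => by linarith [h1 i (Finset.mem_insert_of_mem hi)])
      (fun i hi => by linarith [h0 i (Finset.mem_insert_of_mem hi)])
    nlinarith

lemma janson {τ : Type*} (V : Finset τ) {q r : ℝ} (h0 : 0 ≤ q) (h1 : q ≤ 1) (hr0 : 0 ≤ r)
    (hr1 : r ≤ 1) (F : Finset (Finset τ)) (hF : ∀ X ∈ F, X ⊆ V) :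
    subsetExpOn V q (fun A => ∏ X ∈ F, (1 - r * (if X ⊆ A then 1 else 0))) ≤
      Real.exp (- r * ∑ X ∈ F, q ^ X.card
        + r ^ 2 * ∑ X ∈ F, ∑ Y ∈ F, if Disjoint X Y then 0 else q ^ (X ∪ Y).card) := by
  have hfac : ∀ X A : Finset τ, 0 ≤ 1 - r * (if X ⊆ A then (1:ℝ) else 0) ∧
      1 - r * (if X ⊆ A then (1:ℝ) else 0) ≤ 1 := by
    intro X A; split_ifs <;> constructor <;> linarith
  induction F using Finset.induction_on with
  | empty => simp [ex_const]
  | insert X F hX ih =>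
    have hXV : X ⊆ V := hF X (Finset.mem_insert_self _ _)
    have hFV : ∀ Y ∈ F, Y ⊆ V := fun Y hY => hF Y (Finset.mem_insert_of_mem hY)
    specialize ih hFV
    set G : Finset τ → ℝ := fun A => ∏ X ∈ F, (1 - r * (if X ⊆ A then 1 else 0)) with hG
    set F1 := F.filter (fun Y => Disjoint X Y) with hF1
    set F2 := F.filter (fun Y => ¬ Disjoint X Y) with hF2
    set G1 : Finset τ → ℝ := fun A => ∏ X ∈ F1, (1 - r * (if X ⊆ A then 1 else 0)) with hG1
    have hG10 : ∀ A, 0 ≤ G1 A := fun A => Finset.prod_nonneg fun Y _ => (hfac Y A).1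
    have hG0 : ∀ A, 0 ≤ G A := fun A => Finset.prod_nonneg fun Y _ => (hfac Y A).1
    have hsplit : ∀ A, G A = G1 A * ∏ Y ∈ F2, (1 - r * (if Y ⊆ A then 1 else 0)) := fun A =>
      (Finset.prod_filter_mul_prod_filter_not F _ _).symm
    have hGG1 : ∀ A, G A ≤ G1 A := fun A => by
      rw [hsplit]
      exact mul_le_of_le_one_right (hG10 A)
        (Finset.prod_le_one (fun Y _ => (hfac Y A).1) (fun Y _ => (hfac Y A).2))
    have hGlow : ∀ A, G1 A - r * ∑ Y ∈ F2, (if Y ⊆ A then G1 A else 0) ≤ G A := fun A => by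
      have := one_sub_sum_le_prod F2
        (fun Y => r * (if Y ⊆ A then (1:ℝ) else 0))
        (fun Y _ => by have := hfac Y A; linarith) (fun Y _ => by have := hfac Y A; linarith)
      rw [hsplit]
      refine le_trans (le_of_eq ?_) (mul_le_mul_of_nonneg_left this (hG10 A))
      rw [mul_sub, mul_one, Finset.mul_sum, Finset.mul_sum]
      congr 1
      refine Finset.sum_congr rfl fun Y _ => ?_
      split_ifs <;> ring
    have hanti : ∀ A B, G1 (A ∪ B) ≤ G1 A := fun A B => by
      refine Finset.prod_le_prod (fun Y _ => (hfac Y _).1) fun Y _ => ?_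
      have : (if Y ⊆ A then (1:ℝ) else 0) ≤ (if Y ⊆ A ∪ B then (1:ℝ) else 0) := by
        by_cases h : Y ⊆ A
        · rw [if_pos h, if_pos (h.trans Finset.subset_union_left)]
        · rw [if_neg h]; split_ifs <;> norm_num
      nlinarith
    have hindep : ∀ A, G1 (A ∪ X) = G1 A := fun A => by
      refine Finset.prod_congr rfl fun Y hY => ?_
      have hd : Disjoint X Y := (Finset.mem_filter.1 hY).2
      have : Y ⊆ A ∪ X ↔ Y ⊆ A :=
        ⟨fun h => hd.symm.left_le_of_le_sup_right h, fun h => h.trans Finset.subset_union_left⟩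
      simp only [this]
    set E1 := subsetExpOn V q G1 with hE1
    have hE10 : 0 ≤ E1 := ex_nonneg V h0 h1 fun A _ => hG10 A
    have k1 : subsetExpOn V q (fun A => if X ⊆ A then G1 A else 0) = q ^ X.card * E1 := by
      rw [ex_subset V q X hXV]
      simp only [hindep]
      rfl
    have k2 : ∀ Y ∈ F2, subsetExpOn V q (fun A => if X ∪ Y ⊆ A then G1 A else 0)
        ≤ q ^ (X ∪ Y).card * E1 := fun Y hY => by
      rw [ex_subset V q _ (Finset.union_subset hXV (hFV Y (Finset.mem_filter.1 hY).1))]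
      exact mul_le_mul_of_nonneg_left (ex_mono V h0 h1 fun A _ => hanti A _) (by positivity)
    set x := q ^ X.card - r * ∑ Y ∈ F2, q ^ (X ∪ Y).card with hx
    have k3 : x * E1 ≤ subsetExpOn V q (fun A => if X ⊆ A then G A else 0) := by
      have m : subsetExpOn V q (fun A => (if X ⊆ A then G1 A else 0)
          - r * ∑ Y ∈ F2, (if X ∪ Y ⊆ A then G1 A else 0))
          ≤ subsetExpOn V q (fun A => if X ⊆ A then G A else 0) := by
        refine ex_mono V h0 h1 fun A _ => ?_
        by_cases h : X ⊆ A
        · simp only [Finset.union_subset_iff, h, true_and, if_true]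
          exact hGlow A
        · simp [Finset.union_subset_iff, h]
      rw [ex_sub, ex_mul, ex_sum, k1] at m
      have : ∑ Y ∈ F2, subsetExpOn V q (fun A => if X ∪ Y ⊆ A then G1 A else 0)
          ≤ (∑ Y ∈ F2, q ^ (X ∪ Y).card) * E1 := by
        rw [Finset.sum_mul]; exact Finset.sum_le_sum k2
      have := mul_le_mul_of_nonneg_left this hr0
      rw [hx, sub_mul]; nlinarith
    have k4 : subsetExpOn V q (fun A => ∏ X ∈ insert X F, (1 - r * (if X ⊆ A then 1 else 0)))
        = subsetExpOn V q G - r * subsetExpOn V q (fun A => if X ⊆ A then G A else 0) := by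
      rw [← ex_mul, ← ex_sub]
      refine ex_congr V fun A _ => ?_
      rw [Finset.prod_insert hX]
      simp only [hG]
      split_ifs <;> ring
    have hEG0 : 0 ≤ subsetExpOn V q G := ex_nonneg V h0 h1 fun A _ => hG0 A
    have hEGE1 : subsetExpOn V q G ≤ E1 := ex_mono V h0 h1 fun A _ => hGG1 A
    have k5 : subsetExpOn V q G - r * subsetExpOn V q (fun A => if X ⊆ A then G A else 0)
        ≤ subsetExpOn V q G * Real.exp (- (r * x)) := by
      rcases le_total 0 x with hx0 | hx0
      · have a1 : x * subsetExpOn V q G ≤ x * E1 := mul_le_mul_of_nonneg_left hEGE1 hx0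
        have a2 := mul_le_mul_of_nonneg_left (a1.trans k3) hr0
        have a3 := mul_le_mul_of_nonneg_left (Real.add_one_le_exp (-(r * x))) hEG0
        nlinarith
      · have a1 : 0 ≤ subsetExpOn V q (fun A => if X ⊆ A then G A else 0) :=
          ex_nonneg V h0 h1 fun A _ => by split_ifs; exacts [hG0 A, le_rfl]
        have a2 : 1 ≤ Real.exp (-(r * x)) := Real.one_le_exp (by nlinarith)
        nlinarith [mul_nonneg hr0 a1]
    rw [k4]
    refine k5.trans ((mul_le_mul_of_nonneg_right ih (Real.exp_pos _).le).trans ?_)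
    rw [← Real.exp_add, Real.exp_le_exp, Finset.sum_insert hX, Finset.sum_insert hX,
      Finset.sum_insert hX]
    have k6 : ∑ Y ∈ F2, q ^ (X ∪ Y).card
        = ∑ Y ∈ F, if Disjoint X Y then 0 else q ^ (X ∪ Y).card := by
      rw [hF2, Finset.sum_filter]
      refine Finset.sum_congr rfl fun Y _ => ?_
      split_ifs <;> simp_all
    have k7 : ∑ Z ∈ F, (∑ Y ∈ F, if Disjoint Z Y then 0 else q ^ (Z ∪ Y).card) ≤
        ∑ Z ∈ F, (∑ Y ∈ insert X F, if Disjoint Z Y then 0 else q ^ (Z ∪ Y).card) := by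
      refine Finset.sum_le_sum fun Z _ => ?_
      rw [Finset.sum_insert hX]
      have : (0:ℝ) ≤ if Disjoint Z X then 0 else q ^ (Z ∪ X).card := by split_ifs <;> positivity
      linarith
    have k8 : (0:ℝ) ≤ if Disjoint X X then 0 else q ^ (X ∪ X).card := by split_ifs <;> positivity
    rw [hx, k6]
    have := mul_le_mul_of_nonneg_left k7 (sq_nonneg r)
    have := mul_nonneg (sq_nonneg r) k8
    nlinarith

lemma janson' {τ : Type*} (V : Finset τ) {q : ℝ} (h0 : 0 ≤ q) (h1 : q ≤ 1)
    (F : Finset (Finset τ)) (hF : ∀ X ∈ F, X ⊆ V) (hne : ∀ X ∈ F, X.Nonempty) (m D : ℝ)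
    (hm : 0 ≤ m) (hmu : m ≤ ∑ X ∈ F, q ^ X.card) (hD : 0 < D)
    (hDD : ∑ X ∈ F, (∑ Y ∈ F, if Disjoint X Y then 0 else q ^ (X ∪ Y).card) ≤ D) :
    subsetExpOn V q (fun A => if ∀ X ∈ F, ¬ X ⊆ A then 1 else 0) ≤
      Real.exp (- (m ^ 2 / (4 * D))) := by
  have hdiag : ∑ X ∈ F, q ^ X.card ≤ D := by
    refine le_trans (Finset.sum_le_sum fun X hX => ?_) hDD
    refine le_trans (le_of_eq ?_) (Finset.single_le_sum (f := fun Y =>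
      if Disjoint X Y then (0:ℝ) else q ^ (X ∪ Y).card) (fun Y _ => ?_) hX)
    · have : ¬ Disjoint X X := by
        rw [disjoint_self]; exact (hne X hX).ne_empty
      rw [if_neg this, Finset.union_self]
    · show (0:ℝ) ≤ if Disjoint X Y then (0:ℝ) else q ^ (X ∪ Y).card
      split_ifs <;> positivity
  have hr0 : 0 ≤ m / (2 * D) := by positivity
  have hr1 : m / (2 * D) ≤ 1 := by rw [div_le_one (by positivity)]; linarith
  refine le_trans (ex_mono V h0 h1 fun A _ => ?_)
    ((janson V h0 h1 hr0 hr1 F hF).trans (Real.exp_le_exp.2 ?_))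
  · split_ifs with h
    · rw [Finset.prod_eq_one]
      intro X hX
      rw [if_neg (h X hX)]; ring
    · refine Finset.prod_nonneg fun X _ => ?_
      split_ifs <;> linarith
  · have e1 := mul_le_mul_of_nonneg_left hmu hr0
    have e2 := mul_le_mul_of_nonneg_left hDD (sq_nonneg (m / (2 * D)))
    have e3 : -(m ^ 2 / (4 * D)) = - (m / (2 * D)) * m + (m / (2 * D)) ^ 2 * D := by
      field_simp; ring
    rw [e3]; linarith

noncomputable def hcPsi {τ : Type*} (Ind : Finset τ → Prop) (l : ℝ) (S B : Finset τ) : ℝ :=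
  ∑ R ∈ B.powerset, if Ind (S ∪ R) then l ^ R.card else 0

lemma hcPsi_insert {τ : Type*} (Ind : Finset τ → Prop) (l : ℝ) (S B : Finset τ) (v : τ)
    (hv : v ∉ B) : hcPsi Ind l S (insert v B) = hcPsi Ind l S B + l * hcPsi Ind l (insert v S) B := by
  unfold hcPsi
  rw [Finset.sum_powerset_insert hv, Finset.mul_sum]
  congr 1
  refine Finset.sum_congr rfl fun R hR => ?_
  have : v ∉ R := fun h => hv (Finset.mem_powerset.1 hR h)
  rw [Finset.card_insert_of_notMem this, Finset.union_insert, Finset.insert_union, pow_succ]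
  split_ifs <;> ring

lemma hcPsi_nonneg {τ : Type*} (Ind : Finset τ → Prop) {l : ℝ} (hl : 0 ≤ l) (S B : Finset τ) :
    0 ≤ hcPsi Ind l S B := Finset.sum_nonneg fun R _ => by split_ifs <;> positivity

lemma hcPsi_one {τ : Type*} (Ind : Finset τ → Prop) {l : ℝ} (hl : 0 ≤ l) (S B : Finset τ)
    (h : Ind S) : 1 ≤ hcPsi Ind l S B := by
  unfold hcPsi
  refine le_trans (le_of_eq ?_) (Finset.single_le_sum (f := fun R =>
      if Ind (S ∪ R) then l ^ R.card else 0) (fun R _ => ?_) (Finset.empty_mem_powerset B))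
  · simp [h]
  · show 0 ≤ if Ind (S ∪ R) then l ^ R.card else 0
    split_ifs <;> positivity

lemma hcontainer {τ : Type*} (Ind : Finset τ → Prop) (hI : ∀ A B, A ⊆ B → Ind B → Ind A)
    {l d : ℝ} (hl : 0 < l) (hd0 : 0 < d) (hd1 : d < 1) :
    ∀ m : ℕ, ∀ C S : Finset τ, C.card = m → ∃ f : Finset τ → Finset τ, ∀ W ⊆ C, Ind (S ∪ W) →
      ∃ T ⊆ W, W ⊆ T ∪ f T ∧ f T ⊆ C ∧
        (1 + (1 - d) * l) ^ (f T).card ≤ hcPsi Ind l (S ∪ T) (f T) ∧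
        ∀ B ⊆ C, 1 ≤ (1 - d) ^ T.card * (hcPsi Ind l S B * (1 + (1 - d) * l) ^ (C \ B).card) := by
  set a := 1 + (1 - d) * l with ha
  have ha1 : 1 ≤ a := by
    have : 0 < (1 - d) * l := mul_pos (by linarith) hl
    linarith
  have hd' : 0 < 1 - d := by linarith
  intro m
  induction m with
  | zero =>
    intro C S hC
    rw [Finset.card_eq_zero] at hC
    subst hC
    refine ⟨fun _ => ∅, fun W hW hind => ⟨∅, by simp, by simpa using hW, by simp, ?_, ?_⟩⟩
    · have : Ind S := hI _ _ Finset.subset_union_left hind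
      simpa using hcPsi_one Ind hl.le S ∅ this
    · intro B hB
      have : Ind S := hI _ _ Finset.subset_union_left hind
      have h1 := hcPsi_one Ind hl.le S B this
      simpa using h1
  | succ m ih =>
    intro C S hC
    by_cases hterm : ∀ B ⊆ C, a ^ C.card ≤ hcPsi Ind l S B * a ^ (C \ B).card
    · refine ⟨fun _ => C, fun W hW hind => ⟨∅, by simp, by simpa using hW, by simp, ?_, ?_⟩⟩
      · simpa using hterm C (Finset.Subset.refl _)
      · intro B hB
        have : Ind S := hI _ _ Finset.subset_union_left hind
        have h1 := hcPsi_one Ind hl.le S B this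
        have h2 : 1 ≤ a ^ (C \ B).card := one_le_pow₀ ha1
        simp only [Finset.card_empty, pow_zero, one_mul]
        nlinarith
    · push Not at hterm
      obtain ⟨B₀, hB₀, hlt⟩ := hterm
      obtain ⟨B, hB, hmin⟩ := Finset.exists_min_image C.powerset
        (fun B => hcPsi Ind l S B * a ^ (C \ B).card) ⟨C, Finset.mem_powerset_self C⟩
      rw [Finset.mem_powerset] at hB
      by_cases hS : Ind S
      swap
      · exact ⟨fun _ => ∅, fun W hW hind => absurd (hI _ _ Finset.subset_union_left hind) hS⟩
      have hBne : B.Nonempty := by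
        rw [Finset.nonempty_iff_ne_empty]
        rintro rfl
        have := hmin B₀ (Finset.mem_powerset.2 hB₀)
        have h1 := hcPsi_one Ind hl.le S ∅ hS
        have h2 : 0 < a ^ C.card := by positivity
        simp only [Finset.sdiff_empty] at this
        nlinarith
      obtain ⟨v, hvB⟩ := hBne
      have hvC : v ∈ C := hB hvB
      have hcard : (C.erase v).card = m := by rw [Finset.card_erase_of_mem hvC, hC]; rfl
      obtain ⟨f0, hf0⟩ := ih (C.erase v) S hcard
      obtain ⟨f1, hf1⟩ := ih (C.erase v) (insert v S) hcard
      have hBe : B.erase v ⊆ C.erase v := Finset.erase_subset_erase _ hB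
      have hsd : C.erase v \ B.erase v = C \ B := by
        ext x; simp only [Finset.mem_sdiff, Finset.mem_erase]
        constructor
        · rintro ⟨⟨h1, h2⟩, h3⟩; exact ⟨h2, fun h => h3 ⟨h1, h⟩⟩
        · rintro ⟨h1, h2⟩
          have : x ≠ v := fun h => h2 (h ▸ hvB)
          exact ⟨⟨this, h1⟩, fun h => h2 h.2⟩
      have hrec := hcPsi_insert Ind l S (B.erase v) v (by simp)
      rw [Finset.insert_erase hvB] at hrec
      set P0 := hcPsi Ind l S (B.erase v) with hP0
      set P1 := hcPsi Ind l (insert v S) (B.erase v) with hP1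
      have hP0n : 0 ≤ P0 := hcPsi_nonneg Ind hl.le _ _
      have hP1n : 0 ≤ P1 := hcPsi_nonneg Ind hl.le _ _
      have hpos : 0 < a ^ (C \ B).card := by positivity
      have hP0B : P0 ≤ hcPsi Ind l S B := by rw [hrec]; nlinarith
      have hP1B : P1 ≤ (1 - d) * hcPsi Ind l S B := by
        have h1 := hmin (B.erase v) (Finset.mem_powerset.2 ((Finset.erase_subset _ _).trans hB))
        have h2 : (C \ B.erase v).card = (C \ B).card + 1 := by
          have : C \ B.erase v = insert v (C \ B) := by
            rw [← hsd]; ext x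
            simp only [Finset.mem_sdiff, Finset.mem_erase, Finset.mem_insert]
            by_cases hx : x = v
            · simp [hx, hvC]
            · simp [hx]
          rw [this, Finset.card_insert_of_notMem (by simp [hvB])]
        simp only [h2, pow_succ] at h1
        have h3 : hcPsi Ind l S B ≤ P0 * a := by
          by_contra hcon
          push Not at hcon
          nlinarith
        have h4 : l * P1 ≤ l * ((1 - d) * P0) := by rw [hrec] at h3; rw [ha] at h3; linarith
        have h5 := le_of_mul_le_mul_left h4 hl
        nlinarith
      refine ⟨fun T => if v ∈ T then f1 (T.erase v) else f0 T, fun W hW hind => ?_⟩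
      by_cases hvW : v ∈ W
      · have hW' : W.erase v ⊆ C.erase v := Finset.erase_subset_erase _ hW
        have e1 : insert v S ∪ W.erase v = S ∪ W := by
          rw [Finset.insert_union, ← Finset.union_insert, Finset.insert_erase hvW]
        obtain ⟨T, hTW, hcov, hfC, hPsi, hbd⟩ := hf1 (W.erase v) hW' (by rw [e1]; exact hind)
        have hvT : v ∉ T := fun h => by simpa using hTW h
        refine ⟨insert v T, ?_, ?_⟩
        · rw [Finset.insert_subset_iff]
          exact ⟨hvW, hTW.trans (Finset.erase_subset _ _)⟩
        · simp only [Finset.mem_insert_self, if_true, Finset.erase_insert hvT]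
          refine ⟨?_, hfC.trans (Finset.erase_subset _ _), ?_, ?_⟩
          · rw [Finset.insert_union, ← Finset.insert_erase hvW]
            exact Finset.insert_subset_insert _ hcov
          · rw [Finset.union_insert, ← Finset.insert_union]; exact hPsi
          · intro B' hB'
            have h1 := hbd (B.erase v) hBe
            rw [hsd, ← hP1] at h1
            have h2 := hmin B' (Finset.mem_powerset.2 hB')
            rw [Finset.card_insert_of_notMem hvT, pow_succ]
            have h3 : P1 * a ^ (C \ B).card ≤ (1 - d) * (hcPsi Ind l S B' * a ^ (C \ B').card) :=
              calc P1 * a ^ (C \ B).card ≤ ((1 - d) * hcPsi Ind l S B) * a ^ (C \ B).card :=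
                    mul_le_mul_of_nonneg_right hP1B hpos.le
                _ = (1 - d) * (hcPsi Ind l S B * a ^ (C \ B).card) := by ring
                _ ≤ _ := mul_le_mul_of_nonneg_left h2 hd'.le
            have h4 := mul_le_mul_of_nonneg_left h3 (pow_nonneg hd'.le T.card)
            linarith
      · have hW' : W ⊆ C.erase v := fun x hx =>
          Finset.mem_erase.2 ⟨fun h => hvW (h ▸ hx), hW hx⟩
        obtain ⟨T, hTW, hcov, hfC, hPsi, hbd⟩ := hf0 W hW' hind
        have hvT : v ∉ T := fun h => hvW (hTW h)
        refine ⟨T, hTW, ?_⟩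
        simp only [hvT, if_false]
        refine ⟨hcov, hfC.trans (Finset.erase_subset _ _), hPsi, fun B' hB' => ?_⟩
        have h1 := hbd (B.erase v) hBe
        rw [hsd, ← hP0] at h1
        have h2 := hmin B' (Finset.mem_powerset.2 hB')
        have h3 : P0 * a ^ (C \ B).card ≤ hcPsi Ind l S B' * a ^ (C \ B').card :=
          (mul_le_mul_of_nonneg_right hP0B hpos.le).trans h2
        have h4 := mul_le_mul_of_nonneg_left h3 (pow_nonneg hd'.le T.card)
        linarith

/-- container lemma in probabilistic form -/
lemma hcontainer' {τ : Type*} (Ind : Finset τ → Prop) (hI : ∀ A B, A ⊆ B → Ind B → Ind A)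
    {p d : ℝ} (hp0 : 0 < p) (hp1 : p ≤ 1 / 2) (hd0 : 0 < d) (hd1 : d < 1) (V : Finset τ) :
    ∃ f : Finset τ → Finset τ, ∀ W ⊆ V, Ind W →
      ∃ T ⊆ W, W ⊆ T ∪ f T ∧ f T ⊆ V ∧
        (1 - d * p) ^ (f T).card ≤ subsetExpOn (f T) p (fun A => if Ind A then 1 else 0) ∧
        d * T.card ≤ 2 * p * V.card := by
  have h1p : 0 < 1 - p := by linarith
  obtain ⟨f, hf⟩ := hcontainer Ind hI (l := p / (1 - p)) (by positivity) hd0 hd1 V.card V ∅ rfl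
  refine ⟨f, fun W hW hind => ?_⟩
  obtain ⟨T, hT, h1, h2, h3, h4⟩ := hf W hW (by simpa using hind)
  refine ⟨T, hT, h1, h2, ?_, ?_⟩
  · have e1 : (1 - d * p) ^ (f T).card
        = (1 - p) ^ (f T).card * (1 + (1 - d) * (p / (1 - p))) ^ (f T).card := by
      rw [← mul_pow]; congr 1; field_simp; ring
    rw [e1]
    refine (mul_le_mul_of_nonneg_left h3 (by positivity)).trans ?_
    unfold hcPsi subsetExpOn
    rw [Finset.mul_sum]
    refine Finset.sum_le_sum fun R hR => ?_
    have hc := Finset.card_le_card (Finset.mem_powerset.1 hR)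
    have e2 : (1 - p) ^ (f T).card * (p / (1 - p)) ^ R.card
        = p ^ R.card * (1 - p) ^ ((f T).card - R.card) := by
      obtain ⟨j, hj⟩ := Nat.exists_eq_add_of_le hc
      rw [hj, Nat.add_sub_cancel_left, pow_add, div_pow]
      field_simp
    beta_reduce
    by_cases h : Ind (∅ ∪ T ∪ R)
    · rw [if_pos h, if_pos (hI _ _ Finset.subset_union_right h), e2, mul_one]
    · rw [if_neg h, mul_zero]
      split_ifs <;> positivity
  · have h5 := h4 ∅ (Finset.empty_subset _)
    have e : hcPsi Ind (p / (1 - p)) ∅ ∅ = 1 := by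
      have : Ind ∅ := hI _ _ (Finset.empty_subset _) hind
      simp [hcPsi, this]
    rw [e, one_mul, Finset.sdiff_empty] at h5
    have h6 : (1 - d) ^ T.card ≤ Real.exp (- (d * T.card)) := by
      rw [show -(d * T.card) = T.card * (-d) by ring, Real.exp_nat_mul]
      exact pow_le_pow_left₀ (by linarith) (by linarith [Real.add_one_le_exp (-d)]) _
    have h7 : (1 + (1 - d) * (p / (1 - p))) ^ V.card ≤ Real.exp (2 * p * V.card) := by
      rw [show 2 * p * V.card = V.card * (2 * p) by ring, Real.exp_nat_mul]
      have : p / (1 - p) ≤ 2 * p := by rw [div_le_iff₀ h1p]; nlinarith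
      have h0 : 0 ≤ p / (1 - p) := by positivity
      have : (1 - d) * (p / (1 - p)) ≤ 2 * p := by nlinarith
      have h8 : 0 ≤ (1 - d) * (p / (1 - p)) := mul_nonneg (by linarith) h0
      exact pow_le_pow_left₀ (by linarith) (by linarith [Real.add_one_le_exp (2 * p)]) _
    have h8 := h5.trans (mul_le_mul h6 h7 (by
      have h0 : 0 ≤ p / (1 - p) := by positivity
      have h8 : 0 ≤ (1 - d) * (p / (1 - p)) := mul_nonneg (by linarith) h0
      positivity) (Real.exp_pos _).le)
    rw [← Real.exp_add, Real.one_le_exp_iff] at h8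
    linarith

lemma second_moment {τ : Type*} (V : Finset τ) (E : Finset (Finset τ)) (k : ℕ) (K p : ℝ)
    (hk : 2 ≤ k) (hu : ∀ X ∈ E, X ⊆ V ∧ X.card = k) (hp0 : 0 < p) (hp1 : p ≤ 1)
    (hb : HyperBounded V E k K p) :
    ∑ X ∈ E, (∑ Y ∈ E, if Disjoint X Y then 0 else p ^ (X ∪ Y).card) ≤
      K * p ^ (2 * k - 1) * (E.card : ℝ) ^ 2 / V.card := by
  have h1 := hb (k - 1) (by omega) le_rfl p le_rfl hp1
  set Z : τ → Finset τ → Finset τ → Finset τ → ℝ := fun v X Y A =>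
      if (X ∪ Y).erase v ⊆ A then (if v ∈ X ∧ v ∈ Y then (1:ℝ) else 0) else 0 with hZ
  have h2 : subsetExpOn V p (fun A => ∑ v ∈ V, ∑ X ∈ E, ∑ Y ∈ E, Z v X Y A) ≤
      subsetExpOn V p (fun A => ∑ v ∈ V, (hyperDeg E (k - 1) v A : ℝ) ^ 2) := by
    refine ex_mono V hp0.le hp1 fun A hA => Finset.sum_le_sum fun v hv => ?_
    have e2 : (hyperDeg E (k - 1) v A : ℝ)
        = ∑ X ∈ E, if v ∈ X ∧ k - 1 ≤ (X ∩ (A.erase v)).card then (1:ℝ) else 0 := by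
      unfold hyperDeg
      rw [Finset.card_filter]
      push_cast
      rfl
    rw [e2, sq, Finset.sum_mul_sum]
    refine Finset.sum_le_sum fun X hX => Finset.sum_le_sum fun Y hY => ?_
    have key : ∀ X ∈ E, v ∈ X → X.erase v ⊆ A → k - 1 ≤ (X ∩ (A.erase v)).card := by
      intro X hX hvX hs
      rw [← (hu X hX).2, ← Finset.card_erase_of_mem hvX]
      refine Finset.card_le_card fun x hx => ?_
      have hx' := Finset.mem_erase.1 hx
      exact Finset.mem_inter.2 ⟨hx'.2, Finset.mem_erase.2 ⟨hx'.1, hs hx⟩⟩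
    simp only [hZ]
    by_cases c1 : (X ∪ Y).erase v ⊆ A
    · by_cases c2 : v ∈ X ∧ v ∈ Y
      · have a1 : X.erase v ⊆ A :=
          (Finset.erase_subset_erase v Finset.subset_union_left).trans c1
        have a2 : Y.erase v ⊆ A :=
          (Finset.erase_subset_erase v Finset.subset_union_right).trans c1
        rw [if_pos c1, if_pos c2, if_pos ⟨c2.1, key X hX c2.1 a1⟩,
          if_pos ⟨c2.2, key Y hY c2.2 a2⟩]
        norm_num
      · rw [if_pos c1, if_neg c2]
        split_ifs <;> norm_num
    · rw [if_neg c1]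
      split_ifs <;> norm_num
  have h3 : subsetExpOn V p (fun A => ∑ v ∈ V, ∑ X ∈ E, ∑ Y ∈ E, Z v X Y A)
      = ∑ X ∈ E, ∑ Y ∈ E, ∑ v ∈ V, subsetExpOn V p (Z v X Y) := by
    simp only [ex_sum]
    rw [Finset.sum_comm]
    refine Finset.sum_congr rfl fun X _ => ?_
    rw [Finset.sum_comm]
  have h4 : ∑ X ∈ E, (∑ Y ∈ E, if Disjoint X Y then 0 else p ^ (X ∪ Y).card) ≤
      p * ∑ X ∈ E, ∑ Y ∈ E, ∑ v ∈ V, subsetExpOn V p (Z v X Y) := by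
    rw [Finset.mul_sum]
    refine Finset.sum_le_sum fun X hX => ?_
    rw [Finset.mul_sum]
    refine Finset.sum_le_sum fun Y hY => ?_
    have hnn : ∀ v ∈ V, 0 ≤ subsetExpOn V p (Z v X Y) := fun v _ =>
      ex_nonneg V hp0.le hp1 fun A _ => by simp only [hZ]; split_ifs <;> norm_num
    split_ifs with hd
    · exact mul_nonneg hp0.le (Finset.sum_nonneg hnn)
    · obtain ⟨v, hvX, hvY⟩ := Finset.not_disjoint_iff.1 hd
      have hvV : v ∈ V := (hu X hX).1 hvX
      refine le_trans (le_of_eq ?_)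
        (mul_le_mul_of_nonneg_left (Finset.single_le_sum hnn hvV) hp0.le)
      have hsub : (X ∪ Y).erase v ⊆ V :=
        (Finset.erase_subset _ _).trans (Finset.union_subset (hu X hX).1 (hu Y hY).1)
      have : subsetExpOn V p (Z v X Y) = p ^ ((X ∪ Y).erase v).card * 1 := by
        rw [← ex_const V p 1]
        simp only [hZ]
        rw [ex_subset V p _ hsub]
        simp only [hvX, hvY, and_self, if_true]
      have hm : v ∈ X ∪ Y := Finset.mem_union_left _ hvX
      rw [this, mul_one, ← pow_succ', Finset.card_erase_add_one hm]
  rw [← h3] at h4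
  refine h4.trans ((mul_le_mul_of_nonneg_left (h2.trans h1) hp0.le).trans (le_of_eq ?_))
  have : 2 * k - 1 = 2 * (k - 1) + 1 := by omega
  rw [this, pow_succ]
  ring

lemma small_containers {τ : Type*} (V : Finset τ) (E : Finset (Finset τ)) (k : ℕ) (K p F g : ℝ)
    (hk : 1 ≤ k) (hu : ∀ X ∈ E, X ⊆ V ∧ X.card = k) (hp0 : 0 < p) (hp1 : p ≤ 1 / 2)
    (hK : 1 ≤ K) (hF0 : 0 < F) (hF1 : F < 1) (hV : 0 < V.card) (hE : 0 < E.card)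
    (hD : ∑ X ∈ E, (∑ Y ∈ E, if Disjoint X Y then 0 else p ^ (X ∪ Y).card) ≤
      K * p ^ (2 * k - 1) * (E.card : ℝ) ^ 2 / V.card)
    (hdense : ∀ U ⊆ V, g * (V.card : ℝ) ≤ U.card →
      F * (E.card : ℝ) ≤ (((E.filter (fun X => X ⊆ U)).card : ℕ) : ℝ)) :
    ∃ f : Finset τ → Finset τ, ∀ W ⊆ V, (∀ X ∈ E, ¬ X ⊆ W) →
      ∃ T ⊆ W, W ⊆ T ∪ f T ∧ f T ⊆ V ∧ ((f T).card : ℝ) ≤ g * V.card ∧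
        F ^ 2 / (16 * K) * T.card ≤ 2 * p * V.card := by
  set d := F ^ 2 / (16 * K) with hd
  have hK0 : 0 < K := by linarith
  have hN : (0:ℝ) < V.card := by exact_mod_cast hV
  have he : (0:ℝ) < E.card := by exact_mod_cast hE
  have hd0 : 0 < d := by positivity
  have hd1 : d < 1 := by rw [hd, div_lt_one (by positivity)]; nlinarith
  obtain ⟨f, hf⟩ := hcontainer' (fun A : Finset τ => ∀ X ∈ E, ¬ X ⊆ A)
    (fun A B hAB h X hX hs => h X hX (hs.trans hAB)) hp0 hp1 hd0 hd1 V
  refine ⟨f, fun W hW hind => ?_⟩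
  obtain ⟨T, hT, h1, h2, h3, h4⟩ := hf W hW hind
  refine ⟨T, hT, h1, h2, ?_, h4⟩
  by_contra hcon
  push Not at hcon
  have h5 := hdense (f T) h2 hcon.le
  set F' := E.filter (fun X => X ⊆ f T) with hF'
  have hF'E : F' ⊆ E := Finset.filter_subset _ _
  have hj := janson' (f T) hp0.le (by linarith) F' (fun X hX => (Finset.mem_filter.1 hX).2)
    (fun X hX => Finset.card_pos.1 (by rw [(hu X (hF'E hX)).2]; omega))
    (F * E.card * p ^ k) (K * p ^ (2 * k - 1) * (E.card : ℝ) ^ 2 / V.card)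
    (by positivity)
    (by
      rw [Finset.sum_congr rfl (fun X hX => by rw [(hu X (hF'E hX)).2]), Finset.sum_const,
        nsmul_eq_mul]
      exact mul_le_mul_of_nonneg_right h5 (by positivity))
    (by positivity)
    (by
      refine le_trans ?_ hD
      have nn : ∀ X Y : Finset τ, (0:ℝ) ≤ if Disjoint X Y then 0 else p ^ (X ∪ Y).card :=
        fun X Y => by split_ifs <;> positivity
      refine (Finset.sum_le_sum fun X _ => Finset.sum_le_sum_of_subset_of_nonneg hF'E
        fun Y _ _ => nn X Y).trans ?_
      exact Finset.sum_le_sum_of_subset_of_nonneg hF'E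
        fun X _ _ => Finset.sum_nonneg fun Y _ => nn X Y)
  have h6 : subsetExpOn (f T) p (fun A => if ∀ X ∈ E, ¬ X ⊆ A then 1 else 0) ≤
      subsetExpOn (f T) p (fun A => if ∀ X ∈ F', ¬ X ⊆ A then 1 else 0) := by
    refine ex_mono _ hp0.le (by linarith) fun A _ => ?_
    by_cases h : ∀ X ∈ E, ¬ X ⊆ A
    · rw [if_pos h, if_pos fun X hX => h X (hF'E hX)]
    · rw [if_neg h]; split_ifs <;> norm_num
  have h7 : (F * E.card * p ^ k) ^ 2 / (4 * (K * p ^ (2 * k - 1) * (E.card : ℝ) ^ 2 / V.card))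
      = 4 * d * p * V.card := by
    have : (p ^ k) ^ 2 = p * p ^ (2 * k - 1) := by
      rw [← pow_mul, ← pow_succ']; congr 1; omega
    rw [mul_pow, this, hd]
    field_simp
    norm_num
  have h8 : Real.exp (-(2 * d * p * V.card)) ≤ (1 - d * p) ^ (f T).card := by
    have hc : (f T).card ≤ V.card := Finset.card_le_card h2
    have hdp : 0 < d * p := by positivity
    have hdp1 : d * p ≤ 1 / 2 := by nlinarith
    refine le_trans ?_ (pow_le_pow_of_le_one (by linarith) (by linarith) hc)
    rw [show -(2 * d * p * V.card) = V.card * (-(2 * (d * p))) by ring, Real.exp_nat_mul]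
    refine pow_le_pow_left₀ (Real.exp_pos _).le ?_ _
    rw [Real.exp_neg, inv_le_comm₀ (Real.exp_pos _) (by linarith)]
    refine le_trans ?_ (Real.add_one_le_exp _)
    rw [inv_le_iff_one_le_mul₀ (by linarith)]
    nlinarith
  have h3' : (1 - d * p) ^ (f T).card ≤
      subsetExpOn (f T) p (fun A => if ∀ X ∈ E, ¬ X ⊆ A then 1 else 0) := by
    convert h3
  have h9 := h8.trans (h3'.trans (h6.trans hj))
  rw [h7, Real.exp_le_exp] at h9
  have : 0 < d * p * V.card := by positivity
  linarith

lemma ex_exp_bound {τ : Type*} (V D : Finset τ) (hD : D ⊆ V) {q t β : ℝ} (hq0 : 0 ≤ q) (hq1 : q ≤ 1)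
    (ht0 : 0 ≤ t) (ht1 : t ≤ 1) (hβ0 : 0 ≤ β) (hβ1 : β ≤ 1) :
    subsetExpOn V q (fun A => Real.exp (t * ((A ∩ D).card - β * A.card))) ≤
      Real.exp (q * (t * D.card - t * β * V.card + t ^ 2 * V.card)) := by
  have e1 : ∀ A : Finset τ, ((A ∩ D).card : ℝ) - β * A.card
      = ∑ v ∈ A, ((if v ∈ D then (1:ℝ) else 0) - β) := fun A => by
    rw [Finset.sum_sub_distrib, Finset.sum_boole, Finset.filter_mem_eq_inter, Finset.sum_const,
      nsmul_eq_mul]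
    ring
  have e2 : ∀ A : Finset τ, Real.exp (t * ((A ∩ D).card - β * A.card))
      = ∏ v ∈ A, Real.exp (t * ((if v ∈ D then (1:ℝ) else 0) - β)) := fun A => by
    rw [e1, Finset.mul_sum, Real.exp_sum]
  simp only [e2]
  rw [ex_prod]
  have e3 : q * (t * D.card - t * β * V.card + t ^ 2 * V.card)
      = ∑ v ∈ V, q * (t * ((if v ∈ D then (1:ℝ) else 0) - β) + t ^ 2) := by
    rw [← Finset.mul_sum, Finset.sum_add_distrib, ← Finset.mul_sum, ← e1,
      Finset.inter_eq_right.2 hD, Finset.sum_const, nsmul_eq_mul]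
    ring
  rw [e3, Real.exp_sum]
  refine Finset.prod_le_prod (fun v _ => ?_) (fun v _ => ?_)
  all_goals
    set x := t * ((if v ∈ D then (1:ℝ) else 0) - β) with hx
    have hx1 : |x| ≤ t := by
      rw [hx, abs_mul, abs_of_nonneg ht0]
      refine mul_le_of_le_one_right ht0 (abs_le.2 ?_)
      split_ifs <;> constructor <;> linarith
  · have : 0 ≤ q * Real.exp x := by positivity
    nlinarith
  · have h1 := (abs_le.1 (Real.abs_exp_sub_one_sub_id_le (hx1.trans ht1))).2
    have h2 : x ^ 2 ≤ t ^ 2 := sq_le_sq' (by linarith [abs_le.1 hx1]) (by linarith [abs_le.1 hx1])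
    have h3 : q * (Real.exp x - 1) ≤ q * (x + t ^ 2) :=
      mul_le_mul_of_nonneg_left (by linarith) hq0
    linarith [Real.add_one_le_exp (q * (x + t ^ 2))]

lemma union_bound {τ : Type*} (V : Finset τ) (E : Finset (Finset τ)) {q t β g L M ε : ℝ}
    (hq0 : 0 < q) (hq1 : q ≤ 1) (hε0 : 0 < ε) (hε1 : ε < 1) (ht : t = ε / 4)
    (hβ : β = g + ε / 2) (hβ0 : 0 ≤ β) (hβ1 : β ≤ 1)
    (hL : L = - Real.log (ε ^ 2 / 192)) (hM : M = q * V.card * ε ^ 2 / 64)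
    (f : Finset τ → Finset τ)
    (hf : ∀ W ⊆ V, (∀ X ∈ E, ¬ X ⊆ W) →
      ∃ T ⊆ W, W ⊆ T ∪ f T ∧ f T ⊆ V ∧ ((f T).card : ℝ) ≤ g * V.card ∧ L * T.card ≤ M) :
    1 - Real.exp (-(ε ^ 2 / 32 * q * V.card)) ≤ subsetProbOn V q (fun A =>
      ∀ W ⊆ A, β * (A.card : ℝ) ≤ (W.card : ℝ) → ∃ X ∈ E, X ⊆ W) := by
  set P : Finset τ → Prop := fun A =>
      ∀ W ⊆ A, β * (A.card : ℝ) ≤ (W.card : ℝ) → ∃ X ∈ E, X ⊆ W with hP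
  have ht0 : 0 ≤ t := by rw [ht]; linarith
  have ht1 : t ≤ 1 := by rw [ht]; linarith
  set TT := V.powerset.filter (fun T => f T ⊆ V ∧ ((f T).card : ℝ) ≤ g * V.card ∧ L * T.card ≤ M)
    with hTT
  set N : ℝ := (V.card : ℝ) with hN
  have hN0 : 0 ≤ N := Nat.cast_nonneg _
  have h1 : 1 - subsetProbOn V q P = subsetExpOn V q (fun A => 1 - if P A then 1 else 0) := by
    rw [ex_sub, ex_const]
    congr 1
    unfold subsetProbOn subsetExpOn
    refine Finset.sum_congr rfl fun A _ => ?_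
    by_cases h : P A
    · simp only [if_pos h, mul_one]
    · simp only [if_neg h, mul_zero]
  have h2 : subsetExpOn V q (fun A => 1 - if P A then 1 else 0) ≤
      subsetExpOn V q (fun A => ∑ T ∈ TT, if T ⊆ A then
        Real.exp (t * ((A ∩ (T ∪ f T)).card - β * A.card)) else 0) := by
    refine ex_mono V hq0.le hq1 fun A hA => ?_
    have nn : ∀ T ∈ TT, (0:ℝ) ≤ if T ⊆ A then
        Real.exp (t * ((A ∩ (T ∪ f T)).card - β * A.card)) else 0 := fun T _ => by
      split_ifs <;> positivity
    by_cases h : P A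
    · rw [if_pos h, sub_self]; exact Finset.sum_nonneg nn
    · rw [if_neg h, sub_zero]
      rw [hP] at h
      push Not at h
      obtain ⟨W, hWA, hWc, hWi⟩ := h
      obtain ⟨T, hT, c1, c2, c3, c4⟩ := hf W (hWA.trans hA) hWi
      have hTA : T ⊆ A := hT.trans hWA
      have hTm : T ∈ TT :=
        Finset.mem_filter.2 ⟨Finset.mem_powerset.2 (hTA.trans hA), c2, c3, c4⟩
      refine le_trans ?_ (Finset.single_le_sum nn hTm)
      rw [if_pos hTA]
      refine Real.one_le_exp (mul_nonneg ht0 ?_)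
      have : W.card ≤ (A ∩ (T ∪ f T)).card :=
        Finset.card_le_card (Finset.subset_inter hWA c1)
      have : (W.card : ℝ) ≤ (A ∩ (T ∪ f T)).card := by exact_mod_cast this
      linarith
  rw [ex_sum] at h2
  set z : ℝ := ε ^ 2 / 192 with hz
  have hz0 : 0 < z := by positivity
  have het : Real.exp t ≤ 3 := by
    have := Real.exp_le_exp.2 ht1
    have := Real.exp_one_lt_d9
    linarith
  have h3 : ∀ T ∈ TT, subsetExpOn V q (fun A => if T ⊆ A then
        Real.exp (t * ((A ∩ (T ∪ f T)).card - β * A.card)) else 0) ≤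
      (q * 3 * z) ^ T.card * 1 ^ (V.card - T.card) * Real.exp (M - q * N * ε ^ 2 / 16) := by
    intro T hT
    obtain ⟨hTV, c2, c3, c4⟩ := Finset.mem_filter.1 hT
    rw [Finset.mem_powerset] at hTV
    rw [ex_subset V q T hTV (fun A => Real.exp (t * ((A ∩ (T ∪ f T)).card - β * A.card)))]
    have a1 : subsetExpOn V q (fun A => Real.exp (t * (((A ∪ T) ∩ (T ∪ f T)).card
        - β * (A ∪ T).card))) ≤ subsetExpOn V q (fun A =>
          Real.exp t ^ T.card * Real.exp (t * ((A ∩ f T).card - β * A.card))) := by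
      refine ex_mono V hq0.le hq1 fun A _ => ?_
      rw [← Real.exp_nat_mul, ← Real.exp_add, Real.exp_le_exp]
      have b1 : ((A ∪ T) ∩ (T ∪ f T)).card ≤ (A ∩ f T).card + T.card := by
        refine le_trans (Finset.card_le_card ?_) (Finset.card_union_le _ _)
        intro x; simp only [Finset.mem_inter, Finset.mem_union]; tauto
      have b2 : A.card ≤ (A ∪ T).card := Finset.card_le_card Finset.subset_union_left
      have b1' : (((A ∪ T) ∩ (T ∪ f T)).card : ℝ) ≤ (A ∩ f T).card + T.card := by
        exact_mod_cast b1
      have b2' : (A.card : ℝ) ≤ (A ∪ T).card := by exact_mod_cast b2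
      have b3 := mul_le_mul_of_nonneg_left b2' hβ0
      have b4 : (((A ∪ T) ∩ (T ∪ f T)).card : ℝ) - β * (A ∪ T).card ≤
        T.card + ((A ∩ f T).card - β * A.card) := by linarith
      have b5 := mul_le_mul_of_nonneg_left b4 ht0
      linarith
    rw [ex_mul] at a1
    have a2 := ex_exp_bound V (f T) c2 hq0.le hq1 ht0 ht1 hβ0 hβ1
    have a3 : q * (t * (f T).card - t * β * V.card + t ^ 2 * V.card) ≤ - (q * N * ε ^ 2 / 16) := by
      have : t * (f T).card ≤ t * (g * N) := mul_le_mul_of_nonneg_left c3 ht0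
      have b : t * (f T).card - t * β * V.card + t ^ 2 * V.card ≤ - (N * ε ^ 2 / 16) := by
        rw [← hN]
        have : t * (g * N) - t * β * N + t ^ 2 * N = - (N * ε ^ 2 / 16) := by
          rw [hβ, ht]; ring
        linarith
      have := mul_le_mul_of_nonneg_left b hq0.le
      linarith
    have a4 := a2.trans (Real.exp_le_exp.2 a3)
    have a5 : 1 ≤ z ^ T.card * Real.exp M := by
      have : z = Real.exp (-L) := by rw [hL, neg_neg, Real.exp_log hz0]
      rw [this, ← Real.exp_nat_mul, ← Real.exp_add]
      exact Real.one_le_exp (by linarith)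
    calc q ^ T.card * _ ≤ q ^ T.card * (Real.exp t ^ T.card *
          Real.exp (-(q * N * ε ^ 2 / 16))) :=
          mul_le_mul_of_nonneg_left (a1.trans (mul_le_mul_of_nonneg_left a4 (by positivity)))
            (by positivity)
      _ ≤ q ^ T.card * (3 ^ T.card * Real.exp (-(q * N * ε ^ 2 / 16))) := by
          gcongr
      _ ≤ q ^ T.card * (3 ^ T.card * Real.exp (-(q * N * ε ^ 2 / 16))) *
            (z ^ T.card * Real.exp M) := le_mul_of_one_le_right (by positivity) a5
      _ = _ := by
          rw [sub_eq_add_neg, Real.exp_add, mul_pow, mul_pow, one_pow]; ring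
  have h4 := h2.trans (Finset.sum_le_sum h3)
  rw [← Finset.sum_mul] at h4
  have h5 : ∑ T ∈ TT, (q * 3 * z) ^ T.card * 1 ^ (V.card - T.card) ≤ Real.exp (N * (q * 3 * z)) := by
    refine (Finset.sum_le_sum_of_subset_of_nonneg (Finset.filter_subset _ _)
      fun T _ _ => by positivity).trans ?_
    rw [Finset.sum_pow_mul_eq_add_pow, hN, Real.exp_nat_mul]
    exact pow_le_pow_left₀ (by positivity) (Real.add_one_le_exp _) _
  have h6 := h4.trans (mul_le_mul_of_nonneg_right h5 (Real.exp_pos _).le)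
  rw [← h1, ← Real.exp_add] at h6
  have h7 : N * (q * 3 * z) + (M - q * N * ε ^ 2 / 16) = -(ε ^ 2 / 32 * q * N) := by
    rw [hM, hz]; ring
  rw [h7] at h6
  linarith

lemma empty_bound {τ : Type*} (V : Finset τ) (E : Finset (Finset τ)) {q β : ℝ}
    (hq0 : 0 ≤ q) (hq1 : q ≤ 1) (hβ1 : 1 < β) :
    1 - Real.exp (-(q * V.card)) ≤ subsetProbOn V q (fun A =>
      ∀ W ⊆ A, β * (A.card : ℝ) ≤ (W.card : ℝ) → ∃ X ∈ E, X ⊆ W) := by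
  set P : Finset τ → Prop := fun A =>
      ∀ W ⊆ A, β * (A.card : ℝ) ≤ (W.card : ℝ) → ∃ X ∈ E, X ⊆ W with hP
  have h1 : 1 - subsetProbOn V q P = subsetExpOn V q (fun A => 1 - if P A then 1 else 0) := by
    rw [ex_sub, ex_const]
    congr 1
    unfold subsetProbOn subsetExpOn
    refine Finset.sum_congr rfl fun A _ => ?_
    by_cases h : P A
    · simp only [if_pos h, mul_one]
    · simp only [if_neg h, mul_zero]
  have h2 : subsetExpOn V q (fun A => 1 - if P A then 1 else 0) ≤
      subsetExpOn V q (fun A => ∏ v ∈ A, (fun _ => (0:ℝ)) v) := by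
    refine ex_mono V hq0 hq1 fun A _ => ?_
    rcases A.eq_empty_or_nonempty with rfl | hA
    · simp only [Finset.prod_empty]
      split_ifs <;> norm_num
    · have hPA : P A := by
        intro W hW hc
        exfalso
        have c1 : (W.card : ℝ) ≤ A.card := by exact_mod_cast Finset.card_le_card hW
        have c2 : (0:ℝ) < A.card := by exact_mod_cast hA.card_pos
        nlinarith
      rw [if_pos hPA, sub_self]
      exact Finset.prod_nonneg fun _ _ => le_rfl
  rw [ex_prod, ← h1, Finset.prod_const] at h2
  have h3 : (1 + q * (0 - 1)) ^ V.card ≤ Real.exp (-(q * V.card)) := by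
    rw [show -(q * V.card) = V.card * (-q) by ring, Real.exp_nat_mul]
    exact pow_le_pow_left₀ (by linarith) (by linarith [Real.add_one_le_exp (-q)]) _
  linarith

lemma moment_one {τ : Type*} [DecidableEq τ] (V : Finset τ) (E : Finset (Finset τ))
    {p F ε g K : ℝ}
    (hu : ∀ X ∈ E, X ⊆ V ∧ X.card = 1) (hp0 : 0 < p) (hε0 : 0 < ε) (hF0 : 0 < F)
    (hE : 0 < E.card) (hV : 0 < V.card) (hK : 2 / ε ≤ K) (hg : g ≤ 1 - ε / 2)
    (hdense : ∀ U ⊆ V, g * (V.card : ℝ) ≤ U.card →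
      F * (E.card : ℝ) ≤ (((E.filter (fun X => X ⊆ U)).card : ℕ) : ℝ)) :
    ∑ X ∈ E, (∑ Y ∈ E, if Disjoint X Y then 0 else p ^ (X ∪ Y).card) ≤
      K * p ^ (2 * 1 - 1) * (E.card : ℝ) ^ 2 / V.card := by
  have hN : (0:ℝ) < V.card := by exact_mod_cast hV
  have he : (0:ℝ) < E.card := by exact_mod_cast hE
  have h1 : ∑ X ∈ E, (∑ Y ∈ E, if Disjoint X Y then 0 else p ^ (X ∪ Y).card) ≤ E.card * p := by
    rw [← nsmul_eq_mul, ← Finset.sum_const]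
    refine Finset.sum_le_sum fun X hX => ?_
    refine le_of_eq ?_
    obtain ⟨x, rfl⟩ := Finset.card_eq_one.1 (hu X hX).2
    rw [Finset.sum_eq_single_of_mem _ hX]
    · simp
    · intro Y hY hne
      obtain ⟨y, rfl⟩ := Finset.card_eq_one.1 (hu Y hY).2
      rw [if_pos]
      rw [Finset.disjoint_singleton]
      rintro rfl
      exact hne rfl
  have h2 : ε / 2 * V.card ≤ E.card := by
    by_contra hcon
    push Not at hcon
    have c1 : (E.biUnion id).card ≤ E.card * 1 :=
      Finset.card_biUnion_le_card_mul _ _ _ fun X hX => (hu X hX).2.le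
    have c2 := Finset.le_card_sdiff (E.biUnion id) V
    have c3 : (V.card : ℝ) ≤ (V \ E.biUnion id).card + E.card := by
      have : V.card ≤ (V \ E.biUnion id).card + E.card := by omega
      exact_mod_cast this
    have c4 := hdense (V \ E.biUnion id) Finset.sdiff_subset (by nlinarith)
    have c5 : E.filter (fun X => X ⊆ V \ E.biUnion id) = ∅ := by
      refine Finset.filter_eq_empty_iff.2 fun X hX hs => ?_
      obtain ⟨x, rfl⟩ := Finset.card_eq_one.1 (hu X hX).2
      have := Finset.mem_sdiff.1 (hs (Finset.mem_singleton_self x))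
      exact this.2 (Finset.mem_biUnion.2 ⟨{x}, hX, Finset.mem_singleton_self x⟩)
    rw [c5, Finset.card_empty, Nat.cast_zero] at c4
    have : 0 < F * E.card := by positivity
    linarith
  refine h1.trans ?_
  rw [le_div_iff₀ hN]
  have h3 : (V.card : ℝ) ≤ K * E.card := by
    have a1 := mul_le_mul_of_nonneg_right hK he.le
    have a2 : (V.card : ℝ) ≤ 2 / ε * E.card := by
      rw [div_mul_eq_mul_div, le_div_iff₀ hε0]; linarith
    linarith
  have h4 := mul_le_mul_of_nonneg_left h3 (show 0 ≤ E.card * p by positivity)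
  norm_num
  linarith

end aux

/-- **Schacht's transference theorem.** -/
theorem schacht (k : ℕ) (hk : 1 ≤ k)
    (τ : ℕ → Type) [∀ n, DecidableEq (τ n)]
    (V : ∀ n : ℕ, Finset (τ n)) (Hedges : ∀ n : ℕ, Finset (Finset (τ n)))
    (huniform : ∀ n : ℕ, ∀ X ∈ Hedges n, X ⊆ V n ∧ X.card = k)
    (p : ℕ → ℝ) (hp : ∀ n, 0 < p n ∧ p n ≤ 1)
    (v e : ℕ → ℕ) (hv : ∀ n, 0 < v n) (he : ∀ n, 0 < e n)
    (hpv : Filter.Tendsto (fun n : ℕ => p n * (v n : ℝ)) Filter.atTop Filter.atTop)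
    (hpe : Filter.Tendsto (fun n : ℕ => (p n) ^ k * (e n : ℝ)) Filter.atTop Filter.atTop)
    (α : ℝ) (hα : 0 ≤ α) (K : ℝ) (hK : 1 ≤ K)
    (f : ℝ → ℝ) (hfmono : ∀ x y : ℝ, 0 < x → x ≤ y → y < 1 → f x ≤ f y)
    (hf01 : ∀ x : ℝ, 0 < x → x < 1 → 0 < f x ∧ f x < 1)
    (ε : ℝ) (hε : 0 < ε ∧ ε < 1) :
    ∃ ε₀ : ℝ, (0 < ε₀ ∧ ε₀ < 1) ∧ ∃ b : ℝ, 0 < b ∧ ∃ C : ℝ, 1 ≤ C ∧ ∃ n₀ : ℕ, 1 ≤ n₀ ∧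
      ∀ n : ℕ, n₀ ≤ n → ∀ q : ℝ, C * p n ≤ q → q ≤ (n : ℝ) ^ (-(1 : ℝ) / 3) →
        HyperDense (V n) (Hedges n) α f ε₀ →
        HyperBounded (V n) (Hedges n) k K (p n) →
        v n ≤ (V n).card → e n ≤ (Hedges n).card →
        1 - Real.exp (-(b * q * (v n : ℝ))) ≤
          subsetProbOn (V n) q (fun A =>
            ∀ W ⊆ A, (α + ε) * (A.card : ℝ) ≤ (W.card : ℝ) → ∃ X ∈ Hedges n, X ⊆ W) := by
  obtain ⟨hε0, hε1⟩ := hε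
  obtain ⟨hF0, hF1⟩ := hf01 (ε / 2) (by linarith) (by linarith)
  set F := f (ε / 2) with hF
  set K' := max K (2 / ε) with hK'
  have hK'1 : 1 ≤ K' := hK.trans (le_max_left _ _)
  have hK'0 : 0 < K' := by linarith
  set d := F ^ 2 / (16 * K') with hd
  have hd0 : 0 < d := by positivity
  set L := - Real.log (ε ^ 2 / 192) with hL
  have hL0 : 0 ≤ L := by
    rw [hL, neg_nonneg]
    exact Real.log_nonpos (by positivity) (by nlinarith)
  refine ⟨ε / 2, ⟨by linarith, by linarith⟩, ε ^ 2 / 32, by positivity,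
    max 2 (128 * L / (d * ε ^ 2)), le_trans (by norm_num) (le_max_left _ _), 1, le_rfl, ?_⟩
  intro n hn q hCq hqn hdense hbdd hvn hen
  obtain ⟨hp0, hp1⟩ := hp n
  have hq1 : q ≤ 1 := hqn.trans
    (Real.rpow_le_one_of_one_le_of_nonpos (by exact_mod_cast hn) (by norm_num))
  have hpq : 2 * p n ≤ q := (mul_le_mul_of_nonneg_right (le_max_left _ _) hp0.le).trans hCq
  have hpq2 : 128 * L / (d * ε ^ 2) * p n ≤ q :=
    (mul_le_mul_of_nonneg_right (le_max_right _ _) hp0.le).trans hCq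
  have hq0 : 0 < q := by linarith
  have hVpos : 0 < (V n).card := (hv n).trans_le hvn
  have hEpos : 0 < (Hedges n).card := (he n).trans_le hen
  have hN : (0:ℝ) < (V n).card := by exact_mod_cast hVpos
  have hmono : 1 - Real.exp (-(ε ^ 2 / 32 * q * (v n : ℝ))) ≤
      1 - Real.exp (-(ε ^ 2 / 32 * q * ((V n).card : ℝ))) := by
    have h1 : (v n : ℝ) ≤ (V n).card := by exact_mod_cast hvn
    have h2 := mul_le_mul_of_nonneg_left h1 (show 0 ≤ ε ^ 2 / 32 * q by positivity)
    have := Real.exp_le_exp.2 (neg_le_neg h2)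
    linarith
  refine hmono.trans ?_
  by_cases hβ : α + ε ≤ 1
  · have hD' : ∀ U ⊆ V n, (α + ε / 2) * ((V n).card : ℝ) ≤ U.card →
        F * ((Hedges n).card : ℝ) ≤ ((((Hedges n).filter (fun X => X ⊆ U)).card : ℕ) : ℝ) := by
      intro U hU hc
      have := hdense (ε / 2) le_rfl (by linarith) U hU hc
      convert this
    have hmom : ∑ X ∈ Hedges n, (∑ Y ∈ Hedges n, if Disjoint X Y then 0 else p n ^ (X ∪ Y).card) ≤
        K' * p n ^ (2 * k - 1) * ((Hedges n).card : ℝ) ^ 2 / (V n).card := by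
      rcases Nat.lt_or_ge 1 k with hk2 | hk1
      · have h1 := second_moment (V n) (Hedges n) k K (p n) hk2 (huniform n) hp0 hp1 hbdd
        have h2 : K * p n ^ (2 * k - 1) * ((Hedges n).card : ℝ) ^ 2 / (V n).card ≤
          K' * p n ^ (2 * k - 1) * ((Hedges n).card : ℝ) ^ 2 / (V n).card := by
          have : K ≤ K' := le_max_left _ _
          gcongr
        refine le_trans (le_of_eq ?_) (h1.trans h2)
        refine Finset.sum_congr rfl fun X _ => Finset.sum_congr rfl fun Y _ => ?_
        congr
        exact Subsingleton.elim _ _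
      · obtain rfl : k = 1 := le_antisymm hk1 hk
        exact moment_one (V n) (Hedges n) (huniform n) hp0 hε0 hF0 hEpos hVpos (le_max_right _ _)
          (by linarith : α + ε / 2 ≤ 1 - ε / 2) hD'
    obtain ⟨c, hc⟩ := small_containers (V n) (Hedges n) k K' (p n) F (α + ε / 2) hk (huniform n)
      hp0 (by linarith) hK'1 hF0 hF1 hVpos hEpos
      (by
        refine le_trans (le_of_eq ?_) hmom
        refine Finset.sum_congr rfl fun X _ => Finset.sum_congr rfl fun Y _ => ?_
        congr
        exact Subsingleton.elim _ _)
      (by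
        intro U hU hcU
        convert hD' U hU hcU)
    refine union_bound (V n) (Hedges n) hq0 hq1 hε0 hε1 rfl (g := α + ε / 2) (by ring)
      (by linarith) hβ hL rfl c (fun W hW hi => ?_)
    obtain ⟨T, h1, h2, h3, h4, h5⟩ := hc W hW hi
    refine ⟨T, h1, ?_, h3, h4, ?_⟩
    · convert h2
    · rw [← hd] at h5
      have h6 : 128 * L * p n ≤ q * (d * ε ^ 2) := by
        have : 0 < d * ε ^ 2 := by positivity
        rw [div_mul_eq_mul_div, div_le_iff₀ this] at hpq2
        exact hpq2
      have h7 : d * (L * T.card) ≤ d * (q * (V n).card * ε ^ 2 / 64) := by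
        have h8 := mul_le_mul_of_nonneg_left h5 hL0
        have h9 := mul_le_mul_of_nonneg_right h6 hN.le
        nlinarith
      exact le_of_mul_le_mul_left h7 hd0
  · push Not at hβ
    refine le_trans ?_ (empty_bound (V n) (Hedges n) hq0.le hq1 hβ)
    have : -(q * (V n).card) ≤ -(ε ^ 2 / 32 * q * (V n).card) := by
      have : ε ^ 2 / 32 ≤ 1 := by nlinarith
      have := mul_le_mul_of_nonneg_right this (show 0 ≤ q * (V n).card by positivity)
      linarith
    have := Real.exp_le_exp.2 this
    linarith
end
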